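/- arXiv:1610.07295 — 3 statements merged into one kernel-verified Lean document; each statement's English description precedes it below -/
import Mathlib

section
/- Let U ⊆ ℂⁿ be open, f : U → ℂ holomorphic, and x ∈ U with f(x) = 0 and with the germ of f at x nonzero. Then for every real α ≥ 0 one has the equality of ideals of the local ring of holomorphic germs at x: 𝒥(f^{α+1})_x = f·𝒥(f^α)_x. Explicitly: a holomorphic germ g at x satisfies the multiplier condition for (f, α+1) at x if and only if there is a holomorphic germ h at x satisfying the multiplier condition for (f, α) at x with g = f·h. -/
open MeasureTheory Filter Topology

noncomputable section

variable {E : Type*} [NormedAddCommGroup E] [NormedSpace ℂ E] [MeasureSpace E]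

/-- `g` is holomorphic on some open neighborhood of `x`. -/
def HolNear (g : E → ℂ) (x : E) : Prop :=
  ∃ W : Set E, IsOpen W ∧ x ∈ W ∧ DifferentiableOn ℂ g W

/-- `g` satisfies the multiplier condition for `(f, α)` at `x`, where `U` is the domain of the
holomorphic function `f`: on some open neighborhood `V ∋ x` contained in the domains of `f` and
`g`, the function `|g|²/|f|^{2α}` is Lebesgue integrable. -/
def MultCond (f : E → ℂ) (U : Set E) (g : E → ℂ) (x : E) (α : ℝ) : Prop :=
  ∃ V : Set E, IsOpen V ∧ x ∈ V ∧ V ⊆ U ∧ DifferentiableOn ℂ g V ∧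
    IntegrableOn (fun y => ‖g y‖ ^ 2 / ‖f y‖ ^ (2 * α)) V volume

/-- `α` is a jumping coefficient of `f` at `x`. -/
def JumpCoeff (f : E → ℂ) (U : Set E) (x : E) (α : ℝ) : Prop :=
  ∃ g : E → ℂ, HolNear g x ∧ (∀ α' : ℝ, α' < α → MultCond f U g x α') ∧ ¬ MultCond f U g x α

/-- the log canonical threshold of `f` at `x`. -/
def Lct (f : E → ℂ) (U : Set E) (x : E) : ℝ :=
  sSup {α : ℝ | 0 ≤ α ∧ MultCond f U (fun _ => 1) x α}

open Metric Set Real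

/-- The locus where a continuous family of compact sets stays inside an open set is open. -/
theorem eventually_forall_add_smul_mem {F : Type*} [NormedAddCommGroup F] [NormedSpace ℂ F]
    {V : Set F} (hV : IsOpen V) {K : Set ℂ}
    (hK : IsCompact K) {x v : F} (h : ∀ ζ ∈ K, x + ζ • v ∈ V) :
    ∀ᶠ z in 𝓝 x, ∀ ζ ∈ K, z + ζ • v ∈ V := by
  refine hK.eventually_forall_of_forall_eventually fun ζ hζ => ?_
  have hc : Continuous fun p : F × ℂ => p.1 + p.2 • v := by fun_prop
  exact hc.continuousAt.eventually (hV.mem_nhds (h ζ hζ))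

/-- Averages over translates of a circle of a holomorphic function depend holomorphically on the
translation. -/
theorem differentiableAt_circleAverage_add_smul [FiniteDimensional ℂ E] [BorelSpace E]
    {q : E → ℂ} {Ω : Set E} (hΩ : IsOpen Ω) (hq : DifferentiableOn ℂ q Ω) {x v : E} {r : ℝ}
    (hr : 0 ≤ r) (h : ∀ ζ ∈ sphere (0 : ℂ) r, x + ζ • v ∈ Ω) :
    DifferentiableAt ℂ (fun z => circleAverage (fun ζ => q (z + ζ • v)) 0 r) x := by
  have := FiniteDimensional.proper ℂ E
  set γ : ℝ → E := fun θ => circleMap 0 r θ • v with hγ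
  have hγc : Continuous γ := by fun_prop
  set K : Set E := (fun ζ : ℂ => x + ζ • v) '' sphere (0 : ℂ) r with hK
  have hKc : IsCompact K := (isCompact_sphere 0 r).image (by fun_prop)
  have hγK (θ : ℝ) : x + γ θ ∈ K := ⟨circleMap 0 r θ, circleMap_mem_sphere 0 hr θ, rfl⟩
  have hKΩ : K ⊆ Ω := by
    rintro _ ⟨ζ, hζ, rfl⟩
    exact h ζ hζ
  obtain ⟨δ, hδ, hδΩ⟩ := hKc.exists_cthickening_subset_open hΩ hKΩ
  obtain ⟨M, hM⟩ := (hKc.cthickening (r := δ)).exists_bound_of_continuousOn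
    (hq.continuousOn.mono hδΩ)
  have hnear {z : E} (hz : z ∈ ball x (δ / 2)) (θ : ℝ) :
      ball (z + γ θ) (δ / 2) ⊆ cthickening δ K := by
    intro w hw
    refine mem_cthickening_of_dist_le w (x + γ θ) δ K (hγK θ) ?_
    have h1 : dist (z + γ θ) (x + γ θ) = dist z x := dist_add_right _ _ _
    have h2 := dist_triangle w (z + γ θ) (x + γ θ)
    rw [mem_ball] at hw hz
    linarith
  have hmem {z : E} (hz : z ∈ ball x (δ / 2)) (θ : ℝ) : z + γ θ ∈ cthickening δ K :=
    hnear hz θ (mem_ball_self (by positivity))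
  have hcont {z : E} (hz : z ∈ ball x (δ / 2)) : Continuous fun θ => q (z + γ θ) :=
    hq.continuousOn.comp_continuous (by fun_prop) fun θ => hδΩ (hmem hz θ)
  have hx : x ∈ ball x (δ / 2) := mem_ball_self (by positivity)
  have key := intervalIntegral.hasFDerivAt_integral_of_dominated_of_fderiv_le (𝕜 := ℂ)
    (μ := volume) (a := 0) (b := 2 * π) (F := fun z θ => q (z + γ θ))
    (F' := fun z θ => fderiv ℂ q (z + γ θ)) (x₀ := x) (bound := fun _ => (2 * M) / (δ / 2))
    (ball_mem_nhds x (half_pos hδ)) ?_ ((hcont hx).intervalIntegrable _ _) ?_ ?_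
    intervalIntegrable_const ?_
  · exact key.differentiableAt.const_smul ((2 * π)⁻¹ : ℝ)
  · filter_upwards [ball_mem_nhds x (half_pos hδ)] with z hz
    exact (hcont hz).aestronglyMeasurable
  · exact ((measurable_fderiv ℂ q).comp
      (by fun_prop : Measurable fun θ => x + γ θ)).aestronglyMeasurable
  · refine Eventually.of_forall fun θ _ z hz => ?_
    refine Complex.norm_fderiv_le_div_of_mapsTo_ball
      (hq.mono ((hnear hz θ).trans hδΩ)) (fun w hw => ?_) (half_pos hδ)
    rw [mem_closedBall, dist_eq_norm]
    have h1 := hM _ (hnear hz θ hw)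
    have h2 := hM _ (hmem hz θ)
    linarith [norm_sub_le (q w) (q (z + γ θ))]
  · refine Eventually.of_forall fun θ _ z hz => ?_
    have h1 : HasFDerivAt q (fderiv ℂ q (z + γ θ)) (z + γ θ) :=
      (hq.differentiableAt (hΩ.mem_nhds (hδΩ (hmem hz θ)))).hasFDerivAt
    exact (hasFDerivAt_comp_add_right (γ θ)).2 h1

/-- An integrable function on a vector space restricts to an integrable function on almost every
translate of a disc in a complex line. -/
theorem ae_integrableOn_add_smul [FiniteDimensional ℂ E] [BorelSpace E]
    [(volume : Measure E).IsAddHaarMeasure] {G : E → ℝ} (hG : Integrable G) (v : E) (r : ℝ) :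
    ∀ᵐ z : E, IntegrableOn (fun ζ : ℂ => G (z + ζ • v)) (closedBall 0 r) := by
  have := FiniteDimensional.proper ℂ E
  set ν : Measure ℂ := volume.restrict (closedBall 0 r) with hν
  have : IsFiniteMeasure ν := ⟨by
    rw [hν, Measure.restrict_apply_univ]
    exact measure_closedBall_lt_top⟩
  have hmp : MeasurePreserving (fun p : ℂ × E => (p.1, p.2 + p.1 • v))
      (ν.prod volume) (ν.prod volume) :=
    (MeasurePreserving.id ν).skew_product (g := fun ζ z => z + ζ • v)
      (by fun_prop) (Eventually.of_forall fun ζ => map_add_right_eq_self _ _)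
  have hG2 : Integrable (fun p : ℂ × E => G p.2) (ν.prod volume) := hG.comp_snd ν
  exact ((hmp.integrable_comp hG2.aestronglyMeasurable).2 hG2).prod_left_ae

theorem not_integrableOn_ball_norm_inv_sq {c : ℂ} {ε : ℝ} (hε : 0 < ε) :
    ¬ IntegrableOn (fun z : ℂ => (‖z - c‖ ^ 2)⁻¹) (ball c ε) := by
  intro h
  have h0 : IntegrableOn (fun z : ℂ => (‖z‖ ^ 2)⁻¹) (ball 0 ε) := by
    have := (measurePreserving_add_right (volume : Measure ℂ) c).integrableOn_comp_preimage
      (Homeomorph.addRight c).measurableEmbedding (f := fun z : ℂ => (‖z - c‖ ^ 2)⁻¹)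
      (s := ball c ε) |>.2 h
    refine (this.congr_set_ae (Eventually.of_forall fun z => ?_)).congr_fun
      (fun z _ => by simp) measurableSet_ball
    simp [ball, dist_eq_norm]
  rw [← integrable_indicator_iff measurableSet_ball] at h0
  have h1 : Integrable (fun z : ℂ => (Iio ε).indicator (fun y : ℝ => (y ^ 2)⁻¹) ‖z‖) := by
    refine h0.congr (Eventually.of_forall fun z => ?_)
    simp [indicator]
  rw [integrable_fun_norm_addHaar, Complex.finrank_real_complex] at h1
  have h2 : IntegrableOn (fun y : ℝ => y⁻¹) (Ioo 0 ε) := by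
    refine (h1.mono_set Ioo_subset_Ioi_self).congr_fun (fun y hy => ?_) measurableSet_Ioo
    have : y ≠ 0 := hy.1.ne'
    simp [indicator, hy.2]
    field_simp
  have h3 : IntervalIntegrable (fun y : ℝ => y⁻¹) volume 0 ε :=
    (intervalIntegrable_iff_integrableOn_Ioo_of_le hε.le).2 h2
  rw [intervalIntegrable_inv_iff] at h3
  rcases h3 with h3 | h3
  · exact hε.ne h3
  · exact h3 left_mem_uIcc

/-- A square-integrable meromorphic function has no pole. -/
theorem MeromorphicAt.meromorphicOrderAt_nonneg_of_integrableOn {φ : ℂ → ℂ} {c : ℂ} {s : Set ℂ}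
    (hφ : MeromorphicAt φ c) (hs : s ∈ 𝓝 c) (hint : IntegrableOn (fun z => ‖φ z‖ ^ 2) s) :
    0 ≤ meromorphicOrderAt φ c := by
  by_contra! hneg
  obtain ⟨n, hn⟩ := WithTop.ne_top_iff_exists.1 hneg.ne_top
  rw [← hn] at hneg
  have hn0 : n < 0 := by exact_mod_cast hneg
  obtain ⟨ψ, hψ, hψc, hev⟩ := (meromorphicOrderAt_eq_int_iff hφ).1 hn.symm
  have hψpos : 0 < ‖ψ c‖ := norm_pos_iff.2 hψc
  have hψev : ∀ᶠ z in 𝓝 c, ‖ψ c‖ / 2 < ‖ψ z‖ :=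
    hψ.continuousAt.norm.eventually (lt_mem_nhds (half_lt_self hψpos))
  obtain ⟨ε, hε, hball⟩ := Metric.eventually_nhds_iff_ball.1
    ((eventually_nhdsWithin_iff.1 hev).and (hψev.and (inter_mem (ball_mem_nhds c one_pos) hs)))
  refine not_integrableOn_ball_norm_inv_sq (c := c) hε ?_
  have hint' : IntegrableOn (fun z => (‖ψ c‖ / 2)⁻¹ ^ 2 * ‖φ z‖ ^ 2) (ball c ε) :=
    (hint.mono_set fun z hz => (hball z hz).2.2.2).const_mul _
  refine hint'.mono' (by fun_prop) ?_
  filter_upwards [ae_restrict_mem measurableSet_ball] with z hz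
  obtain ⟨h1, h2, h3, -⟩ := hball z hz
  rw [norm_of_nonneg (by positivity), ← mul_pow, ← inv_pow]
  rcases eq_or_ne z c with rfl | hzc
  · rw [sub_self, norm_zero, inv_zero, zero_pow two_ne_zero]
    positivity
  have hd : 0 < ‖z - c‖ := norm_pos_iff.2 (sub_ne_zero.2 hzc)
  have hd1 : ‖z - c‖ ≤ 1 := by
    rw [mem_ball, dist_eq_norm] at h3
    exact h3.le
  gcongr
  rw [h1 hzc, norm_smul, norm_zpow]
  have h4 : ‖z - c‖⁻¹ ≤ ‖z - c‖ ^ n := by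
    rw [← zpow_neg_one]
    exact zpow_le_zpow_right_of_le_one₀ hd hd1 (by omega)
  calc ‖z - c‖⁻¹ ≤ ‖z - c‖ ^ n := h4
    _ = (‖ψ c‖ / 2)⁻¹ * (‖z - c‖ ^ n * (‖ψ c‖ / 2)) := by field_simp
    _ ≤ (‖ψ c‖ / 2)⁻¹ * (‖z - c‖ ^ n * ‖ψ z‖) := by gcongr

/-- The mean value property for a square-integrable quotient of holomorphic functions on a disc. -/
theorem eq_mul_circleAverage_div {f g : ℂ → ℂ} {r : ℝ} (hr : 0 < r)
    (hf : AnalyticOnNhd ℂ f (closedBall 0 r)) (hg : AnalyticOnNhd ℂ g (closedBall 0 r))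
    (hfr : ∀ ζ ∈ sphere (0 : ℂ) r, f ζ ≠ 0)
    (hint : IntegrableOn (fun ζ => ‖g ζ / f ζ‖ ^ 2) (closedBall 0 r)) :
    g 0 = f 0 * circleAverage (fun ζ => g ζ / f ζ) 0 r := by
  set φ : ℂ → ℂ := fun ζ => g ζ / f ζ with hφ
  have hmer : MeromorphicOn φ (closedBall 0 r) := fun z hz =>
    (hg z hz).meromorphicAt.fun_div (hf z hz).meromorphicAt
  have hsph {z : ℂ} (hz : z ∈ sphere (0 : ℂ) r) : AnalyticAt ℂ φ z :=
    (hg z (sphere_subset_closedBall hz)).fun_div (hf z (sphere_subset_closedBall hz)) (hfr z hz)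
  have hord {z : ℂ} (hz : z ∈ closedBall (0 : ℂ) r) : 0 ≤ meromorphicOrderAt φ z := by
    rcases (mem_closedBall.1 hz).lt_or_eq with h | h
    · exact (hmer z hz).meromorphicOrderAt_nonneg_of_integrableOn
        (mem_of_superset (isOpen_ball.mem_nhds h) ball_subset_closedBall) hint
    · exact (hsph h).meromorphicOrderAt_nonneg
  set N := toMeromorphicNFOn φ (closedBall 0 r) with hN
  have hNan {z : ℂ} (hz : z ∈ closedBall (0 : ℂ) r) : AnalyticAt ℂ N z := by
    rw [← (meromorphicNFOn_toMeromorphicNFOn φ _ hz).meromorphicOrderAt_nonneg_iff_analyticAt,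
      meromorphicOrderAt_toMeromorphicNFOn hmer hz]
    exact hord hz
  have hNsph {z : ℂ} (hz : z ∈ sphere (0 : ℂ) r) : N z = φ z := by
    rw [hN, toMeromorphicNFOn_eq_toMeromorphicNFAt hmer (sphere_subset_closedBall hz),
      toMeromorphicNFAt_eq_self.2 (hsph hz).meromorphicNFAt]
  have havg : circleAverage φ 0 r = N 0 := by
    rw [← circleAverage_congr_sphere (f₁ := N) (by
      rw [abs_of_pos hr]
      exact fun z hz => hNsph hz)]
    refine DiffContOnCl.circleAverage (DifferentiableOn.diffContOnCl fun z hz => ?_)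
    rw [abs_of_pos hr, closure_ball _ hr.ne'] at hz
    exact (hNan hz).differentiableAt.differentiableWithinAt
  rw [havg]
  have h0 : (0 : ℂ) ∈ closedBall (0 : ℂ) r := mem_closedBall_self hr.le
  have hfne : ∀ᶠ z in 𝓝[≠] (0 : ℂ), f z ≠ 0 := by
    refine (hf 0 h0).eventually_eq_zero_or_eventually_ne_zero.resolve_left fun hz => ?_
    have := hf.eqOn_zero_of_preconnected_of_eventuallyEq_zero
      (convex_closedBall 0 r).isPreconnected h0 hz
    have hrs : (r : ℂ) ∈ sphere (0 : ℂ) r := by simp [abs_of_pos hr]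
    exact hfr _ hrs (this (sphere_subset_closedBall hrs))
  have hev : g =ᶠ[𝓝[≠] 0] fun z => f z * N z := by
    filter_upwards [hfne, hmer.toMeromorphicNFOn_eq_self_on_nhdsNE h0] with z hz1 hz2
    rw [hN, hz2, hφ, mul_div_cancel₀ _ hz1]
  exact ((hg 0 h0).continuousAt.eventuallyEq_nhds_iff_eventuallyEq_nhdsNE
    ((hf 0 h0).continuousAt.mul (hNan h0).continuousAt)).1 hev |>.eq_of_nhds

/-- A nonzero holomorphic germ does not vanish on some small circle around the base point. -/
theorem exists_forall_sphere_ne_zero {F : Type*} [NormedAddCommGroup F] [NormedSpace ℂ F]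
    {f : F → ℂ} {V : Set F} (hV : IsOpen V)
    (hf : DifferentiableOn ℂ f V) {x : F} (hx : x ∈ V) (hne : ¬ (f =ᶠ[𝓝 x] 0)) :
    ∃ (v : F) (r : ℝ), 0 < r ∧ (∀ ζ ∈ closedBall (0 : ℂ) r, x + ζ • v ∈ V) ∧
      ∀ ζ ∈ sphere (0 : ℂ) r, f (x + ζ • v) ≠ 0 := by
  obtain ⟨ε, hε, hball⟩ := Metric.isOpen_iff.1 hV x hx
  obtain ⟨y, hy, hfy⟩ : ∃ y ∈ ball x ε, f y ≠ 0 := by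
    by_contra! hcon
    exact hne (mem_of_superset (ball_mem_nhds x hε) hcon)
  set v := y - x with hv
  set ℓ : ℂ →ᵃ[ℝ] F := ((LinearMap.toSpanSingleton ℂ F v).restrictScalars ℝ).toAffineMap +
    AffineMap.const ℝ ℂ x with hℓ
  have hℓ' (ζ : ℂ) : ℓ ζ = x + ζ • v := by simp [hℓ, add_comm]
  set D : Set ℂ := (fun ζ : ℂ => x + ζ • v) ⁻¹' ball x ε with hD
  have hDo : IsOpen D := isOpen_ball.preimage (by fun_prop)
  have hDc : Convex ℝ D := by
    have := (convex_ball x ε).affine_preimage ℓ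
    rwa [funext hℓ'] at this
  have hD0 : (0 : ℂ) ∈ D := by simp [hD, hε]
  have hD1 : (1 : ℂ) ∈ D := by simpa [hD, hv] using hy
  have han : AnalyticOnNhd ℂ (fun ζ : ℂ => f (x + ζ • v)) D :=
    DifferentiableOn.analyticOnNhd (hf.comp (by fun_prop) fun ζ hζ => hball hζ) hDo
  have hne0 : ∀ᶠ ζ in 𝓝[≠] (0 : ℂ), f (x + ζ • v) ≠ 0 := by
    refine (han 0 hD0).eventually_eq_zero_or_eventually_ne_zero.resolve_left fun hz => hfy ?_
    simpa [hv] using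
      han.eqOn_zero_of_preconnected_of_eventuallyEq_zero hDc.isPreconnected hD0 hz hD1
  obtain ⟨R, hR, hRball⟩ := Metric.eventually_nhds_iff_ball.1
    ((eventually_nhdsWithin_iff.1 hne0).and (hDo.mem_nhds hD0))
  have hsub : closedBall (0 : ℂ) (R / 2) ⊆ ball 0 R := closedBall_subset_ball (half_lt_self hR)
  refine ⟨v, R / 2, half_pos hR, fun ζ hζ => hball (hRball ζ (hsub hζ)).2, fun ζ hζ => ?_⟩
  exact (hRball ζ (hsub (sphere_subset_closedBall hζ))).1
    (ne_of_mem_sphere hζ (half_pos hR).ne')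

/-- A quotient of holomorphic germs that is locally square-integrable is holomorphic. -/
theorem exists_holomorphic_quotient [FiniteDimensional ℂ E] [BorelSpace E]
    [(volume : Measure E).IsAddHaarMeasure] {f g : E → ℂ} {V : Set E} (hV : IsOpen V)
    (hf : DifferentiableOn ℂ f V) (hg : DifferentiableOn ℂ g V) {x : E} (hx : x ∈ V)
    (hne : ¬ (f =ᶠ[𝓝 x] 0)) (hint : IntegrableOn (fun y => ‖g y / f y‖ ^ 2) V) :
    ∃ (h : E → ℂ) (W : Set E), IsOpen W ∧ x ∈ W ∧ W ⊆ V ∧ DifferentiableOn ℂ h W ∧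
      ∀ y ∈ W, g y = f y * h y := by
  obtain ⟨v, r, hr, hdisc, hsph⟩ := exists_forall_sphere_ne_zero hV hf hx hne
  set Ω : Set E := V ∩ f ⁻¹' {0}ᶜ with hΩ
  have hΩo : IsOpen Ω := hf.continuousOn.isOpen_inter_preimage hV isOpen_compl_singleton
  have hq : DifferentiableOn ℂ (fun y => g y / f y) Ω := by
    simp only [div_eq_mul_inv]
    exact (hg.mono inter_subset_left).fun_mul
      ((hf.mono inter_subset_left).fun_inv fun y hy => hy.2)
  obtain ⟨W, hW, hWo, hxW⟩ := _root_.mem_nhds_iff.1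
    ((eventually_forall_add_smul_mem hV (isCompact_closedBall 0 r) hdisc).and
      (eventually_forall_add_smul_mem hΩo (isCompact_sphere 0 r) fun ζ hζ =>
        ⟨hdisc ζ (sphere_subset_closedBall hζ), hsph ζ hζ⟩))
  have hWV : W ⊆ V := fun z hz => by simpa using (hW hz).1 0 (mem_closedBall_self hr.le)
  set h : E → ℂ := fun z => circleAverage (fun ζ => g (z + ζ • v) / f (z + ζ • v)) 0 r with hh
  have hhd : DifferentiableOn ℂ h W := fun z hz =>
    (differentiableAt_circleAverage_add_smul hΩo hq hr.le (hW hz).2).differentiableWithinAt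
  refine ⟨h, W, hWo, hxW, hWV, hhd, ?_⟩
  refine Measure.eqOn_open_of_ae_eq (μ := volume) ?_ hWo (hg.continuousOn.mono hWV)
    ((hf.continuousOn.mono hWV).mul hhd.continuousOn)
  rw [EventuallyEq, ae_restrict_iff' hWo.measurableSet]
  filter_upwards [ae_integrableOn_add_smul
    ((integrable_indicator_iff hV.measurableSet).2 hint) v r] with z hz hzW
  have hline {u : E → ℂ} (hu : DifferentiableOn ℂ u V) :
      AnalyticOnNhd ℂ (fun ζ : ℂ => u (z + ζ • v)) (closedBall 0 r) := by
    have hVo : IsOpen ((fun ζ : ℂ => z + ζ • v) ⁻¹' V) := hV.preimage (by fun_prop)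
    exact (DifferentiableOn.analyticOnNhd (hu.comp (by fun_prop) fun ζ hζ => hζ) hVo).mono
      (hW hzW).1
  have := eq_mul_circleAverage_div hr (hline hf) (hline hg) (fun ζ hζ => ((hW hzW).2 ζ hζ).2)
    (hz.congr_fun (fun ζ hζ => indicator_of_mem ((hW hzW).1 ζ hζ) _) measurableSet_closedBall)
  simpa using this

theorem norm_mul_sq_div_rpow {a b c : ℂ} (ha : a ≠ 0) (hb : b = a * c) (α : ℝ) :
    ‖b‖ ^ 2 / ‖a‖ ^ (2 * (α + 1)) = ‖c‖ ^ 2 / ‖a‖ ^ (2 * α) := by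
  have hpos : 0 < ‖a‖ := norm_pos_iff.2 ha
  have : ‖a‖ ^ (2 * (α + 1)) = ‖a‖ ^ (2 * α) * ‖a‖ ^ 2 := by
    rw [mul_add, mul_one, rpow_add hpos, rpow_two]
  rw [hb, norm_mul, this]
  field_simp

/-- Germ-level version of (2.1.2): `𝒥(f^{α+1})_x = f · 𝒥(f^α)_x` for `α ≥ 0`. -/
theorem multiplier_ideal_shift_one
    {n : ℕ} (hn : 1 ≤ n)
    (U : Set (Fin n → ℂ)) (hU : IsOpen U)
    (f : (Fin n → ℂ) → ℂ) (hf : DifferentiableOn ℂ f U)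
    (x : Fin n → ℂ) (hx : x ∈ U) (hf0 : f x = 0) (hne : ¬ (f =ᶠ[𝓝 x] 0))
    (α : ℝ) (hα : 0 ≤ α)
    (g : (Fin n → ℂ) → ℂ) (hg : HolNear g x) :
    MultCond f U g x (α + 1) ↔
      ∃ h : (Fin n → ℂ) → ℂ, HolNear h x ∧ MultCond f U h x α ∧
        g =ᶠ[𝓝 x] fun y => f y * h y := by
  constructor
  · rintro ⟨V, hVo, hxV, hVU, hgV, hint⟩
    have hα1 : 0 ≤ 2 * α := by positivity
    have hfx : ContinuousAt f x := hf.continuousOn.continuousAt (hU.mem_nhds hx)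
    obtain ⟨ε, hε, hball⟩ := Metric.eventually_nhds_iff_ball.1
      ((hfx.norm.eventually (gt_mem_nhds (by simp [hf0] : ‖f x‖ < 1))).and (hVo.mem_nhds hxV))
    have hsub : ball x ε ⊆ V := fun y hy => (hball y hy).2
    have hsubU := hsub.trans hVU
    have hq : IntegrableOn (fun y => ‖g y / f y‖ ^ 2) (ball x ε) := by
      refine (hint.mono_set hsub).mono' ?_ ?_
      · refine AEMeasurable.aestronglyMeasurable ?_
        exact ((((hgV.mono hsub).continuousOn.aemeasurable measurableSet_ball).div
          ((hf.mono hsubU).continuousOn.aemeasurable measurableSet_ball)).norm).pow_const 2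
      · filter_upwards [ae_restrict_mem measurableSet_ball] with y hy
        rw [norm_of_nonneg (by positivity), norm_div, div_pow]
        rcases eq_or_ne (f y) 0 with hy0 | hy0
        · rw [hy0, norm_zero, zero_pow two_ne_zero, div_zero]
          positivity
        have hpos : 0 < ‖f y‖ := norm_pos_iff.2 hy0
        gcongr
        rw [← rpow_two]
        exact rpow_le_rpow_of_exponent_ge hpos (hball y hy).1.le (by linarith)
    obtain ⟨h, W, hWo, hxW, hWV, hhd, heq⟩ := exists_holomorphic_quotient isOpen_ball
      (hf.mono hsubU) (hgV.mono hsub) (mem_ball_self hε) hne hq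
    refine ⟨h, ⟨W, hWo, hxW, hhd⟩, ?_, mem_of_superset (hWo.mem_nhds hxW) heq⟩
    rcases hα.eq_or_lt with rfl | hα0
    · obtain ⟨δ, hδ, hδW⟩ := Metric.nhds_basis_closedBall.mem_iff.1 (hWo.mem_nhds hxW)
      have hδb : ball x δ ⊆ W := ball_subset_closedBall.trans hδW
      refine ⟨ball x δ, isOpen_ball, mem_ball_self hδ, (hδb.trans hWV).trans hsubU,
        hhd.mono hδb, IntegrableOn.mono_set ?_ ball_subset_closedBall⟩
      simp only [mul_zero, rpow_zero, div_one]
      exact ((hhd.continuousOn.mono hδW).norm.pow 2).integrableOn_compact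
        (isCompact_closedBall x δ)
    · refine ⟨W, hWo, hxW, hWV.trans hsubU, hhd, ?_⟩
      refine (hint.mono_set (hWV.trans hsub)).congr_fun (fun y hy => ?_) hWo.measurableSet
      have hα2 : 2 * α ≠ 0 := by positivity
      have hα3 : 2 * (α + 1) ≠ 0 := by positivity
      rcases eq_or_ne (f y) 0 with hy0 | hy0
      · simp [hy0, zero_rpow hα2, zero_rpow hα3]
      · exact norm_mul_sq_div_rpow hy0 (heq y hy) α
  · rintro ⟨h, -, ⟨V, hVo, hxV, hVU, hhV, hint⟩, heq⟩
    obtain ⟨W, hW, hWo, hxW⟩ := _root_.mem_nhds_iff.1 heq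
    have hsub : V ∩ W ⊆ V := inter_subset_left
    have hVWo : IsOpen (V ∩ W) := hVo.inter hWo
    have hgd : DifferentiableOn ℂ g (V ∩ W) :=
      ((hf.mono (hsub.trans hVU)).fun_mul (hhV.mono hsub)).congr fun y hy => hW hy.2
    refine ⟨V ∩ W, hVWo, ⟨hxV, hxW⟩, hsub.trans hVU, hgd, ?_⟩
    refine (hint.mono_set hsub).mono' ?_ ?_
    · refine AEMeasurable.aestronglyMeasurable ?_
      exact ((hgd.continuousOn.aemeasurable hVWo.measurableSet).norm.pow_const 2).div
        (((hf.mono (hsub.trans hVU)).continuousOn.aemeasurable hVWo.measurableSet).norm.pow_const _)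
    · filter_upwards [ae_restrict_mem hVWo.measurableSet] with y hy
      rw [norm_of_nonneg (by positivity)]
      rcases eq_or_ne (f y) 0 with hy0 | hy0
      · have hα3 : 2 * (α + 1) ≠ 0 := by positivity
        simp only [hy0, norm_zero, zero_rpow hα3, div_zero]
        positivity
      · exact (norm_mul_sq_div_rpow hy0 (hW hy.2) α).le
end
end

section
/- Let U ⊆ ℂⁿ be open, f : U → ℂ holomorphic, and x ∈ U with f(x) = 0 and with the germ of f at x nonzero. Then a holomorphic germ g at x satisfies the multiplier condition for (f, 1) at x (i.e., |g|²/|f|² is integrable on some neighborhood of x) if and only if f divides g in the local ring of holomorphic germs at x. In other words, 𝒥(f^1)_x is the principal ideal generated by the germ of f. -/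
open MeasureTheory Filter Topology

noncomputable section

variable {E : Type*} [NormedAddCommGroup E] [NormedSpace ℂ E] [MeasureSpace E]

open Metric Real in
/-- A function meromorphic at `c` and square integrable near `c` has no pole at `c`. -/
lemma meromorphicOrderAt_nonneg_of_integrableOn_norm_sq {q : ℂ → ℂ} {c : ℂ} {R : ℝ} (hR : 0 < R)
    (hq : MeromorphicAt q c) (hint : IntegrableOn (fun z => ‖q z‖ ^ 2) (ball c R) volume) :
    0 ≤ meromorphicOrderAt q c := by
  by_contra! hneg
  obtain ⟨k, hk⟩ := WithTop.ne_top_iff_exists.mp hneg.ne_top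
  have hk0 : k < 0 := by rw [← hk] at hneg; exact_mod_cast hneg
  obtain ⟨u, hu, hu0, hqu⟩ := (meromorphicOrderAt_eq_int_iff hq).mp hk.symm
  have hpos : 0 < ‖u c‖ := norm_pos_iff.mpr hu0
  have hbig : ∀ᶠ z in 𝓝 c, ‖u c‖ / 2 < ‖u z‖ :=
    hu.continuousAt.norm.eventually_const_lt (by linarith)
  obtain ⟨ε, hε, hball⟩ := Metric.eventually_nhds_iff_ball.mp
    ((eventually_nhdsWithin_iff.mp hqu).and hbig)
  set d := min (min ε R) 1
  have hd : 0 < d := by positivity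
  have hbound : ∀ z ∈ ball c d, ‖(‖z - c‖ ^ 2)⁻¹‖ ≤ ‖(4 / ‖u c‖ ^ 2) * ‖q z‖ ^ 2‖ := by
    intro z hz
    rcases eq_or_ne z c with rfl | hzc
    · simp only [sub_self, norm_zero]; norm_num; positivity
    have hz' : ‖z - c‖ < d := mem_ball_iff_norm.mp hz
    obtain ⟨h1, h2⟩ := hball z (mem_ball_iff_norm.mpr
      (hz'.trans_le ((min_le_left _ _).trans (min_le_left _ _))))
    have hn : 0 < ‖z - c‖ := norm_pos_iff.mpr (sub_ne_zero.mpr hzc)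
    have hle : ‖z - c‖⁻¹ ≤ ‖z - c‖ ^ k := by
      rw [← zpow_neg_one]
      exact zpow_le_zpow_right_of_le_one₀ hn (hz'.le.trans (min_le_right _ _)) (by omega)
    have hqz : ‖u c‖ / 2 * ‖z - c‖⁻¹ ≤ ‖q z‖ := by
      rw [h1 hzc, norm_smul, norm_zpow, mul_comm]
      gcongr
    have hsq := pow_le_pow_left₀ (by positivity) hqz 2
    rw [norm_of_nonneg (by positivity), norm_of_nonneg (by positivity)]
    calc (‖z - c‖ ^ 2)⁻¹ = 4 / ‖u c‖ ^ 2 * (‖u c‖ / 2 * ‖z - c‖⁻¹) ^ 2 := by field_simp; norm_num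
      _ ≤ _ := by gcongr
  have hint' : IntegrableOn (fun z : ℂ => (‖z - c‖ ^ 2)⁻¹) (ball c d) volume := by
    refine Integrable.mono ((hint.mono_set (ball_subset_ball
      ((min_le_left _ _).trans (min_le_right _ _)))).const_mul (4 / ‖u c‖ ^ 2)) ?_ ?_
    · exact Measurable.aestronglyMeasurable (by fun_prop)
    · exact (ae_restrict_iff' measurableSet_ball).mpr (.of_forall hbound)
  have hint0 : IntegrableOn (fun z : ℂ => (‖z‖ ^ 2)⁻¹) (ball 0 d) volume := by
    have := (measurePreserving_add_right (volume : Measure ℂ) c).integrableOn_comp_preimage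
      (measurableEmbedding_addRight c) (f := fun z : ℂ => (‖z - c‖ ^ 2)⁻¹) (s := ball c d)
    have h := this.mpr hint'
    rw [preimage_add_right_ball, sub_self] at h
    simpa [Function.comp_def] using h
  have h1 := (integrableOn_fun_norm_addHaar volume (f := fun t : ℝ => (t ^ 2)⁻¹)).mp hint0
  have h2 : IntervalIntegrable (fun t : ℝ => t⁻¹) volume 0 d := by
    rw [intervalIntegrable_iff_integrableOn_Ioo_of_le hd.le]
    refine h1.congr_fun (fun t ht => ?_) measurableSet_Ioo
    have := ht.1.ne'
    simp only [Complex.finrank_real_complex, smul_eq_mul, Nat.add_one_sub_one, pow_one]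
    field_simp
  rcases intervalIntegrable_inv_iff.mp h2 with h | h
  · exact hd.ne h
  · exact h Set.left_mem_uIcc

open Metric Real in
/-- If `G / F` is square integrable on a disc, then its mean over a concentric circle on which `F`
does not vanish is the value at the center of a holomorphic quotient of `G` by `F`. -/
lemma mul_circleAverage_div_eq {F G : ℂ → ℂ} {r R : ℝ} (hr : 0 < r) (hrR : r < R)
    (hF : DifferentiableOn ℂ F (ball 0 R)) (hG : DifferentiableOn ℂ G (ball 0 R))
    (hF0 : ∀ s ∈ sphere (0 : ℂ) r, F s ≠ 0)
    (hint : IntegrableOn (fun s => ‖G s‖ ^ 2 / ‖F s‖ ^ 2) (ball 0 R) volume) :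
    F 0 * circleAverage (fun s => G s / F s) 0 r = G 0 := by
  have hFa := hF.analyticOnNhd isOpen_ball
  have hGa := hG.analyticOnNhd isOpen_ball
  set q : ℂ → ℂ := fun s => G s / F s
  have hq : MeromorphicOn q (ball 0 R) := fun z hz =>
    (hGa z hz).meromorphicAt.div (hFa z hz).meromorphicAt
  set φ := toMeromorphicNFOn q (ball 0 R)
  have hφ : AnalyticOnNhd ℂ φ (ball 0 R) := by
    intro z hz
    rw [← (meromorphicNFOn_toMeromorphicNFOn q _ hz).meromorphicOrderAt_nonneg_iff_analyticAt,
      meromorphicOrderAt_toMeromorphicNFOn hq hz]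
    obtain ⟨ε, hε, hsub⟩ := Metric.isOpen_iff.mp isOpen_ball z hz
    refine meromorphicOrderAt_nonneg_of_integrableOn_norm_sq hε (hq z hz) ?_
    simpa only [q, norm_div, div_pow] using hint.mono_set hsub
  have hr_mem : (r : ℂ) ∈ sphere (0 : ℂ) r := by simp [abs_of_pos hr]
  have hsub : closedBall (0 : ℂ) r ⊆ ball 0 R := closedBall_subset_ball hrR
  have hne : ∀ z ∈ ball (0 : ℂ) R, ∀ᶠ w in 𝓝[≠] z, F w ≠ 0 := by
    intro z hz
    refine (hFa z hz).eventually_eq_zero_or_eventually_ne_zero.resolve_left fun h => ?_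
    exact hF0 r hr_mem (hFa.eqOn_zero_of_preconnected_of_eventuallyEq_zero
      (convex_ball _ _).isPreconnected hz h (hsub (sphere_subset_closedBall hr_mem)))
  have hmul : ∀ z ∈ ball (0 : ℂ) R, F z * φ z = G z := by
    intro z hz
    have hev : (fun w => F w * φ w) =ᶠ[𝓝[≠] z] G := by
      filter_upwards [hne z hz, hq.toMeromorphicNFOn_eq_self_on_nhdsNE hz] with w hw hw'
      exact (congrArg (F w * ·) hw').trans (mul_div_cancel₀ _ hw)
    exact (((hFa z hz).mul (hφ z hz)).continuousAt.eventuallyEq_nhds_iff_eventuallyEq_nhdsNE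
      (hGa z hz).continuousAt).mp hev |>.eq_of_nhds
  have havg : circleAverage q 0 r = circleAverage φ 0 r := by
    refine circleAverage_congr_sphere fun z hz => ?_
    rw [abs_of_pos hr] at hz
    rw [← mul_right_inj' (hF0 z hz), hmul z (hsub (sphere_subset_closedBall hz)),
      mul_div_cancel₀ _ (hF0 z hz)]
  rw [havg, DiffContOnCl.circleAverage, hmul 0 (mem_ball_self (hr.trans hrR))]
  rw [abs_of_pos hr]
  exact (hφ.differentiableOn.mono (closure_ball_subset_closedBall.trans hsub)).diffContOnCl

open Metric in
/-- Almost every slice in a direction `e` of an integrable function is integrable on discs. -/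
lemma ae_integrableOn_slice {n : ℕ} {K : (Fin n → ℂ) → ℝ} (hK : Integrable K volume)
    (e : Fin n → ℂ) (R : ℝ) :
    ∀ᵐ z : Fin n → ℂ, IntegrableOn (fun s : ℂ => K (z + s • e)) (ball 0 R) volume := by
  have hfin : IsFiniteMeasure ((volume : Measure ℂ).restrict (ball 0 R)) :=
    ⟨by simpa using measure_ball_lt_top (μ := (volume : Measure ℂ)) (x := 0) (r := R)⟩
  have hmp : MeasurePreserving (fun p : ℂ × (Fin n → ℂ) => (p.1, p.2 + p.1 • e))
      ((volume.restrict (ball 0 R)).prod volume) ((volume.restrict (ball 0 R)).prod volume) :=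
    (MeasurePreserving.id _).skew_product (g := fun s z => z + s • e) (by fun_prop)
      (.of_forall fun s => map_add_right_eq_self _ _)
  exact (hmp.integrable_comp_of_integrable (hK.comp_snd _)).prod_left_ae

open Metric Real in
/-- The circle averages of the translates of a holomorphic function are holomorphic. -/
lemma differentiableOn_circleAverage_translate {n : ℕ} {q : (Fin n → ℂ) → ℂ}
    {Ω : Set (Fin n → ℂ)} (hΩ : IsOpen Ω) (hq : DifferentiableOn ℂ q Ω) {x e : Fin n → ℂ} {r : ℝ}
    (hr : 0 ≤ r) (hx : ∀ s ∈ sphere (0 : ℂ) r, x + s • e ∈ Ω) :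
    ∃ δ > 0, (∀ z ∈ ball x δ, ∀ s ∈ sphere (0 : ℂ) r, z + s • e ∈ Ω) ∧
      DifferentiableOn ℂ (fun z => circleAverage (fun s => q (z + s • e)) 0 r) (ball x δ) := by
  have hK : IsCompact ((fun s : ℂ => x + s • e) '' sphere 0 r) :=
    (isCompact_sphere _ _).image (by fun_prop)
  obtain ⟨η, hη, hsub⟩ := hK.exists_cthickening_subset_open hΩ (Set.image_subset_iff.mpr hx)
  obtain ⟨M, hM⟩ := hK.cthickening.exists_bound_of_continuousOn (hq.continuousOn.mono hsub)
  have hnear : ∀ z ∈ ball x (η / 2), ∀ s ∈ sphere (0 : ℂ) r, ball (z + s • e) (η / 2) ⊆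
      cthickening η ((fun s : ℂ => x + s • e) '' sphere 0 r) := by
    intro z hz s hs w hw
    refine mem_cthickening_of_dist_le w (x + s • e) _ _ (Set.mem_image_of_mem _ hs) ?_
    have h1 : dist (z + s • e) (x + s • e) < η / 2 := by simpa using hz
    linarith [dist_triangle w (z + s • e) (x + s • e), mem_ball.mp hw]
  have hmem : ∀ z ∈ ball x (η / 2), ∀ s ∈ sphere (0 : ℂ) r, z + s • e ∈ Ω := fun z hz s hs =>
    hsub (hnear z hz s hs (mem_ball_self (by positivity)))
  refine ⟨η / 2, by positivity, hmem, fun z₀ hz₀ => DifferentiableAt.differentiableWithinAt ?_⟩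
  have hcirc : ∀ θ, circleMap 0 r θ ∈ sphere (0 : ℂ) r := circleMap_mem_sphere 0 hr
  have hcont : ∀ z ∈ ball x (η / 2), Continuous fun θ : ℝ => q (z + circleMap 0 r θ • e) :=
    fun z hz => hq.continuousOn.comp_continuous (by fun_prop) fun θ => hmem z hz _ (hcirc θ)
  have hder := intervalIntegral.hasFDerivAt_integral_of_dominated_of_fderiv_le (𝕜 := ℂ)
    (μ := volume) (a := 0) (b := 2 * π) (s := ball x (η / 2)) (x₀ := z₀)
    (bound := fun _ => (M + M) / (η / 2)) (F := fun z θ => q (z + circleMap 0 r θ • e))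
    (F' := fun z θ => fderiv ℂ q (z + circleMap 0 r θ • e)) (isOpen_ball.mem_nhds hz₀) ?_ ?_ ?_ ?_
    (by simp) ?_
  · exact (hder.differentiableAt.const_smul ((2 * π)⁻¹ : ℝ))
  · filter_upwards [isOpen_ball.mem_nhds hz₀] with z hz
    exact (hcont z hz).aestronglyMeasurable
  · exact (hcont z₀ hz₀).intervalIntegrable _ _
  · exact ((measurable_fderiv ℂ q).comp
      (by fun_prop : Continuous fun θ => z₀ + circleMap 0 r θ • e).measurable).aestronglyMeasurable
  · refine .of_forall fun θ _ z hz => ?_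
    have hb := hnear z hz _ (hcirc θ)
    refine Complex.norm_fderiv_le_div_of_mapsTo_ball (hq.mono (hb.trans hsub)) (fun w hw => ?_)
      (by positivity)
    rw [mem_closedBall, dist_eq_norm]
    exact (norm_sub_le _ _).trans
      (add_le_add (hM _ (hb hw)) (hM _ (hb (mem_ball_self (by positivity)))))
  · refine .of_forall fun θ _ z hz => ?_
    have := (hq.differentiableAt (hΩ.mem_nhds (hmem z hz _ (hcirc θ)))).hasFDerivAt
    simpa [Function.comp_def] using this.comp z ((hasFDerivAt_id z).add_const _)

open Metric in
/-- A nonzero holomorphic germ is nonzero on a punctured disc in some direction. -/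
lemma exists_direction_eventually_ne_zero {n : ℕ} {f : (Fin n → ℂ) → ℂ} {U : Set (Fin n → ℂ)}
    (hU : IsOpen U) (hf : DifferentiableOn ℂ f U) {x : Fin n → ℂ} (hx : x ∈ U)
    (hne : ¬ (f =ᶠ[𝓝 x] 0)) :
    ∃ e : Fin n → ℂ, ∀ᶠ s : ℂ in 𝓝[≠] 0, f (x + s • e) ≠ 0 := by
  obtain ⟨ρ, hρ, hsub⟩ := Metric.isOpen_iff.mp hU x hx
  have : ∃ y ∈ ball x ρ, f y ≠ 0 := by
    by_contra! h
    exact hne (Filter.eventually_of_mem (ball_mem_nhds x hρ) h)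
  obtain ⟨y, hy, hfy⟩ := this
  refine ⟨y - x, ?_⟩
  set L : ℂ → (Fin n → ℂ) := fun s => x + s • (y - x)
  have hL : Differentiable ℂ L := by fun_prop
  set S := L ⁻¹' ball x ρ
  have hS : IsOpen S := isOpen_ball.preimage hL.continuous
  have hSc : IsPreconnected S := by
    have : S = (LinearMap.toSpanSingleton ℂ (Fin n → ℂ) (y - x)).restrictScalars ℝ ⁻¹' ball 0 ρ := by
      ext s; simp [S, L]
    rw [this]
    exact ((convex_ball 0 ρ).linear_preimage _).isPreconnected
  have hfa : AnalyticOnNhd ℂ (fun s => f (L s)) S :=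
    DifferentiableOn.analyticOnNhd (hf.comp hL.differentiableOn fun s hs => hsub hs) hS
  have h0 : (0 : ℂ) ∈ S := by simp [S, L, hρ]
  have h1 : (1 : ℂ) ∈ S := by simpa [S, L] using hy
  refine (hfa 0 h0).eventually_eq_zero_or_eventually_ne_zero.resolve_left fun h => hfy ?_
  simpa [L] using hfa.eqOn_zero_of_preconnected_of_eventuallyEq_zero hSc h0 h h1

open Metric Real in
/-- A holomorphic function square integrable with respect to `1 / |f|²` is divisible by `f`. -/
lemma exists_eq_mul_of_integrableOn {n : ℕ} {f g : (Fin n → ℂ) → ℂ} {V : Set (Fin n → ℂ)}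
    (hV : IsOpen V) (hf : DifferentiableOn ℂ f V) (hg : DifferentiableOn ℂ g V) {x : Fin n → ℂ}
    (hx : x ∈ V) (hne : ¬ (f =ᶠ[𝓝 x] 0))
    (hint : IntegrableOn (fun y => ‖g y‖ ^ 2 / ‖f y‖ ^ 2) V volume) :
    ∃ h : (Fin n → ℂ) → ℂ, HolNear h x ∧ g =ᶠ[𝓝 x] fun y => f y * h y := by
  obtain ⟨e, he⟩ := exists_direction_eventually_ne_zero hV hf hx hne
  obtain ⟨ρ, hρ, hρV⟩ := Metric.isOpen_iff.mp hV x hx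
  obtain ⟨ε, hε, hball⟩ := Metric.eventually_nhds_iff_ball.mp (eventually_nhdsWithin_iff.mp he)
  set R := min ε (ρ / 2 / (‖e‖ + 1))
  have hR : 0 < R := by positivity
  have hV' : ∀ z ∈ ball x (ρ / 2), ∀ s ∈ ball (0 : ℂ) R, z + s • e ∈ V := by
    intro z hz s hs
    apply hρV
    have h1 : ‖s‖ < ρ / 2 / (‖e‖ + 1) := (mem_ball_zero_iff.mp hs).trans_le (min_le_right _ _)
    rw [lt_div_iff₀ (by positivity)] at h1
    have h2 : ‖z - x‖ < ρ / 2 := mem_ball_iff_norm.mp hz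
    rw [mem_ball_iff_norm]
    calc ‖z + s • e - x‖ = ‖(z - x) + s • e‖ := by congr 1; abel
      _ ≤ ‖z - x‖ + ‖s‖ * ‖e‖ := (norm_add_le _ _).trans_eq (by rw [norm_smul])
      _ < ρ := by nlinarith [norm_nonneg s]
  have hΩ : IsOpen (V ∩ f ⁻¹' {0}ᶜ) :=
    hf.continuousOn.isOpen_inter_preimage hV isOpen_compl_singleton
  have hq : DifferentiableOn ℂ (fun y => g y / f y) (V ∩ f ⁻¹' {0}ᶜ) := by
    simp only [div_eq_mul_inv]
    exact (hg.mono Set.inter_subset_left).mul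
      (DifferentiableOn.fun_inv (hf.mono Set.inter_subset_left) fun y hy => hy.2)
  have hr : 0 < R / 2 := by positivity
  have hrR : R / 2 < R := by linarith
  have hsph : ∀ s ∈ sphere (0 : ℂ) (R / 2), s ∈ ball (0 : ℂ) R := fun s hs =>
    closedBall_subset_ball hrR (sphere_subset_closedBall hs)
  obtain ⟨δ, hδ, hmem, hH⟩ := differentiableOn_circleAverage_translate hΩ hq (x := x) (e := e) hr.le
    fun s hs => ⟨hV' x (mem_ball_self (by positivity)) s (hsph s hs),
      hball s (ball_subset_ball (min_le_left _ _) (hsph s hs)) (ne_of_mem_sphere hs hr.ne')⟩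
  set H := fun z => circleAverage (fun s => g (z + s • e) / f (z + s • e)) 0 (R / 2)
  set d := min δ (ρ / 2)
  have hd : 0 < d := by positivity
  have hdV : ball x d ⊆ V := fun z hz => by
    simpa using hV' z (ball_subset_ball (min_le_right _ _) hz) 0 (mem_ball_self hR)
  have hae : ∀ᵐ z ∂volume.restrict (ball x d), g z = f z * H z := by
    rw [ae_restrict_iff' measurableSet_ball]
    filter_upwards [ae_integrableOn_slice ((integrable_indicator_iff hV.measurableSet).mpr hint) e R]
      with z hz hzd
    have hzV := hV' z (ball_subset_ball (min_le_right _ _) hzd)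
    have hmaps : Set.MapsTo (fun s : ℂ => z + s • e) (ball 0 R) V := hzV
    have hline : DifferentiableOn ℂ (fun s : ℂ => z + s • e) (ball 0 R) := by fun_prop
    have key := mul_circleAverage_div_eq hr hrR (hf.comp hline hmaps) (hg.comp hline hmaps)
      (fun s hs => (hmem z (ball_subset_ball (min_le_left _ _) hzd) s hs).2)
      (hz.congr_fun (fun s hs => by simp [Set.indicator_of_mem (hzV s hs)]) measurableSet_ball)
    simpa using key.symm
  have hHd : DifferentiableOn ℂ H (ball x d) := hH.mono (ball_subset_ball (min_le_left _ _))
  refine ⟨H, ⟨ball x d, isOpen_ball, mem_ball_self hd, hHd⟩,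
    Filter.eventually_of_mem (ball_mem_nhds x hd) ?_⟩
  exact Measure.eqOn_open_of_ae_eq hae isOpen_ball (hg.mono hdV).continuousOn
    ((hf.mono hdV).mul hHd).continuousOn

open Metric in
/-- A holomorphic multiple of `f` is square integrable with respect to `1 / |f|²`. -/
lemma multCond_one_of_eventuallyEq_mul {n : ℕ} {f g h : (Fin n → ℂ) → ℂ} {U : Set (Fin n → ℂ)}
    (hU : IsOpen U) (hf : DifferentiableOn ℂ f U) {x : Fin n → ℂ} (hx : x ∈ U) (hg : HolNear g x)
    (hh : HolNear h x) (hgh : g =ᶠ[𝓝 x] fun y => f y * h y) : MultCond f U g x 1 := by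
  obtain ⟨W, hW, hxW, hgW⟩ := hg
  obtain ⟨W', hW', hxW', hhW'⟩ := hh
  have hbdd : ∀ᶠ y in 𝓝 x, ‖h y‖ < ‖h x‖ + 1 :=
    (hhW'.continuousOn.continuousAt (hW'.mem_nhds hxW')).norm.eventually_lt_const (by linarith)
  obtain ⟨d, hd, hball⟩ := Metric.eventually_nhds_iff_ball.mp ((hgh.and hbdd).and
    ((hU.eventually_mem hx).and (hW.eventually_mem hxW)))
  have hBU : ball x d ⊆ U := fun y hy => (hball y hy).2.1
  have hgB : DifferentiableOn ℂ g (ball x d) := hgW.mono fun y hy => (hball y hy).2.2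
  refine ⟨ball x d, isOpen_ball, mem_ball_self hd, hBU, hgB, ?_⟩
  have hmeas : AEMeasurable (fun y => ‖g y‖ ^ 2 / ‖f y‖ ^ (2 * 1 : ℝ))
      (volume.restrict (ball x d)) :=
    ((hgB.continuousOn.aemeasurable measurableSet_ball).norm.pow_const 2).div
      (((hf.mono hBU).continuousOn.aemeasurable measurableSet_ball).norm.pow_const _)
  refine IntegrableOn.of_bound measure_ball_lt_top hmeas.aestronglyMeasurable ((‖h x‖ + 1) ^ 2) ?_
  rw [ae_restrict_iff' measurableSet_ball]
  refine .of_forall fun y hy => ?_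
  obtain ⟨⟨h1, h2⟩, -⟩ := hball y hy
  have hpow : ‖f y‖ ^ (2 * 1 : ℝ) = ‖f y‖ ^ 2 := by norm_num
  rw [Real.norm_of_nonneg (by positivity), hpow, h1, norm_mul, mul_pow]
  refine div_le_of_le_mul₀ (by positivity) (by positivity) ?_
  rw [mul_comm]
  gcongr

/-- Germ-level version of (2.1.13): `𝒥(f^1)_x` is the principal ideal generated by the
germ of `f`, i.e. `|g|²/|f|²` is locally integrable at `x` iff `f` divides `g` in the local
ring of holomorphic germs at `x`. -/
theorem multCond_one_iff_dvd
    {n : ℕ} (hn : 1 ≤ n)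
    (U : Set (Fin n → ℂ)) (hU : IsOpen U)
    (f : (Fin n → ℂ) → ℂ) (hf : DifferentiableOn ℂ f U)
    (x : Fin n → ℂ) (hx : x ∈ U) (hf0 : f x = 0) (hne : ¬ (f =ᶠ[𝓝 x] 0))
    (g : (Fin n → ℂ) → ℂ) (hg : HolNear g x) :
    MultCond f U g x 1 ↔
      ∃ h : (Fin n → ℂ) → ℂ, HolNear h x ∧ g =ᶠ[𝓝 x] fun y => f y * h y := by
  constructor
  · rintro ⟨V, hV, hxV, hVU, hgV, hint⟩
    refine exists_eq_mul_of_integrableOn hV (hf.mono hVU) hgV hxV hne ?_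
    convert hint using 4
    norm_num
  · rintro ⟨h, hh, hgh⟩
    exact multCond_one_of_eventuallyEq_mul hU hf hx hg hh hgh
end
end

section
/- Let U ⊆ ℂⁿ be open, f : U → ℂ holomorphic, and x ∈ U with f(x) = 0 and with the germ of f at x nonzero. Let g be holomorphic near x with nonzero germ at x. Then there exists a positive rational number β such that the set {α ∈ ℝ : g satisfies the multiplier condition for (f, α) at x} equals the open ray (−∞, β). In particular this set is open on the right (right-continuity of multiplier ideals) and its supremum is a positive rational number. -/
open MeasureTheory Filter Topology

noncomputable section

variable {E : Type*} [NormedAddCommGroup E] [NormedSpace ℂ E] [MeasureSpace E]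

section resolution

/-- A circle integral depending holomorphically on parameters is holomorphic in them. -/
theorem differentiableAt_circleIntegral {m : ℕ} {p : Fin m → ℂ} {r R : ℝ} {c : ℂ} (hr : 0 < r)
    (hR : 0 ≤ R) {H : (Fin m → ℂ) → ℂ → ℂ}
    (hd : ∀ ζ ∈ Metric.sphere c R, DifferentiableOn ℂ (fun y => H y ζ) (Metric.ball p r))
    (hc : ContinuousOn (Function.uncurry H) (Metric.ball p r ×ˢ Metric.sphere c R)) :
    DifferentiableAt ℂ (fun y => ∮ ζ in C(c, R), H y ζ) p := by
  obtain ⟨M, hM⟩ : ∃ M, ∀ x ∈ Metric.closedBall p (r / 2) ×ˢ Metric.sphere c R,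
      ‖Function.uncurry H x‖ ≤ M :=
    ((isCompact_closedBall p (r / 2)).prod (isCompact_sphere c R)).exists_bound_of_continuousOn
      (hc.mono (Set.prod_mono (Metric.closedBall_subset_ball (by linarith)) le_rfl))
  have hM' : ∀ y ∈ Metric.ball p (r / 2), ∀ θ, ‖H y (circleMap c R θ)‖ ≤ M := fun y hy θ =>
    hM (y, circleMap c R θ) ⟨Metric.ball_subset_closedBall hy, circleMap_mem_sphere c hR θ⟩
  have hM0 : 0 ≤ M := (norm_nonneg _).trans (hM' p (Metric.mem_ball_self (by linarith)) 0)
  have hcont : ∀ y ∈ Metric.ball p r, Continuous fun θ => H y (circleMap c R θ) := by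
    intro y hy
    refine hc.comp_continuous (f := fun θ => (y, circleMap c R θ)) (by fun_prop) fun θ => ?_
    exact ⟨hy, circleMap_mem_sphere c hR θ⟩
  set G : (Fin m → ℂ) → ℝ → ℂ := fun y θ => deriv (circleMap c R) θ • H y (circleMap c R θ) with hG
  have hGc : ∀ y ∈ Metric.ball p r, Continuous (G y) := by
    intro y hy
    have := hcont y hy
    simp only [hG, deriv_circleMap]
    exact ((continuous_circleMap 0 R).mul continuous_const).smul this
  have hpr : p ∈ Metric.ball p r := Metric.mem_ball_self hr
  have hGd : ∀ θ, ∀ y ∈ Metric.ball p r, DifferentiableAt ℂ (fun y => G y θ) y := by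
    intro θ y hy
    exact ((hd _ (circleMap_mem_sphere c hR θ)).differentiableAt
      (Metric.isOpen_ball.mem_nhds hy)).fun_const_smul _
  set F' : ℝ → (Fin m → ℂ) →L[ℂ] ℂ := fun θ => fderiv ℂ (fun y => G y θ) p with hF'
  have hdiff : ∀ θ, HasFDerivAt (fun y => G y θ) (F' θ) p := fun θ =>
    (hGd θ p hpr).hasFDerivAt
  set μ : Measure ℝ := volume.restrict (Set.Ioc 0 (2 * Real.pi))
  have hmeas1 : ∀ v, AEStronglyMeasurable (fun θ => F' θ v) μ := by
    intro v
    have hev : ∀ᶠ n : ℕ in atTop, p + ((n : ℂ))⁻¹ • v ∈ Metric.ball p r := by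
      have : Tendsto (fun n : ℕ => p + ((n : ℂ))⁻¹ • v) atTop (𝓝 (p + (0 : ℂ) • v)) :=
        tendsto_const_nhds.add ((tendsto_inv_atTop_nhds_zero_nat (𝕜 := ℂ)).smul_const v)
      rw [zero_smul, add_zero] at this
      exact this (Metric.ball_mem_nhds p hr)
    obtain ⟨N, hN⟩ := eventually_atTop.1 hev
    refine aestronglyMeasurable_of_tendsto_ae (u := (atTop : Filter ℕ))
      (f := fun n θ => (((n + N : ℕ) : ℂ)) • (G (p + (((n + N : ℕ) : ℂ))⁻¹ • v) θ - G p θ)) ?_ ?_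
    · intro n
      have h1 := hGc _ (hN (n + N) (by omega))
      have h2 := hGc p hpr
      exact (by fun_prop : Continuous _).aestronglyMeasurable
    · refine ae_of_all _ fun θ => ?_
      refine (hdiff θ).lim (v := v) ?_
      simp only [Complex.norm_natCast]
      exact tendsto_natCast_atTop_atTop.comp (tendsto_add_atTop_nat N)
  have hmeas : AEStronglyMeasurable F' μ := by
    have : F' = fun θ => ∑ i, (F' θ (Pi.single i 1)) •
        (ContinuousLinearMap.proj (R := ℂ) (φ := fun _ : Fin m => ℂ) i) := by
      funext θ
      refine ContinuousLinearMap.ext fun v => ?_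
      have hv : v = ∑ i, v i • (Pi.single i 1 : Fin m → ℂ) := by
        ext k
        simp [Finset.sum_apply, Pi.single_apply]
      conv_lhs => rw [hv]
      simp [mul_comm]
    rw [this]
    exact Finset.aestronglyMeasurable_fun_sum _ fun i _ => (hmeas1 _).smul_const _
  have hlip : ∀ θ, LipschitzOnWith (Real.nnabs (2 * (|R| * M) / (r / 4))) (fun y => G y θ)
      (Metric.ball p (r / 4)) := by
    intro θ
    refine (convex_ball _ _).lipschitzOnWith_of_nnnorm_fderiv_le (𝕜 := ℂ)
      (fun y hy => hGd θ y (Metric.ball_subset_ball (by linarith) hy)) fun y hy => ?_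
    rw [← NNReal.coe_le_coe, coe_nnnorm, Real.coe_nnabs]
    refine le_trans ?_ (le_abs_self _)
    have hsub : Metric.ball y (r / 4) ⊆ Metric.ball p (r / 2) := by
      intro z hz
      rw [Metric.mem_ball] at *
      linarith [dist_triangle z y p]
    have hGb : ∀ z ∈ Metric.ball p (r / 2), ‖G z θ‖ ≤ |R| * M := by
      intro z hz
      simp only [hG, deriv_circleMap, norm_smul, norm_mul, Complex.norm_I, norm_circleMap_zero,
        mul_one]
      exact mul_le_mul_of_nonneg_left (hM' z hz θ) (abs_nonneg _)
    refine Complex.norm_fderiv_le_div_of_mapsTo_ball (R₁ := r / 4) ?_ ?_ (by linarith)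
    · intro z hz
      exact (hGd θ z (Metric.ball_subset_ball (by linarith) (hsub hz))).differentiableWithinAt
    · intro z hz
      rw [mem_closedBall_iff_norm]
      refine (norm_sub_le _ _).trans ?_
      linarith [hGb z (hsub hz), hGb y (hsub (Metric.mem_ball_self (by linarith)))]
  have key := hasFDerivAt_integral_of_dominated_loc_of_lip (𝕜 := ℂ) (μ := μ) (F := G) (F' := F')
    (x₀ := p) (s := Metric.ball p (r / 4)) (bound := fun _ => 2 * (|R| * M) / (r / 4))
    (Metric.ball_mem_nhds _ (by linarith))
    (by
      filter_upwards [Metric.ball_mem_nhds p hr] with y hy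
      exact (hGc y hy).aestronglyMeasurable)
    ((hGc p hpr).integrableOn_Ioc) hmeas (ae_of_all _ hlip) (by simp [μ]) (ae_of_all _ hdiff)
  have heq : (fun y => ∮ ζ in C(c, R), H y ζ) = fun y => ∫ θ, G y θ ∂μ := by
    funext y
    rw [circleIntegral, intervalIntegral.integral_of_le Real.two_pi_pos.le]
  rw [heq]
  exact key.2.differentiableAt

/-- `f` is holomorphic near the origin. -/
def HolGerm {X Y : Type*} [NormedAddCommGroup X] [NormedSpace ℂ X] [NormedAddCommGroup Y]
    [NormedSpace ℂ Y] (f : X → Y) : Prop :=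
  ∀ᶠ y in 𝓝 (0 : X), DifferentiableAt ℂ f y

theorem differentiableAt_fderiv_apply {m : ℕ} {f : (Fin m → ℂ) → ℂ} {p : Fin m → ℂ}
    (hf : ∀ᶠ y in 𝓝 p, DifferentiableAt ℂ f y) (v : Fin m → ℂ) :
    DifferentiableAt ℂ (fun y => fderiv ℂ f y v) p := by
  obtain ⟨r, hr, hball⟩ := Metric.eventually_nhds_iff_ball.1 hf
  set R : ℝ := r / 2 / (‖v‖ + 1) with hRdef
  have hv : 0 < ‖v‖ + 1 := by positivity
  have hR : 0 < R := by positivity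
  have hRv : R * ‖v‖ < r / 2 := by
    have : R * (‖v‖ + 1) = r / 2 := by rw [hRdef]; field_simp
    nlinarith
  have hmem : ∀ y ∈ Metric.ball p (r / 2), ∀ ζ ∈ Metric.closedBall (0 : ℂ) R,
      y + ζ • v ∈ Metric.ball p r := by
    intro y hy ζ hζ
    rw [mem_ball_iff_norm] at *
    rw [mem_closedBall_zero_iff] at hζ
    calc ‖y + ζ • v - p‖ = ‖(y - p) + ζ • v‖ := by congr 1; abel
      _ ≤ ‖y - p‖ + ‖ζ‖ * ‖v‖ := (norm_add_le _ _).trans (by rw [norm_smul])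
      _ < r := by nlinarith [norm_nonneg v]
  have heq : ∀ y ∈ Metric.ball p (r / 2), fderiv ℂ f y v =
      (2 * Real.pi * Complex.I)⁻¹ * ∮ ζ in C(0, R), (1 / (ζ - 0) ^ 2) • f (y + ζ • v) := by
    intro y hy
    have h1 : DifferentiableOn ℂ (fun ζ : ℂ => f (y + ζ • v)) (Metric.closedBall 0 R) := by
      intro ζ hζ
      exact ((hball _ (hmem y hy ζ hζ)).comp ζ
        (by fun_prop : DifferentiableAt ℂ (fun ζ : ℂ => y + ζ • v) ζ)).differentiableWithinAt
    rw [h1.deriv_eq_smul_circleIntegral hR]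
    have h2 : HasDerivAt (fun ζ : ℂ => f (y + ζ • v)) (fderiv ℂ f y v) 0 := by
      have hy' : DifferentiableAt ℂ f (y + (0 : ℂ) • v) :=
        hball _ (hmem y hy 0 (by simp [hR.le]))
      have h3 : HasDerivAt (fun ζ : ℂ => y + ζ • v) v 0 := by
        simpa using ((hasDerivAt_id (0 : ℂ)).smul_const v).const_add y
      have := HasFDerivAt.comp_hasDerivAt (f := fun ζ : ℂ => y + ζ • v) (0 : ℂ)
        hy'.hasFDerivAt h3
      simpa [Function.comp_def] using this
    rw [h2.deriv, smul_eq_mul, inv_mul_cancel_left₀ Complex.two_pi_I_ne_zero]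
  have hd : DifferentiableAt ℂ (fun y => (2 * Real.pi * Complex.I)⁻¹ *
      ∮ ζ in C(0, R), (1 / (ζ - 0) ^ 2) • f (y + ζ • v)) p := by
    refine (differentiableAt_circleIntegral (r := r / 2) (by linarith) hR.le ?_ ?_).const_mul _
    · intro ζ hζ y hy
      have h1 : DifferentiableAt ℂ (fun y => f (y + ζ • v)) y :=
        (hball _ (hmem y hy ζ (Metric.sphere_subset_closedBall hζ))).comp y
          (by fun_prop : DifferentiableAt ℂ (fun y => y + ζ • v) y)
      exact (h1.fun_const_smul _).differentiableWithinAt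
    · rintro ⟨y, ζ⟩ ⟨hy, hζ⟩
      have hζ0 : ζ ≠ 0 := by
        rintro rfl
        simp at hζ
        exact hR.ne hζ
      have h1 : ContinuousAt f (y + ζ • v) :=
        (hball _ (hmem y hy ζ (Metric.sphere_subset_closedBall hζ))).continuousAt
      have h2 : ContinuousAt (fun z : (Fin m → ℂ) × ℂ => f (z.1 + z.2 • v)) (y, ζ) :=
        ContinuousAt.comp (f := fun z : (Fin m → ℂ) × ℂ => z.1 + z.2 • v) (g := f) h1
          (by fun_prop)
      have h3 : ContinuousAt (fun z : (Fin m → ℂ) × ℂ => 1 / (z.2 - 0) ^ 2) (y, ζ) := by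
        refine ContinuousAt.div continuousAt_const (by fun_prop) ?_
        simpa using hζ0
      exact (h3.smul h2).continuousWithinAt
  refine hd.congr_of_eventuallyEq ?_
  filter_upwards [Metric.ball_mem_nhds p (by linarith : 0 < r / 2)] with y hy using heq y hy

theorem HolGerm.fderiv_apply {m : ℕ} {f : (Fin m → ℂ) → ℂ} (hf : HolGerm f) (v : Fin m → ℂ) :
    HolGerm fun y => fderiv ℂ f y v := by
  filter_upwards [hf.eventually_nhds] with y hy using differentiableAt_fderiv_apply hy v

theorem contDiffAt_one_of_eventually_differentiableAt {m : ℕ} {f : (Fin m → ℂ) → ℂ}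
    {p : Fin m → ℂ} (hf : ∀ᶠ y in 𝓝 p, DifferentiableAt ℂ f y) : ContDiffAt ℂ 1 f p := by
  rw [contDiffAt_one_iff]
  refine ⟨fderiv ℂ f, {y | ∀ᶠ z in 𝓝 y, DifferentiableAt ℂ f z}, hf.eventually_nhds, ?_, ?_⟩
  · rw [continuousOn_clm_apply]
    intro v y hy
    exact (differentiableAt_fderiv_apply hy v).continuousAt.continuousWithinAt
  · intro y hy
    exact hy.self_of_nhds.hasFDerivAt

theorem HolGerm.contDiffAt {m : ℕ} {f : (Fin m → ℂ) → ℂ} (hf : HolGerm f) : ContDiffAt ℂ 1 f 0 :=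
  contDiffAt_one_of_eventually_differentiableAt hf

/-- Hadamard's lemma: division with remainder by a coordinate. -/
theorem HolGerm.exists_div_coord {m : ℕ} {f : (Fin m → ℂ) → ℂ} (hf : HolGerm f) (j : Fin m) :
    ∃ g : (Fin m → ℂ) → ℂ, HolGerm g ∧
      ∀ᶠ y in 𝓝 0, f y = f (Function.update y j 0) + y j * g y := by
  obtain ⟨r, hr, hball⟩ := Metric.eventually_nhds_iff_ball.1 hf
  set R : ℝ := r / 2 with hRdef
  have hR : 0 < R := by positivity
  have hmem : ∀ y ∈ Metric.ball (0 : Fin m → ℂ) R, ∀ ζ ∈ Metric.closedBall (0 : ℂ) R,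
      Function.update y j ζ ∈ Metric.ball (0 : Fin m → ℂ) r := by
    intro y hy ζ hζ
    rw [mem_ball_zero_iff] at *
    rw [mem_closedBall_zero_iff] at hζ
    refine (pi_norm_lt_iff hr).2 fun i => ?_
    by_cases h : i = j
    · subst h; simp; linarith
    · rw [Function.update_of_ne h]
      exact (norm_le_pi_norm y i).trans_lt (by linarith)
  have hupd : ∀ z : (Fin m → ℂ) × ℂ, DifferentiableAt ℂ
      (fun z : (Fin m → ℂ) × ℂ => Function.update z.1 j z.2) z := by
    intro z
    rw [differentiableAt_pi]
    intro i
    by_cases h : i = j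
    · subst h; simp only [Function.update_self]; fun_prop
    · simp only [Function.update_of_ne h]; fun_prop
  have hjoint : ∀ y ∈ Metric.ball (0 : Fin m → ℂ) R, ∀ ζ ∈ Metric.closedBall (0 : ℂ) R,
      DifferentiableAt ℂ (fun z : (Fin m → ℂ) × ℂ => f (Function.update z.1 j z.2)) (y, ζ) := by
    intro y hy ζ hζ
    exact (hball _ (hmem y hy ζ hζ)).comp (y, ζ) (hupd (y, ζ))
  have hyj : ∀ y ∈ Metric.ball (0 : Fin m → ℂ) R, y j ∈ Metric.ball (0 : ℂ) R := by
    intro y hy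
    rw [mem_ball_zero_iff] at *
    exact (norm_le_pi_norm y j).trans_lt hy
  set K : (Fin m → ℂ) → ℂ → ℂ := fun y ζ => (ζ⁻¹ * (ζ - y j)⁻¹) * f (Function.update y j ζ) with hK
  have hne : ∀ y ∈ Metric.ball (0 : Fin m → ℂ) R, ∀ ζ ∈ Metric.sphere (0 : ℂ) R,
      ζ ≠ 0 ∧ ζ - y j ≠ 0 := by
    intro y hy ζ hζ
    have h1 := hyj y hy
    rw [mem_ball_zero_iff] at h1
    rw [mem_sphere_zero_iff_norm] at hζ
    constructor
    · rintro rfl; simp at hζ; exact hR.ne hζ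
    · intro h
      rw [sub_eq_zero.1 h] at hζ
      linarith
  have hKd : ∀ y ∈ Metric.ball (0 : Fin m → ℂ) R, ∀ ζ ∈ Metric.sphere (0 : ℂ) R,
      DifferentiableAt ℂ (Function.uncurry K) (y, ζ) := by
    intro y hy ζ hζ
    obtain ⟨h1, h2⟩ := hne y hy ζ hζ
    have h3 := hjoint y hy ζ (Metric.sphere_subset_closedBall hζ)
    have h4 : DifferentiableAt ℂ (fun z : (Fin m → ℂ) × ℂ => (z.2)⁻¹ * (z.2 - z.1 j)⁻¹) (y, ζ) := by
      refine DifferentiableAt.mul (DifferentiableAt.inv (by fun_prop) h1)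
        (DifferentiableAt.inv (by fun_prop) h2)
    exact h4.mul h3
  refine ⟨fun y => (2 * Real.pi * Complex.I)⁻¹ * ∮ ζ in C(0, R), K y ζ, ?_, ?_⟩
  · filter_upwards [Metric.ball_mem_nhds (0 : Fin m → ℂ) hR] with p hp
    obtain ⟨s, hs, hsub⟩ := Metric.isOpen_ball.mem_nhds hp |> Metric.mem_nhds_iff.1
    refine (differentiableAt_circleIntegral hs hR.le ?_ ?_).const_mul _
    · intro ζ hζ y hy
      exact ((hKd y (hsub hy) ζ hζ).comp y
        (by fun_prop : DifferentiableAt ℂ (fun y => (y, ζ)) y)).differentiableWithinAt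
    · rintro ⟨y, ζ⟩ ⟨hy, hζ⟩
      exact (hKd y (hsub hy) ζ hζ).continuousAt.continuousWithinAt
  · filter_upwards [Metric.ball_mem_nhds (0 : Fin m → ℂ) hR] with y hy
    have h1 : DifferentiableOn ℂ (fun ζ : ℂ => f (Function.update y j ζ))
        (Metric.closedBall 0 R) := by
      intro ζ hζ
      exact ((hjoint y hy ζ hζ).comp ζ
        (by fun_prop : DifferentiableAt ℂ (fun ζ => (y, ζ)) ζ)).differentiableWithinAt
    have e1 := h1.circleIntegral_sub_inv_smul (hyj y hy)
    have e0 := h1.circleIntegral_sub_inv_smul (Metric.mem_ball_self hR)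
    simp only [Function.update_eq_self, smul_eq_mul] at e1 e0
    have hci : ∀ w ∈ Metric.ball (0 : ℂ) R, CircleIntegrable
        (fun ζ => (ζ - w)⁻¹ * f (Function.update y j ζ)) 0 R := by
      intro w hw
      refine ContinuousOn.circleIntegrable hR.le ?_
      refine ContinuousOn.mul (ContinuousOn.inv₀ (by fun_prop) fun ζ hζ h => ?_)
        (h1.continuousOn.mono Metric.sphere_subset_closedBall)
      rw [mem_sphere_zero_iff_norm] at hζ
      rw [mem_ball_zero_iff] at hw
      rw [sub_eq_zero.1 h] at hζ
      linarith
    have hsplit : y j * ∮ ζ in C(0, R), K y ζ =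
        (∮ ζ in C(0, R), (ζ - y j)⁻¹ * f (Function.update y j ζ)) -
        ∮ ζ in C(0, R), (ζ - 0)⁻¹ * f (Function.update y j ζ) := by
      rw [← circleIntegral.integral_sub (hci _ (hyj y hy)) (hci _ (Metric.mem_ball_self hR)),
        ← circleIntegral.integral_const_mul]
      refine circleIntegral.integral_congr hR.le fun ζ hζ => ?_
      obtain ⟨h2, h3⟩ := hne y hy ζ hζ
      simp only [hK, sub_zero]
      field_simp
      ring
    rw [mul_left_comm, hsplit, e1, e0, ← mul_sub, inv_mul_cancel_left₀ Complex.two_pi_I_ne_zero]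
    ring

section germs
variable {X Y Z : Type*} [NormedAddCommGroup X] [NormedSpace ℂ X] [NormedAddCommGroup Y]
  [NormedSpace ℂ Y] [NormedAddCommGroup Z] [NormedSpace ℂ Z]

theorem HolGerm.differentiableAt {f : X → Y} (hf : HolGerm f) : DifferentiableAt ℂ f 0 :=
  hf.self_of_nhds

theorem HolGerm.continuousAt {f : X → Y} (hf : HolGerm f) : ContinuousAt f 0 :=
  hf.differentiableAt.continuousAt

theorem HolGerm.congr {f g : X → Y} (hf : HolGerm f) (h : f =ᶠ[𝓝 0] g) : HolGerm g := by
  filter_upwards [hf, h.eventually_nhds] with y hy hy'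
  exact hy.congr_of_eventuallyEq (hy'.mono fun _ h => h.symm)

theorem _root_.Differentiable.holGerm {f : X → Y} (hf : Differentiable ℂ f) : HolGerm f :=
  Eventually.of_forall fun y => hf y

theorem HolGerm.add {f g : X → Y} (hf : HolGerm f) (hg : HolGerm g) :
    HolGerm fun y => f y + g y := by
  filter_upwards [hf, hg] with y h1 h2 using h1.add h2

theorem HolGerm.sub {f g : X → Y} (hf : HolGerm f) (hg : HolGerm g) :
    HolGerm fun y => f y - g y := by
  filter_upwards [hf, hg] with y h1 h2 using h1.sub h2

theorem HolGerm.mul {f g : X → ℂ} (hf : HolGerm f) (hg : HolGerm g) :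
    HolGerm fun y => f y * g y := by
  filter_upwards [hf, hg] with y h1 h2 using h1.mul h2

theorem HolGerm.pow {f : X → ℂ} (hf : HolGerm f) (n : ℕ) : HolGerm fun y => f y ^ n := by
  filter_upwards [hf] with y h1 using h1.pow n

theorem HolGerm.const (c : Y) : HolGerm fun _ : X => c := (differentiable_const c).holGerm

theorem HolGerm.sum {ι : Type*} (s : Finset ι) {f : ι → X → Y} (hf : ∀ i ∈ s, HolGerm (f i)) :
    HolGerm fun y => ∑ i ∈ s, f i y := by
  have : ∀ᶠ y in 𝓝 (0 : X), ∀ i ∈ s, DifferentiableAt ℂ (f i) y :=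
    (Filter.eventually_all_finset s).2 hf
  filter_upwards [this] with y hy using DifferentiableAt.fun_sum hy

theorem HolGerm.prod {ι : Type*} (s : Finset ι) {f : ι → X → ℂ} (hf : ∀ i ∈ s, HolGerm (f i)) :
    HolGerm fun y => ∏ i ∈ s, f i y := by
  classical
  induction s using Finset.induction_on with
  | empty => simpa using HolGerm.const (1 : ℂ)
  | insert i s hi ih =>
    simp only [Finset.prod_insert hi]
    exact (hf i (by simp)).mul (ih fun k hk => hf k (by simp [hk]))

theorem HolGerm.inv {f : X → ℂ} (hf : HolGerm f) (h0 : f 0 ≠ 0) : HolGerm fun y => (f y)⁻¹ := by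
  filter_upwards [hf, hf.continuousAt.eventually_ne h0] with y h1 h2 using h1.inv h2

theorem HolGerm.tendsto {f : X → Y} (hf : HolGerm f) (h0 : f 0 = 0) :
    Tendsto f (𝓝 0) (𝓝 0) := by
  simpa [ContinuousAt, h0] using hf.continuousAt

theorem HolGerm.comp {f : Y → Z} {g : X → Y} (hf : HolGerm f) (hg : HolGerm g) (h0 : g 0 = 0) :
    HolGerm fun y => f (g y) := by
  filter_upwards [hg, (hg.tendsto h0).eventually hf] with y h1 h2 using
    DifferentiableAt.comp y h2 h1

theorem holGerm_pi {ι : Type*} [Fintype ι] {f : X → ι → ℂ} :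
    HolGerm f ↔ ∀ i, HolGerm fun y => f y i := by
  simp only [HolGerm, differentiableAt_pi]
  exact eventually_all

/-- The identity principle on balls. -/
theorem eqOn_zero_ball_of_eventuallyEq {f : X → ℂ} {r : ℝ} {p z : X}
    (hf : ∀ y ∈ Metric.ball p r, DifferentiableAt ℂ f y) (hz : z ∈ Metric.ball p r)
    (h0 : f =ᶠ[𝓝 z] 0) : ∀ w ∈ Metric.ball p r, f w = 0 := by
  intro w hw
  set γ : ℂ → X := fun t => AffineMap.lineMap z w t with hγ
  have hγd : Differentiable ℂ γ := by
    simp only [hγ, AffineMap.lineMap_apply]; simp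
  have hconv : Convex ℝ (γ ⁻¹' Metric.ball p r) := by
    intro s hs t ht a b ha hb hab
    have e : γ (a • s + b • t) = a • γ s + b • γ t := by
      simp only [hγ, AffineMap.lineMap_apply, vsub_eq_sub, vadd_eq_add, smul_add, add_smul,
        smul_assoc]
      have : a • z + b • z = z := by rw [← add_smul, hab, one_smul]
      generalize w - z = v
      nth_rewrite 1 [← this]
      abel
    rw [Set.mem_preimage, e]
    exact convex_ball p r hs ht ha hb hab
  have hopen : IsOpen (γ ⁻¹' Metric.ball p r) := Metric.isOpen_ball.preimage hγd.continuous
  have han : AnalyticOnNhd ℂ (f ∘ γ) (γ ⁻¹' Metric.ball p r) := by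
    refine DifferentiableOn.analyticOnNhd ?_ hopen
    intro t ht
    exact ((hf _ ht).comp t (hγd t)).differentiableWithinAt
  have hzero : (f ∘ γ) =ᶠ[𝓝 0] 0 := by
    have : Tendsto γ (𝓝 0) (𝓝 z) := by
      have := hγd.continuous.tendsto 0
      simpa [hγ] using this
    exact this.eventually h0
  have := han.eqOn_zero_of_preconnected_of_eventuallyEq_zero hconv.isPreconnected
    (show (0 : ℂ) ∈ _ by simpa [hγ] using hz) hzero (show (1 : ℂ) ∈ _ by simpa [hγ] using hw)
  simpa [hγ] using this

/-- The ring of holomorphic germs is a domain. -/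
theorem HolGerm.eventuallyEq_zero_or {f g : X → ℂ} (hf : HolGerm f) (hg : HolGerm g)
    (h : (fun y => f y * g y) =ᶠ[𝓝 0] 0) : f =ᶠ[𝓝 0] 0 ∨ g =ᶠ[𝓝 0] 0 := by
  obtain ⟨r, hr, hball⟩ := Metric.eventually_nhds_iff_ball.1 ((hf.and hg).and h)
  by_cases hfz : ∀ z ∈ Metric.ball (0 : X) r, f z = 0
  · left
    filter_upwards [Metric.ball_mem_nhds 0 hr] using hfz
  · right
    push Not at hfz
    obtain ⟨z, hz, hfz⟩ := hfz
    have hg0 : g =ᶠ[𝓝 z] 0 := by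
      filter_upwards [(hball z hz).1.1.continuousAt.eventually_ne hfz,
        Metric.isOpen_ball.mem_nhds hz] with y hy hy'
      simpa [hy] using (hball y hy').2
    filter_upwards [Metric.ball_mem_nhds 0 hr] using
      eqOn_zero_ball_of_eventuallyEq (fun y hy => (hball y hy).1.2) hz hg0

theorem HolGerm.prod_eventuallyEq_zero {ι : Type*} (s : Finset ι) {f : ι → X → ℂ}
    (hf : ∀ i ∈ s, HolGerm (f i)) (h : (fun y => ∏ i ∈ s, f i y) =ᶠ[𝓝 0] 0) :
    ∃ i ∈ s, f i =ᶠ[𝓝 0] 0 := by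
  classical
  induction s using Finset.induction_on with
  | empty =>
    have := h.self_of_nhds
    simp at this
  | insert i s hi ih =>
    simp only [Finset.prod_insert hi] at h
    rcases (hf i (by simp)).eventuallyEq_zero_or
      (HolGerm.prod s fun k hk => hf k (by simp [hk])) h with h | h
    · exact ⟨i, by simp, h⟩
    · obtain ⟨k, hk, h⟩ := ih (fun k hk => hf k (by simp [hk])) h
      exact ⟨k, by simp [hk], h⟩

theorem HolGerm.eventuallyEq_of_mul_left {f g k : X → ℂ} (hk : HolGerm k) (hf : HolGerm f)
    (hg : HolGerm g) (hk0 : ¬ k =ᶠ[𝓝 0] 0)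
    (h : (fun y => k y * f y) =ᶠ[𝓝 0] fun y => k y * g y) : f =ᶠ[𝓝 0] g := by
  have := (hk.eventuallyEq_zero_or (hf.sub hg) (by
    filter_upwards [h] with y hy
    simp only [Pi.zero_apply, mul_sub]
    exact sub_eq_zero.2 hy)).resolve_left hk0
  filter_upwards [this] with y hy using sub_eq_zero.1 hy

end germs

variable {m : ℕ}

theorem holGerm_coord (j : Fin m) : HolGerm fun y : Fin m → ℂ => y j :=
  (differentiable_apply j).holGerm

theorem coord_not_eventuallyEq_zero (j : Fin m) :
    ¬ (fun y : Fin m → ℂ => y j) =ᶠ[𝓝 0] 0 := by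
  intro h
  have hc : Tendsto (fun t : ℂ => (fun _ => t : Fin m → ℂ)) (𝓝[≠] 0) (𝓝 0) :=
    Tendsto.mono_left (by
      have : Continuous (fun t : ℂ => (fun _ => t : Fin m → ℂ)) := by fun_prop
      exact this.tendsto 0) nhdsWithin_le_nhds
  obtain ⟨t, ht1, ht2⟩ := ((hc.eventually h).and self_mem_nhdsWithin).exists
  exact ht2 ht1

theorem holGerm_monomial (a : Fin m → ℕ) : HolGerm fun y : Fin m → ℂ => ∏ i, y i ^ a i :=
  HolGerm.prod _ fun i _ => (holGerm_coord i).pow _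

theorem monomial_not_eventuallyEq_zero (a : Fin m → ℕ) :
    ¬ (fun y : Fin m → ℂ => ∏ i, y i ^ a i) =ᶠ[𝓝 0] 0 := by
  intro h
  obtain ⟨i, -, hi⟩ := HolGerm.prod_eventuallyEq_zero _
    (fun i _ => (holGerm_coord i).pow (a i)) h
  refine coord_not_eventuallyEq_zero i ?_
  filter_upwards [hi] with y hy
  exact eq_zero_of_pow_eq_zero hy

theorem holGerm_update_zero (j : Fin m) :
    HolGerm fun y : Fin m → ℂ => Function.update y j (0 : ℂ) := by
  refine holGerm_pi.2 fun i => ?_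
  by_cases h : i = j
  · subst h; simpa using HolGerm.const (0 : ℂ)
  · simpa [Function.update_of_ne h] using holGerm_coord i

/-- `h` is a monomial times a unit near the origin. -/
def Mono (h : (Fin m → ℂ) → ℂ) : Prop :=
  ∃ a : Fin m → ℕ, ∃ u : (Fin m → ℂ) → ℂ, HolGerm u ∧ u 0 ≠ 0 ∧
    h =ᶠ[𝓝 0] fun y => u y * ∏ i, y i ^ a i

theorem Mono.holGerm {h : (Fin m → ℂ) → ℂ} (hh : Mono h) : HolGerm h := by
  obtain ⟨a, u, hu, -, e⟩ := hh
  exact (hu.mul (holGerm_monomial a)).congr e.symm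

theorem Mono.congr {h k : (Fin m → ℂ) → ℂ} (hh : Mono h) (e : h =ᶠ[𝓝 0] k) : Mono k := by
  obtain ⟨a, u, hu, hu0, e'⟩ := hh
  exact ⟨a, u, hu, hu0, e.symm.trans e'⟩

theorem Mono.of_unit {h : (Fin m → ℂ) → ℂ} (hh : HolGerm h) (h0 : h 0 ≠ 0) : Mono h :=
  ⟨0, h, hh, h0, by simp⟩

theorem Mono.not_eventuallyEq_zero {h : (Fin m → ℂ) → ℂ} (hh : Mono h) : ¬ h =ᶠ[𝓝 0] 0 := by
  obtain ⟨a, u, hu, hu0, e⟩ := hh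
  intro h0
  rcases hu.eventuallyEq_zero_or (holGerm_monomial a) (e.symm.trans h0) with h | h
  · exact hu0 h.self_of_nhds
  · exact monomial_not_eventuallyEq_zero a h

theorem Mono.mul {h k : (Fin m → ℂ) → ℂ} (hh : Mono h) (hk : Mono k) :
    Mono fun y => h y * k y := by
  obtain ⟨a, u, hu, hu0, e⟩ := hh
  obtain ⟨b, v, hv, hv0, e'⟩ := hk
  refine ⟨a + b, fun y => u y * v y, hu.mul hv, mul_ne_zero hu0 hv0, ?_⟩
  filter_upwards [e, e'] with y h1 h2
  simp only [h1, h2, Pi.add_apply, pow_add, Finset.prod_mul_distrib]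
  ring

theorem Mono.pow {h : (Fin m → ℂ) → ℂ} (hh : Mono h) (n : ℕ) : Mono fun y => h y ^ n := by
  induction n with
  | zero => simpa using Mono.of_unit (HolGerm.const (1 : ℂ)) one_ne_zero
  | succ n ih => simpa only [pow_succ] using ih.mul hh

theorem Mono.coord (j : Fin m) : Mono fun y : Fin m → ℂ => y j :=
  ⟨Pi.single j 1, fun _ => 1, HolGerm.const _, one_ne_zero, Eventually.of_forall fun y => by
    simp only
    rw [Finset.prod_eq_single j] <;> simp +contextual⟩

theorem Mono.prod {ι : Type*} (s : Finset ι) {f : ι → (Fin m → ℂ) → ℂ}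
    (hf : ∀ i ∈ s, Mono (f i)) : Mono fun y => ∏ i ∈ s, f i y := by
  classical
  induction s using Finset.induction_on with
  | empty => simpa using Mono.of_unit (HolGerm.const (1 : ℂ)) one_ne_zero
  | insert i s hi ih =>
    simp only [Finset.prod_insert hi]
    exact (hf i (by simp)).mul (ih fun k hk => hf k (by simp [hk]))

theorem exists_coord_factor {f : (Fin m → ℂ) → ℂ} (hf : HolGerm f) (j : Fin m)
    (h : (fun y => f (Function.update y j 0)) =ᶠ[𝓝 0] 0) :
    ∃ g : (Fin m → ℂ) → ℂ, HolGerm g ∧ f =ᶠ[𝓝 0] fun y => y j * g y := by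
  obtain ⟨g, hg, e⟩ := hf.exists_div_coord j
  refine ⟨g, hg, ?_⟩
  filter_upwards [h, e] with y h1 h2
  simp at h1
  rw [h2, h1, zero_add]

/-- Factors of monomials are monomials. -/
theorem mono_of_mul {f g : (Fin m → ℂ) → ℂ} (hf : HolGerm f) (hg : HolGerm g)
    (h : Mono fun y => f y * g y) : Mono f ∧ Mono g := by
  obtain ⟨a, u, hu, hu0, e⟩ := h
  obtain ⟨n, hn⟩ : ∃ n, n = ∑ i, a i := ⟨_, rfl⟩
  induction n generalizing a f g with
  | zero =>
    have ha : ∀ i, a i = 0 := by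
      intro i
      exact (Finset.sum_eq_zero_iff.1 hn.symm) i (Finset.mem_univ i)
    have := e.self_of_nhds
    simp [ha] at this
    have h0 : f 0 * g 0 ≠ 0 := by rwa [this]
    exact ⟨Mono.of_unit hf (left_ne_zero_of_mul h0), Mono.of_unit hg (right_ne_zero_of_mul h0)⟩
  | succ n ih =>
    obtain ⟨j, hj⟩ : ∃ j, a j ≠ 0 := by
      by_contra! hc
      simp [hc] at hn
    set a' : Fin m → ℕ := Function.update a j (a j - 1) with ha'
    have hmon : ∀ y : Fin m → ℂ, ∏ i, y i ^ a i = y j * ∏ i, y i ^ a' i := by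
      intro y
      rw [← Finset.mul_prod_erase _ _ (Finset.mem_univ j),
        ← Finset.mul_prod_erase _ (fun i => y i ^ a' i) (Finset.mem_univ j), ← mul_assoc]
      congr 1
      · simp only [ha', Function.update_self]
        rw [← pow_succ', Nat.sub_add_cancel (Nat.one_le_iff_ne_zero.2 hj)]
      · refine Finset.prod_congr rfl fun i hi => ?_
        simp [ha', Function.update_of_ne (Finset.ne_of_mem_erase hi)]
    have hsum : n = ∑ i, a' i := by
      rw [← Finset.add_sum_erase _ _ (Finset.mem_univ j)] at hn ⊢
      have : ∑ i ∈ Finset.univ.erase j, a' i = ∑ i ∈ Finset.univ.erase j, a i :=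
        Finset.sum_congr rfl fun i hi => by
          simp [ha', Function.update_of_ne (Finset.ne_of_mem_erase hi)]
      rw [this]
      simp only [ha', Function.update_self]
      omega
    have hu0' : Function.update (0 : Fin m → ℂ) j 0 = 0 := by simp
    have hres := (holGerm_update_zero j).tendsto hu0'
    have hz : (fun y => f (Function.update y j 0) * g (Function.update y j 0)) =ᶠ[𝓝 0] 0 := by
      filter_upwards [hres.eventually e] with y hy
      rw [hy, hmon]
      simp
    have key : ∀ p q : (Fin m → ℂ) → ℂ, HolGerm p → HolGerm q →
        (fun y => p y * q y) =ᶠ[𝓝 0] (fun y => u y * ∏ i, y i ^ a i) →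
        (fun y => p (Function.update y j 0)) =ᶠ[𝓝 0] 0 → Mono p ∧ Mono q := by
      intro p q hp hq e hp0
      obtain ⟨p', hp', ep⟩ := exists_coord_factor hp j hp0
      obtain ⟨h1, h2⟩ := ih hp' hq a' (by
        refine (holGerm_coord j).eventuallyEq_of_mul_left (hp'.mul hq)
          (hu.mul (holGerm_monomial a')) (coord_not_eventuallyEq_zero j) ?_
        filter_upwards [e, ep] with y h1 h2
        rw [h2, hmon] at h1
        linear_combination h1) hsum
      exact ⟨((Mono.coord j).mul h1).congr ep.symm, h2⟩
    rcases (hf.comp (holGerm_update_zero j) hu0').eventuallyEq_zero_or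
      (hg.comp (holGerm_update_zero j) hu0') hz with h | h
    · exact key f g hf hg e h
    · exact (key g f hg hf (by simpa only [mul_comm] using e) h).symm

/-- The Jacobian determinant. -/
def jac (π : (Fin m → ℂ) → (Fin m → ℂ)) (y : Fin m → ℂ) : ℂ := (fderiv ℂ π y).det

theorem clm_det_eq (L : (Fin m → ℂ) →L[ℂ] (Fin m → ℂ)) :
    L.det = (Matrix.of fun i j => L (Pi.single j 1) i).det := by
  rw [ContinuousLinearMap.det, ← LinearMap.det_toMatrix']
  congr 1

theorem HolGerm.jac {π : (Fin m → ℂ) → (Fin m → ℂ)} (hπ : HolGerm π) : HolGerm (jac π) := by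
  have h : HolGerm fun y => (Matrix.of fun i j => fderiv ℂ (fun y => π y i) y (Pi.single j 1)).det := by
    simp only [Matrix.det_apply', Matrix.of_apply]
    exact HolGerm.sum _ fun σ _ => (HolGerm.const _).mul <| HolGerm.prod _ fun i _ =>
      (holGerm_pi.1 hπ _).fderiv_apply _
  refine h.congr ?_
  filter_upwards [hπ] with y hy
  rw [_root_.jac, clm_det_eq]
  congr 2
  ext i j
  rw [fderiv_pi (differentiableAt_pi.1 hy)]
  simp

theorem jac_comp {π ψ : (Fin m → ℂ) → (Fin m → ℂ)} {y : Fin m → ℂ}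
    (hπ : DifferentiableAt ℂ π (ψ y)) (hψ : DifferentiableAt ℂ ψ y) :
    jac (fun y => π (ψ y)) y = jac π (ψ y) * jac ψ y := by
  have : fderiv ℂ (fun y => π (ψ y)) y = (fderiv ℂ π (ψ y)).comp (fderiv ℂ ψ y) :=
    fderiv_fun_comp y hπ hψ
  rw [jac, this, jac, jac]
  exact LinearMap.det_comp _ _

theorem jac_congr {π ψ : (Fin m → ℂ) → (Fin m → ℂ)} {y : Fin m → ℂ} (h : π =ᶠ[𝓝 y] ψ) :
    jac π y = jac ψ y := by
  rw [jac, jac, h.fderiv_eq]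

theorem jac_id (y : Fin m → ℂ) : jac (fun y => y) y = 1 := by
  rw [jac, fderiv_fun_id]
  exact LinearMap.det_id

theorem jac_update (i : Fin m) {q : (Fin m → ℂ) → ℂ} {y : Fin m → ℂ}
    (hq : DifferentiableAt ℂ q y) :
    jac (fun y => Function.update y i (q y)) y = fderiv ℂ q y (Pi.single i 1) := by
  have hd : HasFDerivAt (fun y : Fin m → ℂ => Function.update y i (q y))
      (ContinuousLinearMap.pi fun k => if k = i then fderiv ℂ q y else
        ContinuousLinearMap.proj k) y := by
    refine hasFDerivAt_pi.2 fun k => ?_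
    by_cases h : k = i
    · subst h; simpa using hq.hasFDerivAt
    · simpa [h] using hasFDerivAt_apply k y
  rw [jac, hd.fderiv, clm_det_eq]
  have : (Matrix.of fun k j => (ContinuousLinearMap.pi fun k => if k = i then fderiv ℂ q y else
        ContinuousLinearMap.proj (R := ℂ) (φ := fun _ : Fin m => ℂ) k) (Pi.single j 1) k) =
      (1 : Matrix (Fin m) (Fin m) ℂ).updateRow i fun j => fderiv ℂ q y (Pi.single j 1) := by
    ext k j
    by_cases h : k = i
    · subst h; simp
    · simp [h, Matrix.updateRow_ne, Matrix.one_apply, Pi.single_apply]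
  rw [this, ← Matrix.cramer_transpose_apply]
  simp

/-- A holomorphic germ of maps fixing the origin which, off its critical locus, is finite to one in
a measurable way. -/
structure Admissible (π : (Fin m → ℂ) → (Fin m → ℂ)) : Prop where
  hol : HolGerm π
  zero : π 0 = 0
  pieces : ∃ 𝒜 : Set (Set (Fin m → ℂ)), 𝒜.Finite ∧
    (∀ A ∈ 𝒜, MeasurableSet A ∧ Set.InjOn π (A ∩ {y | jac π y ≠ 0})) ∧
    ∃ W ∈ 𝓝 (0 : Fin m → ℂ), W ∩ {y | jac π y ≠ 0} ⊆ ⋃₀ 𝒜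

/-- A family of admissible germs such that finitely many of them jointly cover a neighborhood of
the origin, whatever the chosen representatives. -/
structure AdmissibleFamily {ι : Type} (π : ι → (Fin m → ℂ) → (Fin m → ℂ)) : Prop where
  admissible : ∀ c, Admissible (π c)
  cover : ∀ W : ι → Set (Fin m → ℂ), (∀ c, W c ∈ 𝓝 0) →
    ∃ S : Finset ι, (⋃ c ∈ S, π c '' W c) ∈ 𝓝 0

/-- `h` becomes a monomial after a finite tree of admissible families, where in each
step the pullback is multiplied by the Jacobian. -/
inductive Res : ((Fin m → ℂ) → ℂ) → Prop
  | mono {h : (Fin m → ℂ) → ℂ} (hh : Mono h) : Res h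
  | step {h : (Fin m → ℂ) → ℂ} (hh : HolGerm h) {ι : Type}
      (π : ι → (Fin m → ℂ) → (Fin m → ℂ)) (hπ : AdmissibleFamily π)
      (hc : ∀ c, Res fun y => jac (π c) y * h (π c y)) : Res h

theorem Res.congr {h k : (Fin m → ℂ) → ℂ} (hh : Res h) (e : h =ᶠ[𝓝 0] k) : Res k := by
  induction hh generalizing k with
  | mono hh => exact .mono (hh.congr e)
  | step hh π hπ hc ih =>
    refine .step (hh.congr e) π hπ fun c => ih c ?_
    have := (hπ.admissible c)
    filter_upwards [(this.hol.tendsto this.zero).eventually e] with y hy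
    rw [hy]

theorem Res.unit_mul {h w : (Fin m → ℂ) → ℂ} (hh : Res h) (hw : HolGerm w) (hw0 : w 0 ≠ 0) :
    Res fun y => w y * h y := by
  induction hh generalizing w with
  | mono hh => exact .mono ((Mono.of_unit hw hw0).mul hh)
  | step hh π hπ hc ih =>
    refine .step (hw.mul hh) π hπ fun c => ?_
    have := (hπ.admissible c)
    refine (ih c (hw.comp this.hol this.zero) (by simpa [this.zero] using hw0)).congr
      (Eventually.of_forall fun y => ?_)
    simp only; ring

section bihol
variable {π ψ : (Fin m → ℂ) → (Fin m → ℂ)}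

theorem admissibleFamily_of_inverse (hπ : HolGerm π) (hψ : HolGerm ψ) (hπ0 : π 0 = 0)
    (hψ0 : ψ 0 = 0) (h1 : ∀ᶠ y in 𝓝 0, ψ (π y) = y) (h2 : ∀ᶠ y in 𝓝 0, π (ψ y) = y) :
    AdmissibleFamily fun _ : Unit => π where
  admissible _ := by
    obtain ⟨r, hr, hb⟩ := Metric.eventually_nhds_iff_ball.1 h1
    refine ⟨hπ, hπ0, {Metric.ball 0 r}, Set.finite_singleton _, ?_, _, Metric.ball_mem_nhds 0 hr,
      by simp⟩
    rintro A rfl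
    refine ⟨Metric.isOpen_ball.measurableSet, ?_⟩
    intro y hy z hz e
    rw [← hb y hy.1, ← hb z hz.1, e]
  cover W hW := by
    refine ⟨{()}, ?_⟩
    filter_upwards [h2, hψ.tendsto hψ0 (hW ())] with y hy hy'
    exact Set.mem_iUnion₂.2 ⟨(), by simp, ψ y, hy', hy⟩

theorem Res.of_inverse (hπ : HolGerm π) (hψ : HolGerm ψ) (hπ0 : π 0 = 0)
    (hψ0 : ψ 0 = 0) (h1 : ∀ᶠ y in 𝓝 0, ψ (π y) = y) (h2 : ∀ᶠ y in 𝓝 0, π (ψ y) = y)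
    {h : (Fin m → ℂ) → ℂ} (hh : HolGerm h) (hr : Res fun y => h (π y)) : Res h := by
  refine .step hh _ (admissibleFamily_of_inverse hπ hψ hπ0 hψ0 h1 h2) fun _ => ?_
  refine hr.unit_mul hπ.jac ?_
  have h3 := jac_comp (π := ψ) (ψ := π) (y := 0) (by rw [hπ0]; exact hψ.differentiableAt)
    hπ.differentiableAt
  rw [jac_congr h1, jac_id] at h3
  exact right_ne_zero_of_mul (h3.symm ▸ one_ne_zero)

end bihol

section power

/-- The coordinatewise power map. -/
def powMap (N : Fin m → ℕ) (y : Fin m → ℂ) : Fin m → ℂ := fun i => y i ^ N i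

theorem holGerm_powMap (N : Fin m → ℕ) : HolGerm (powMap N) :=
  holGerm_pi.2 fun i => (holGerm_coord i).pow _

theorem jac_powMap (N : Fin m → ℕ) (y : Fin m → ℂ) :
    jac (powMap N) y = ∏ i, (N i : ℂ) * y i ^ (N i - 1) := by
  have hd : HasFDerivAt (powMap N) (ContinuousLinearMap.pi fun k =>
      ((N k : ℂ) * y k ^ (N k - 1)) • ContinuousLinearMap.proj (R := ℂ) (φ := fun _ : Fin m => ℂ) k)
      y := by
    refine hasFDerivAt_pi.2 fun k => ?_
    simpa [powMap, smul_smul] using (hasFDerivAt_apply (𝕜 := ℂ) k y).pow (N k)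
  rw [jac, hd.fderiv, clm_det_eq, ← Matrix.det_diagonal]
  congr 1
  ext k j
  by_cases h : k = j
  · subst h; simp
  · simp [h]

theorem mono_jac_powMap {N : Fin m → ℕ} (hN : ∀ i, N i ≠ 0) : Mono (jac (powMap N)) := by
  refine ⟨fun i => N i - 1, fun _ => ∏ i, (N i : ℂ), HolGerm.const _, ?_, ?_⟩
  · exact Finset.prod_ne_zero_iff.2 fun i _ => by exact_mod_cast hN i
  · exact Eventually.of_forall fun y => by rw [jac_powMap, Finset.prod_mul_distrib]

theorem admissibleFamily_powMap {N : Fin m → ℕ} (hN : ∀ i, N i ≠ 0) :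
    AdmissibleFamily fun _ : Unit => powMap N where
  admissible _ := by
    refine ⟨holGerm_powMap N, ?_, ?_⟩
    · ext i; simp [powMap, hN i]
    · let A : (Fin m → ℂ) → Set (Fin m → ℂ) := fun ω =>
        {z | ∀ i, z i = ω i * (z i ^ N i) ^ ((N i : ℂ)⁻¹)}
      refine ⟨A '' (Fintype.piFinset fun i => Polynomial.nthRootsFinset (N i) (1 : ℂ)),
        (Finset.finite_toSet _).image _, ?_, Set.univ, univ_mem, ?_⟩
      · rintro _ ⟨ω, -, rfl⟩
        constructor
        · have : A ω = ⋂ i, {z | z i = ω i * (z i ^ N i) ^ ((N i : ℂ)⁻¹)} := by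
            ext z; simp [A]
          rw [this]
          refine MeasurableSet.iInter fun i => measurableSet_eq_fun ?_ ?_ <;> fun_prop
        · rintro y ⟨hy, -⟩ z ⟨hz, -⟩ e
          ext i
          have : y i ^ N i = z i ^ N i := congrFun e i
          rw [hy i, hz i, this]
      · rintro z -
        have : ∀ i, ∃ ω : ℂ, ω ∈ Polynomial.nthRootsFinset (N i) (1 : ℂ) ∧
            z i = ω * (z i ^ N i) ^ ((N i : ℂ)⁻¹) := by
          intro i
          have hp := Nat.pos_of_ne_zero (hN i)
          by_cases hz : z i = 0
          · refine ⟨1, by rw [Polynomial.mem_nthRootsFinset hp]; simp, ?_⟩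
            simp [hz, hN i]
          · have hs := Complex.cpow_nat_inv_pow (z i ^ N i) (hN i)
            have hs0 : (z i ^ N i) ^ ((N i : ℂ)⁻¹) ≠ 0 := by
              intro h0
              rw [h0, zero_pow (hN i)] at hs
              exact hz (eq_zero_of_pow_eq_zero hs.symm)
            refine ⟨z i / (z i ^ N i) ^ ((N i : ℂ)⁻¹), ?_, by field_simp⟩
            rw [Polynomial.mem_nthRootsFinset hp, div_pow, hs, div_self (pow_ne_zero _ hz)]
        choose ω hω1 hω2 using this
        exact ⟨A ω, ⟨ω, by simpa using hω1, rfl⟩, hω2⟩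
  cover W hW := by
    refine ⟨{()}, ?_⟩
    obtain ⟨r, hr, hb⟩ := Metric.mem_nhds_iff.1 (hW ())
    have : ∀ᶠ w in 𝓝 (0 : Fin m → ℂ), ∀ i, ‖w i‖ < r ^ N i := by
      refine eventually_all.2 fun i => ?_
      have h : Continuous fun w : Fin m → ℂ => ‖w i‖ := by fun_prop
      exact h.tendsto' 0 0 (by simp) |>.eventually_lt_const (by positivity)
    filter_upwards [this] with w hw
    refine Set.mem_iUnion₂.2 ⟨(), by simp, fun i => w i ^ ((N i : ℂ)⁻¹), hb ?_, ?_⟩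
    · rw [mem_ball_zero_iff, pi_norm_lt_iff hr]
      intro i
      refine lt_of_pow_lt_pow_left₀ (N i) hr.le ?_
      rw [← norm_pow, Complex.cpow_nat_inv_pow _ (hN i)]
      exact hw i
    · ext i
      exact Complex.cpow_nat_inv_pow _ (hN i)

end power

section blowup

/-- The charts of the blow-up of `{y i = y j = 0}`. -/
def blowMap (i j : Fin m) : Option ℂ → (Fin m → ℂ) → (Fin m → ℂ)
  | some c, y => Function.update y i (y j * (y i + c))
  | none, y => Function.update y j (y j * y i)

theorem jac_blowMap_some {i j : Fin m} (hij : i ≠ j) (c : ℂ) (y : Fin m → ℂ) :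
    jac (blowMap i j (some c)) y = y j := by
  have h : HasFDerivAt (fun y : Fin m → ℂ => y j * (y i + c)) _ y :=
    (hasFDerivAt_apply (𝕜 := ℂ) j y).mul ((hasFDerivAt_apply (𝕜 := ℂ) i y).add_const c)
  have := jac_update i h.differentiableAt
  rw [h.fderiv] at this
  change jac (fun y => Function.update y i (y j * (y i + c))) y = y j
  simpa [hij, hij.symm] using this

theorem jac_blowMap_none {i j : Fin m} (hij : i ≠ j) (y : Fin m → ℂ) :
    jac (blowMap i j none) y = y i := by
  have h : HasFDerivAt (fun y : Fin m → ℂ => y j * y i) _ y :=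
    (hasFDerivAt_apply (𝕜 := ℂ) j y).mul ((hasFDerivAt_apply (𝕜 := ℂ) i y))
  have := jac_update j h.differentiableAt
  rw [h.fderiv] at this
  change jac (fun y => Function.update y j (y j * y i)) y = y i
  simpa [hij, hij.symm] using this

theorem holGerm_blowMap (i j : Fin m) (c : Option ℂ) : HolGerm (blowMap i j c) := by
  refine holGerm_pi.2 fun k => ?_
  rcases c with _ | c
  · by_cases h : k = j
    · subst h; simpa [blowMap] using (holGerm_coord k).mul (holGerm_coord i)
    · simpa [blowMap, h] using (holGerm_coord k)
  · by_cases h : k = i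
    · subst h; simpa [blowMap] using (holGerm_coord j).mul ((holGerm_coord k).add (HolGerm.const c))
    · simpa [blowMap, h] using (holGerm_coord k)

theorem blowMap_zero (i j : Fin m) (c : Option ℂ) : blowMap i j c 0 = 0 := by
  rcases c with _ | c <;> simp [blowMap]

theorem admissibleFamily_blowMap {i j : Fin m} (hij : i ≠ j) :
    AdmissibleFamily (blowMap i j) where
  admissible c := by
    refine ⟨holGerm_blowMap i j c, blowMap_zero i j c, {Set.univ}, Set.finite_singleton _, ?_,
      Set.univ, univ_mem, by simp⟩
    rintro A rfl
    refine ⟨MeasurableSet.univ, ?_⟩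
    rintro y ⟨-, hy⟩ z ⟨-, hz⟩ e
    ext k
    have ek : ∀ k, blowMap i j c y k = blowMap i j c z k := fun k => congrFun e k
    rcases c with _ | c
    · simp only [Set.mem_ofPred_eq, jac_blowMap_none hij] at hy hz
      have e1 := ek i
      have e2 := ek j
      simp only [blowMap, Function.update_of_ne hij, Function.update_self] at e1 e2
      by_cases h : k = j
      · subst h
        rw [e1] at e2
        exact mul_right_cancel₀ hz e2
      · simpa [blowMap, h] using ek k
    · simp only [Set.mem_ofPred_eq, jac_blowMap_some hij] at hy hz
      have e1 := ek i
      have e2 := ek j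
      simp only [blowMap, Function.update_of_ne hij.symm, Function.update_self] at e1 e2
      by_cases h : k = i
      · subst h
        rw [e2] at e1
        exact add_right_cancel (mul_left_cancel₀ hz e1)
      · simpa [blowMap, h] using ek k
  cover W hW := by
    classical
    have hW' : ∀ c, ∃ ε > 0, Metric.ball 0 ε ⊆ W c := fun c => Metric.mem_nhds_iff.1 (hW c)
    choose ε hε hb using hW'
    set R : ℝ := 2 / ε none with hR
    have hRpos : 0 < R := div_pos two_pos (hε none)
    obtain ⟨T, hT⟩ := (isCompact_closedBall (0 : ℂ) R).elim_nhds_subcover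
      (fun c => Metric.ball c (ε (some c))) (fun c _ => Metric.ball_mem_nhds c (hε _))
    refine ⟨insert none (T.image some), ?_⟩
    have : ∀ᶠ z in 𝓝 (0 : Fin m → ℂ), ‖z‖ < ε none ∧ ∀ c ∈ T, ‖z‖ < ε (some c) := by
      have hz : Tendsto (fun z : Fin m → ℂ => ‖z‖) (𝓝 0) (𝓝 0) := tendsto_norm_zero
      exact (hz.eventually_lt_const (hε _)).and
        ((Filter.eventually_all_finset T).2 fun c _ => hz.eventually_lt_const (hε _))
    filter_upwards [this] with z hz
    by_cases h : ‖z i‖ ≤ R * ‖z j‖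
    · set t : ℂ := z i / z j with ht
      have htz : z j * t = z i := by
        by_cases h0 : z j = 0
        · have : z i = 0 := by simpa [h0] using h
          simp [h0, this]
        · rw [ht]; field_simp
      have htR : t ∈ Metric.closedBall (0 : ℂ) R := by
        rw [mem_closedBall_zero_iff, ht, norm_div]
        exact div_le_of_le_mul₀ (norm_nonneg _) hRpos.le h
      obtain ⟨c, hc, htc⟩ := Set.mem_iUnion₂.1 (hT.2 htR)
      refine Set.mem_iUnion₂.2 ⟨some c, by simp [hc], Function.update z i (t - c), hb _ ?_, ?_⟩
      · rw [mem_ball_zero_iff, pi_norm_lt_iff (hε _)]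
        intro k
        by_cases hk : k = i
        · subst hk; simpa [dist_eq_norm] using htc
        · rw [Function.update_of_ne hk]
          exact (norm_le_pi_norm z k).trans_lt (hz.2 c hc)
      · simp [blowMap, Function.update_of_ne hij.symm, htz]
    · push Not at h
      have hi0 : z i ≠ 0 := by
        intro h0
        rw [h0, norm_zero] at h
        have : 0 ≤ R * ‖z j‖ := by positivity
        linarith
      refine Set.mem_iUnion₂.2 ⟨none, by simp, Function.update z j (z j / z i), hb _ ?_, ?_⟩
      · rw [mem_ball_zero_iff, pi_norm_lt_iff (hε _)]
        intro k
        by_cases hk : k = j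
        · subst hk
          rw [Function.update_self, norm_div, div_lt_iff₀ (norm_pos_iff.2 hi0)]
          have h3 := hε none
          have : ε none * R = 2 := by rw [hR]; field_simp
          have h2 : 0 ≤ ‖z k‖ := norm_nonneg _
          nlinarith [mul_lt_mul_of_pos_left h h3]
        · rw [Function.update_of_ne hk]
          exact (norm_le_pi_norm z k).trans_lt hz.1
      · simp [blowMap, Function.update_of_ne hij, hi0]

end blowup

/-- The last `m` coordinates. -/
def base (z : Fin (m + 1) → ℂ) : Fin m → ℂ := fun i => z i.succ

/-- Extension of a map by the identity in the coordinate `0`. -/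
def liftMap (ρ : (Fin m → ℂ) → (Fin m → ℂ)) (z : Fin (m + 1) → ℂ) : Fin (m + 1) → ℂ :=
  Fin.cons (z 0) (ρ (base z))

@[simp] theorem base_apply (z : Fin (m + 1) → ℂ) (i : Fin m) : base z i = z i.succ := rfl

@[simp] theorem base_zero : base (0 : Fin (m + 1) → ℂ) = 0 := rfl

@[simp] theorem base_cons (x : ℂ) (y : Fin m → ℂ) :
    base (Fin.cons x y : Fin (m + 1) → ℂ) = y := rfl

@[simp] theorem liftMap_apply_zero (ρ : (Fin m → ℂ) → (Fin m → ℂ)) (z : Fin (m + 1) → ℂ) :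
    liftMap ρ z 0 = z 0 := rfl

@[simp] theorem base_liftMap (ρ : (Fin m → ℂ) → (Fin m → ℂ)) (z : Fin (m + 1) → ℂ) :
    base (liftMap ρ z) = ρ (base z) := rfl

theorem cons_base (z : Fin (m + 1) → ℂ) : (Fin.cons (z 0) (base z) : Fin (m + 1) → ℂ) = z :=
  Fin.cons_self_tail z

theorem differentiable_base : Differentiable ℂ (base : (Fin (m + 1) → ℂ) → _) :=
  differentiable_pi.2 fun i => differentiable_apply i.succ

theorem holGerm_base : HolGerm (base : (Fin (m + 1) → ℂ) → _) := differentiable_base.holGerm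

theorem HolGerm.comp_base {f : (Fin m → ℂ) → ℂ} (hf : HolGerm f) :
    HolGerm fun z : Fin (m + 1) → ℂ => f (base z) :=
  hf.comp holGerm_base base_zero

theorem tendsto_base : Tendsto (base : (Fin (m + 1) → ℂ) → _) (𝓝 0) (𝓝 0) :=
  holGerm_base.tendsto base_zero

theorem Mono.comp_base {f : (Fin m → ℂ) → ℂ} (hf : Mono f) :
    Mono fun z : Fin (m + 1) → ℂ => f (base z) := by
  obtain ⟨a, u, hu, hu0, e⟩ := hf
  refine ⟨Fin.cons 0 a, fun z => u (base z), hu.comp_base, hu0, ?_⟩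
  filter_upwards [tendsto_base.eventually e] with z hz
  rw [hz, Fin.prod_univ_succ]
  simp

theorem holGerm_cons {X : Type*} [NormedAddCommGroup X] [NormedSpace ℂ X] {x : X → ℂ}
    {y : X → Fin m → ℂ} (hx : HolGerm x) (hy : HolGerm y) :
    HolGerm fun t => (Fin.cons (x t) (y t) : Fin (m + 1) → ℂ) := by
  refine holGerm_pi.2 fun i => ?_
  refine Fin.cases ?_ (fun i => ?_) i
  · simpa using hx
  · simpa using holGerm_pi.1 hy i

theorem HolGerm.liftMap {ρ : (Fin m → ℂ) → (Fin m → ℂ)} (hρ : HolGerm ρ) :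
    HolGerm (liftMap ρ) :=
  holGerm_cons (holGerm_coord 0) (hρ.comp holGerm_base base_zero)

theorem liftMap_zero {ρ : (Fin m → ℂ) → (Fin m → ℂ)} (h0 : ρ 0 = 0) :
    liftMap ρ 0 = 0 := by
  ext i
  refine Fin.cases ?_ (fun i => ?_) i
  · rfl
  · simp [_root_.liftMap, h0]

theorem jac_liftMap {ρ : (Fin m → ℂ) → (Fin m → ℂ)} {z : Fin (m + 1) → ℂ}
    (hρ : DifferentiableAt ℂ ρ (base z)) : jac (liftMap ρ) z = jac ρ (base z) := by
  have hb : HasFDerivAt (base : (Fin (m + 1) → ℂ) → _)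
      (ContinuousLinearMap.pi fun i : Fin m => ContinuousLinearMap.proj (R := ℂ)
        (φ := fun _ : Fin (m + 1) => ℂ) i.succ) z :=
    hasFDerivAt_pi.2 fun i => hasFDerivAt_apply (𝕜 := ℂ) i.succ z
  have hd : HasFDerivAt (liftMap ρ) (ContinuousLinearMap.pi (φ := fun _ : Fin (m + 1) => ℂ)
      fun k => Fin.cases (ContinuousLinearMap.proj (R := ℂ) (φ := fun _ : Fin (m + 1) => ℂ) 0)
        (fun k => (ContinuousLinearMap.proj (R := ℂ) (φ := fun _ : Fin m => ℂ) k).comp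
          ((fderiv ℂ ρ (base z)).comp (ContinuousLinearMap.pi fun i : Fin m =>
            ContinuousLinearMap.proj (R := ℂ) (φ := fun _ : Fin (m + 1) => ℂ) i.succ))) k) z := by
    refine hasFDerivAt_pi.2 fun k => ?_
    refine Fin.cases ?_ (fun k => ?_) k
    · exact hasFDerivAt_apply (𝕜 := ℂ) (0 : Fin (m + 1)) z
    · exact (hasFDerivAt_apply (𝕜 := ℂ) k _).comp z (hρ.hasFDerivAt.comp z hb)
  rw [jac, hd.fderiv, clm_det_eq, Matrix.det_succ_row_zero, Finset.sum_eq_single 0]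
  · rw [jac, clm_det_eq]
    simp only [Fin.val_zero, pow_zero, one_mul, Matrix.of_apply, ContinuousLinearMap.coe_pi',
      Fin.cases_zero, ContinuousLinearMap.proj_apply, Pi.single_eq_same]
    congr 1
    ext i j
    simp only [Matrix.submatrix_apply, Matrix.of_apply, ContinuousLinearMap.coe_pi',
      Fin.cases_succ, ContinuousLinearMap.comp_apply, ContinuousLinearMap.proj_apply]
    refine congrFun (congrArg _ ?_) i
    ext k
    simp [Pi.single_apply]
  · intro j _ hj
    simp [hj.symm]
  · simp

theorem AdmissibleFamily.lift {ι : Type} {π : ι → (Fin m → ℂ) → (Fin m → ℂ)}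
    (hπ : AdmissibleFamily π) : AdmissibleFamily fun c => liftMap (π c) where
  admissible c := by
    obtain ⟨h1, h0, 𝒜, hf, hA, W, hW, hWA⟩ := hπ.admissible c
    refine ⟨h1.liftMap, liftMap_zero h0, ?_⟩
    obtain ⟨r, hr, hb⟩ := Metric.eventually_nhds_iff_ball.1 h1
    set B : Set (Fin (m + 1) → ℂ) := base ⁻¹' Metric.ball 0 r with hB
    have hBo : IsOpen B := Metric.isOpen_ball.preimage differentiable_base.continuous
    have hJ : ∀ z ∈ B, jac (liftMap (π c)) z = jac (π c) (base z) := fun z hz =>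
      jac_liftMap (hb _ hz)
    refine ⟨(fun A => base ⁻¹' A ∩ B) '' 𝒜, hf.image _, ?_, base ⁻¹' W ∩ B, ?_, ?_⟩
    · rintro _ ⟨A, hAm, rfl⟩
      obtain ⟨hm, hi⟩ := hA A hAm
      refine ⟨(differentiable_base.continuous.measurable hm).inter hBo.measurableSet, ?_⟩
      rintro y ⟨⟨hy1, hy2⟩, hy3⟩ z ⟨⟨hz1, hz2⟩, hz3⟩ e
      simp only [Set.mem_ofPred_eq, hJ y hy2, hJ z hz2] at hy3 hz3
      have e1 : base y = base z := hi ⟨hy1, hy3⟩ ⟨hz1, hz3⟩ (congrArg base e)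
      rw [← cons_base y, ← cons_base z, e1, show y 0 = z 0 from congrFun e 0]
    · exact inter_mem (tendsto_base hW) (tendsto_base (Metric.ball_mem_nhds 0 hr))
    · rintro z ⟨⟨hz1, hz2⟩, hz3⟩
      simp only [Set.mem_ofPred_eq, hJ z hz2] at hz3
      obtain ⟨A, hAm, hzA⟩ := hWA ⟨hz1, hz3⟩
      exact ⟨_, ⟨A, hAm, rfl⟩, hzA, hz2⟩
  cover W hW := by
    have hW' : ∀ c, ∃ ε > 0, Metric.ball 0 ε ⊆ W c := fun c => Metric.mem_nhds_iff.1 (hW c)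
    choose ε hε hb using hW'
    obtain ⟨S, hS⟩ := hπ.cover (fun c => Metric.ball 0 (ε c))
      fun c => Metric.ball_mem_nhds 0 (hε c)
    refine ⟨S, ?_⟩
    have h0 : ∀ᶠ z in 𝓝 (0 : Fin (m + 1) → ℂ), ∀ c ∈ S, ‖z 0‖ < ε c := by
      refine (Filter.eventually_all_finset S).2 fun c _ => ?_
      have h : Continuous fun w : Fin (m + 1) → ℂ => ‖w 0‖ := by fun_prop
      exact h.tendsto' 0 0 (by simp) |>.eventually_lt_const (hε c)
    filter_upwards [h0, tendsto_base hS] with z hz hz'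
    obtain ⟨c, hc, y, hy, hyz⟩ := Set.mem_iUnion₂.1 hz'
    refine Set.mem_iUnion₂.2 ⟨c, hc, Fin.cons (z 0) y, hb c ?_, ?_⟩
    · rw [mem_ball_zero_iff, pi_norm_lt_iff (hε c)] at *
      intro i
      refine Fin.cases ?_ (fun i => ?_) i
      · exact hz c hc
      · exact hy i
    · simp only [liftMap, base_cons, Fin.cons_zero]
      rw [hyz, cons_base]

/-- To resolve `h`, one may first make the function `δ` of the base coordinates monomial. -/
theorem Res.lift {δ : (Fin m → ℂ) → ℂ} (hδ : Res δ) : ∀ {h : (Fin (m + 1) → ℂ) → ℂ}, HolGerm h →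
    (∀ (ρ : (Fin m → ℂ) → (Fin m → ℂ)) (b : (Fin m → ℂ) → ℂ), HolGerm ρ → ρ 0 = 0 →
      Mono (fun y => δ (ρ y)) → Mono b → Res fun z => b (base z) * h (liftMap ρ z)) →
    Res h := by
  induction hδ with
  | mono hδ =>
    intro h hh H
    refine (H (fun y => y) (fun _ => 1) differentiable_id.holGerm rfl hδ
      (Mono.of_unit (HolGerm.const _) one_ne_zero)).congr (Eventually.of_forall fun z => ?_)
    simp only [one_mul, liftMap]
    rw [cons_base]
  | @step δ hδ ι π hπ hc ih =>
    intro h hh H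
    refine .step hh _ hπ.lift fun c => ?_
    have hl := hπ.lift.admissible c
    have hp := hπ.admissible c
    refine ih c (hl.hol.jac.mul (hh.comp hl.hol hl.zero)) ?_
    intro ρ b hρ hρ0 hM hb
    obtain ⟨hM1, hM2⟩ := mono_of_mul (hp.hol.jac.comp hρ hρ0)
      ((hδ.comp hp.hol hp.zero).comp hρ hρ0) hM
    refine (H (fun y => π c (ρ y)) (fun y => b y * jac (π c) (ρ y)) (hp.hol.comp hρ hρ0)
      (by rw [hρ0, hp.zero]) hM2 (hb.mul hM1)).congr ?_
    filter_upwards [tendsto_base ((hρ.tendsto hρ0) hp.hol)] with z hz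
    have hz' : DifferentiableAt ℂ (π c) (base (liftMap ρ z)) := hz
    simp only [jac_liftMap hz', base_liftMap]
    rw [mul_assoc]
    rfl

theorem monomial_update_of_eq_zero {B : Fin m → ℕ} {j : Fin m} (hj : B j = 0) (y : Fin m → ℂ) :
    ∏ k, Function.update y j 0 k ^ B k = ∏ k, y k ^ B k := by
  refine Finset.prod_congr rfl fun k _ => ?_
  by_cases h : k = j
  · subst h; simp [hj]
  · rw [Function.update_of_ne h]

theorem monomial_update_of_ne_zero {B : Fin m → ℕ} {j : Fin m} (hj : B j ≠ 0) (y : Fin m → ℂ) :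
    ∏ k, Function.update y j 0 k ^ B k = 0 :=
  Finset.prod_eq_zero (Finset.mem_univ j) (by simp [hj])

theorem not_eventuallyEq_zero_unit_mul_monomial {u : (Fin m → ℂ) → ℂ} (hu : HolGerm u)
    (hu0 : u 0 ≠ 0) (A : Fin m → ℕ) : ¬ (fun y => u y * ∏ k, y k ^ A k) =ᶠ[𝓝 0] 0 :=
  Mono.not_eventuallyEq_zero ⟨A, u, hu, hu0, EventuallyEq.rfl⟩

theorem sub_monomial_update_not_eventuallyEq_zero {A B : Fin m → ℕ} {u v : (Fin m → ℂ) → ℂ}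
    (hv : HolGerm v) (hv0 : v 0 ≠ 0) {i j : Fin m} (hA : A i ≠ 0) (hBi : B i = 0) (hBj : B j = 0) :
    ¬ (fun y => u (Function.update y j 0) * ∏ k, Function.update y j 0 k ^ A k -
      v (Function.update y j 0) * ∏ k, Function.update y j 0 k ^ B k) =ᶠ[𝓝 0] 0 := by
  intro h
  have hi0 : Function.update (0 : Fin m → ℂ) i 0 = 0 := by simp
  have hj0 : Function.update (0 : Fin m → ℂ) j 0 = 0 := by simp
  refine not_eventuallyEq_zero_unit_mul_monomial
    ((hv.comp (holGerm_update_zero i) hi0).comp (holGerm_update_zero j) hj0)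
    (by simpa using hv0) B ?_
  filter_upwards [(holGerm_update_zero i).tendsto hi0 h] with y hy
  have e : Function.update (Function.update y j 0) i (0 : ℂ) =
      Function.update (Function.update y i 0) j 0 := by
    by_cases hij : i = j
    · subst hij; simp
    · exact Function.update_comm (Ne.symm hij) _ _ _
  have hz1 := monomial_update_of_ne_zero hA (Function.update y j 0)
  have hz2 := monomial_update_of_eq_zero hBi (Function.update y j 0)
  simp only [Set.mem_ofPred_eq, Pi.zero_apply, ← e, Set.mem_preimage] at hy
  rw [hz1, hz2, monomial_update_of_eq_zero hBj] at hy
  simpa using hy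

theorem comparable_of_disjoint {A B : Fin m → ℕ} {u v : (Fin m → ℂ) → ℂ} (hu : HolGerm u)
    (hu0 : u 0 ≠ 0) (hv : HolGerm v) (hv0 : v 0 ≠ 0) (hAB : ∀ i, A i = 0 ∨ B i = 0) {i i' : Fin m}
    (hi : A i ≠ 0) (hi' : B i' ≠ 0)
    (h : (fun y => u y * ∏ k, y k ^ A k - v y * ∏ k, y k ^ B k) =ᶠ[𝓝 0] 0 ∨
      Mono fun y => u y * ∏ k, y k ^ A k - v y * ∏ k, y k ^ B k) : False := by
  have hj0 : ∀ j, Function.update (0 : Fin m → ℂ) j 0 = 0 := by simp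
  obtain ⟨j, hj⟩ : ∃ j, (fun y => u (Function.update y j 0) * ∏ k, Function.update y j 0 k ^ A k -
      v (Function.update y j 0) * ∏ k, Function.update y j 0 k ^ B k) =ᶠ[𝓝 0] 0 := by
    rcases h with h | ⟨C, w, hw, hw0, e⟩
    · exact ⟨i, (holGerm_update_zero i).tendsto (hj0 i) h⟩
    · have h0 := e.self_of_nhds
      have hA0 : ∏ k, (0 : Fin m → ℂ) k ^ A k = 0 :=
        Finset.prod_eq_zero (Finset.mem_univ i) (by simp [hi])
      have hB0 : ∏ k, (0 : Fin m → ℂ) k ^ B k = 0 :=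
        Finset.prod_eq_zero (Finset.mem_univ i') (by simp [hi'])
      simp only [hA0, hB0, mul_zero, sub_zero] at h0
      have h1 := (mul_eq_zero.1 h0.symm).resolve_left hw0
      obtain ⟨j, -, hj⟩ := Finset.prod_eq_zero_iff.1 h1
      refine ⟨j, ?_⟩
      filter_upwards [(holGerm_update_zero j).tendsto (hj0 j) e] with y hy
      simp only [Set.mem_preimage, Set.mem_ofPred_eq] at hy
      rw [hy, monomial_update_of_ne_zero, mul_zero]
      · rfl
      · intro hC
        simp [hC] at hj
  rcases hAB j with hA | hB
  · refine sub_monomial_update_not_eventuallyEq_zero (u := v) hu hu0 hi'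
      ((hAB i').resolve_right hi') hA ?_
    filter_upwards [hj] with y hy
    simp only [Pi.zero_apply] at hy ⊢
    linear_combination -hy
  · exact sub_monomial_update_not_eventuallyEq_zero hv hv0 hi ((hAB i).resolve_left hi) hB hj

/-- Two monomials (up to units) whose difference is a monomial up to a unit divide each other. -/
theorem comparable_of_sub {A B : Fin m → ℕ} {u v : (Fin m → ℂ) → ℂ} (hu : HolGerm u)
    (hu0 : u 0 ≠ 0) (hv : HolGerm v) (hv0 : v 0 ≠ 0)
    (h : (fun y => u y * ∏ k, y k ^ A k - v y * ∏ k, y k ^ B k) =ᶠ[𝓝 0] 0 ∨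
      Mono fun y => u y * ∏ k, y k ^ A k - v y * ∏ k, y k ^ B k) : A ≤ B ∨ B ≤ A := by
  by_contra! hc
  obtain ⟨hc1, hc2⟩ := hc
  simp only [Pi.le_def, not_forall, not_le] at hc1 hc2
  obtain ⟨i, hi⟩ := hc1
  obtain ⟨i', hi'⟩ := hc2
  set M : Fin m → ℕ := fun k => min (A k) (B k) with hM
  have hsplit : ∀ (A' : Fin m → ℕ), M ≤ A' → ∀ y : Fin m → ℂ,
      ∏ k, y k ^ A' k = (∏ k, y k ^ M k) * ∏ k, y k ^ (A' k - M k) := by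
    intro A' hA' y
    rw [← Finset.prod_mul_distrib]
    refine Finset.prod_congr rfl fun k _ => ?_
    rw [← pow_add, Nat.add_sub_cancel' (hA' k)]
  have hfac : (fun y : Fin m → ℂ => u y * ∏ k, y k ^ A k - v y * ∏ k, y k ^ B k) =
      fun y => (∏ k, y k ^ M k) *
        (u y * ∏ k, y k ^ (A k - M k) - v y * ∏ k, y k ^ (B k - M k)) := by
    ext y
    rw [hsplit A (fun k => min_le_left _ _), hsplit B (fun k => min_le_right _ _)]
    ring
  have hrest : HolGerm fun y : Fin m → ℂ =>
      u y * ∏ k, y k ^ (A k - M k) - v y * ∏ k, y k ^ (B k - M k) :=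
    (hu.mul (holGerm_monomial _)).sub (hv.mul (holGerm_monomial _))
  refine comparable_of_disjoint (A := fun k => A k - M k) (B := fun k => B k - M k) hu hu0 hv hv0
    (i := i) (i' := i') (fun k => ?_) ?_ ?_ ?_
  · simp only [hM]; omega
  · simp only [hM]; omega
  · simp only [hM]; omega
  · rw [hfac] at h
    rcases h with h | h
    · exact Or.inl (((holGerm_monomial M).eventuallyEq_zero_or hrest h).resolve_left
        (monomial_not_eventuallyEq_zero M))
    · exact Or.inr (mono_of_mul (holGerm_monomial M) hrest h).2

/-- The partial derivative in the coordinate `0`. -/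
def derivZero (f : (Fin (m + 1) → ℂ) → ℂ) (z : Fin (m + 1) → ℂ) : ℂ := fderiv ℂ f z (Pi.single 0 1)

section derivZero
variable {f g : (Fin (m + 1) → ℂ) → ℂ}

theorem HolGerm.derivZero_hol (hf : HolGerm f) : HolGerm (derivZero f) := hf.fderiv_apply _

theorem HolGerm.iterate_derivZero (hf : HolGerm f) (k : ℕ) : HolGerm (derivZero^[k] f) := by
  induction k with
  | zero => exact hf
  | succ k ih => rw [Function.iterate_succ_apply']; exact ih.derivZero_hol

theorem derivZero_congr (h : f =ᶠ[𝓝 0] g) : derivZero f =ᶠ[𝓝 0] derivZero g := by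
  filter_upwards [h.eventually_nhds] with z hz
  have : f =ᶠ[𝓝 z] g := hz
  rw [derivZero, derivZero, this.fderiv_eq]

theorem iterate_derivZero_succ_eq {c : (Fin m → ℂ) → ℂ} (hc : HolGerm c) (hg : HolGerm g)
    (h : f =ᶠ[𝓝 0] fun z => c (base z) + z 0 * g z) (k : ℕ) :
    derivZero^[k + 1] f =ᶠ[𝓝 0] fun z => (k + 1) * (derivZero^[k] g) z + z 0 * (derivZero^[k + 1] g) z := by
  induction k with
  | zero =>
    refine (derivZero_congr h).trans ?_
    filter_upwards [hc.comp_base, hg, tendsto_base hc] with z h1 h2 h3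
    have hb : HasFDerivAt (base : (Fin (m + 1) → ℂ) → _)
        (ContinuousLinearMap.pi fun i : Fin m => ContinuousLinearMap.proj (R := ℂ)
          (φ := fun _ : Fin (m + 1) => ℂ) i.succ) z :=
      hasFDerivAt_pi.2 fun i => hasFDerivAt_apply (𝕜 := ℂ) i.succ z
    have h3' : HasFDerivAt c (fderiv ℂ c (base z)) (base z) :=
      DifferentiableAt.hasFDerivAt h3
    have hd := (h3'.comp z hb).add
      ((hasFDerivAt_apply (𝕜 := ℂ) (0 : Fin (m + 1)) z).mul h2.hasFDerivAt)
    have e : (ContinuousLinearMap.pi fun i : Fin m => ContinuousLinearMap.proj (R := ℂ)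
          (φ := fun _ : Fin (m + 1) => ℂ) i.succ) (Pi.single 0 1) = 0 := by
      ext k; simp
    have := congrArg (fun L => L (Pi.single (0 : Fin (m + 1)) (1 : ℂ))) hd.fderiv
    simp only [_root_.add_apply, ContinuousLinearMap.comp_apply, e, map_zero,
      _root_.smul_apply, ContinuousLinearMap.proj_apply, Pi.single_eq_same,
      smul_eq_mul] at this
    change derivZero _ z = _
    rw [derivZero]
    refine this.trans ?_
    simp only [Function.iterate_zero, id, Function.iterate_succ, Function.comp, derivZero, Nat.cast_zero]
    ring
  | succ k ih =>
    rw [Function.iterate_succ_apply']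
    refine (derivZero_congr ih).trans ?_
    filter_upwards [hg.iterate_derivZero k, hg.iterate_derivZero (k + 1)] with z h1 h2
    have hd := (h1.hasFDerivAt.const_mul ((k : ℂ) + 1)).add
      ((hasFDerivAt_apply (𝕜 := ℂ) (0 : Fin (m + 1)) z).mul h2.hasFDerivAt)
    have := congrArg (fun L => L (Pi.single (0 : Fin (m + 1)) (1 : ℂ))) hd.fderiv
    simp only [_root_.add_apply,
      _root_.smul_apply, ContinuousLinearMap.proj_apply, Pi.single_eq_same,
      smul_eq_mul] at this
    rw [derivZero]
    refine this.trans ?_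
    rw [Function.iterate_succ_apply' derivZero (k + 1), Function.iterate_succ_apply' derivZero k]
    push_cast
    simp only [derivZero]
    ring

theorem update_zero_eq_cons (z : Fin (m + 1) → ℂ) :
    Function.update z 0 0 = (Fin.cons 0 (base z) : Fin (m + 1) → ℂ) := by
  conv_lhs => rw [← cons_base z]
  rw [Fin.update_cons_zero]

theorem holGerm_cons_zero : HolGerm fun y : Fin m → ℂ => (Fin.cons 0 y : Fin (m + 1) → ℂ) :=
  holGerm_cons (HolGerm.const 0) differentiable_id.holGerm

theorem cons_zero_zero : (Fin.cons 0 (0 : Fin m → ℂ) : Fin (m + 1) → ℂ) = 0 := by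
  ext i
  refine Fin.cases ?_ (fun i => ?_) i <;> simp

/-- Taylor expansion in the coordinate `0`. -/
theorem exists_taylor (d : ℕ) : ∀ {f : (Fin (m + 1) → ℂ) → ℂ}, HolGerm f →
    ∃ (c : ℕ → (Fin m → ℂ) → ℂ) (u : (Fin (m + 1) → ℂ) → ℂ), (∀ i, HolGerm (c i)) ∧ HolGerm u ∧
      (f =ᶠ[𝓝 0] fun z => ∑ i ∈ Finset.range d, c i (base z) * z 0 ^ i + z 0 ^ d * u z) ∧
      (∀ k < d, (fun y => (derivZero^[k] f) (Fin.cons 0 y)) =ᶠ[𝓝 0] fun y => (k.factorial : ℂ) * c k y) ∧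
      (derivZero^[d] f) 0 = d.factorial * u 0 := by
  induction d with
  | zero =>
    intro f hf
    exact ⟨fun _ _ => 0, f, fun _ => HolGerm.const 0, hf, by simp, by simp, by simp⟩
  | succ d ih =>
    intro f hf
    obtain ⟨g, hg, e⟩ := hf.exists_div_coord 0
    obtain ⟨c, u, hc, hu, e', hk, h0⟩ := ih hg
    simp only [update_zero_eq_cons] at e
    have hc0 : HolGerm fun y : Fin m → ℂ => f (Fin.cons 0 y) :=
      hf.comp holGerm_cons_zero cons_zero_zero
    have hD := iterate_derivZero_succ_eq hc0 hg e
    refine ⟨fun i => Nat.casesOn i (fun y => f (Fin.cons 0 y)) c, u, ?_, hu, ?_, ?_, ?_⟩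
    · rintro (_ | i)
      · exact hc0
      · exact hc i
    · filter_upwards [e, e'] with z h1 h2
      rw [h1, h2, Finset.sum_range_succ']
      simp only [pow_zero, mul_one, mul_add, Finset.mul_sum, pow_succ]
      have hs : ∑ i ∈ Finset.range d, z 0 * (c i (base z) * z 0 ^ i) =
          ∑ i ∈ Finset.range d, c i (base z) * (z 0 ^ i * z 0) :=
        Finset.sum_congr rfl fun i _ => by ring
      rw [hs]
      change f (Fin.cons 0 (base z)) + (_ + _) = (_ + f (Fin.cons 0 (base z))) + _
      ring
    · rintro (_ | k) hkd
      · simp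
      · filter_upwards [hk k (by omega), (holGerm_cons_zero (m := m)).tendsto cons_zero_zero (hD k)]
          with y h1 h2
        simp only [Set.mem_preimage, Set.mem_ofPred_eq] at h2
        rw [h2, h1, Nat.factorial_succ]
        simp only [Fin.cons_zero, zero_mul, add_zero]
        push_cast
        ring
    · have := (hD d).self_of_nhds
      rw [this, Nat.factorial_succ]
      simp only [h0, Pi.zero_apply, zero_mul, add_zero]
      push_cast
      ring

theorem tendsto_slice : Tendsto (fun x : ℂ => (Fin.cons x 0 : Fin (m + 1) → ℂ)) (𝓝 0) (𝓝 0) :=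
  (holGerm_cons (x := fun x : ℂ => x) (y := fun _ => 0) differentiable_id.holGerm
    (HolGerm.const 0)).tendsto cons_zero_zero

/-- If the first derivatives vanish at the origin, the slice is divisible by a power. -/
theorem slice_eq_pow_mul {d : ℕ} (hf : HolGerm f) (h : ∀ k < d, (derivZero^[k] f) 0 = 0) :
    ∃ w : ℂ → ℂ, ContinuousAt w 0 ∧ ∀ᶠ x in 𝓝 (0 : ℂ), f (Fin.cons x 0) = x ^ d * w x := by
  obtain ⟨c, u, hc, hu, e, hk, -⟩ := exists_taylor d hf
  refine ⟨fun x => u (Fin.cons x 0), ?_, ?_⟩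
  · have := hu.continuousAt
    rw [← cons_zero_zero] at this
    refine ContinuousAt.comp this ?_
    simpa [ContinuousAt, cons_zero_zero] using tendsto_slice
  · filter_upwards [tendsto_slice e] with x hx
    simp only [Set.mem_preimage, Set.mem_ofPred_eq] at hx
    rw [hx]
    simp only [base_cons, Fin.cons_zero, add_eq_right]
    refine Finset.sum_eq_zero fun i hi => ?_
    have h1 := (hk i (Finset.mem_range.1 hi)).self_of_nhds
    simp only [cons_zero_zero, h i (Finset.mem_range.1 hi)] at h1
    have := (mul_eq_zero.1 h1.symm).resolve_left (by exact_mod_cast Nat.factorial_ne_zero i)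
    rw [this, zero_mul]

end derivZero

theorem X_pow_dvd_of_eventually {d : ℕ} : ∀ {P : Polynomial ℂ} {w : ℂ → ℂ}, ContinuousAt w 0 →
    (∀ᶠ x in 𝓝[≠] (0 : ℂ), P.eval x = x ^ d * w x) → Polynomial.X ^ d ∣ P := by
  induction d with
  | zero => intro P w _ _; simp
  | succ d ih =>
    intro P w hw h
    have h0 : P.eval 0 = 0 := by
      refine tendsto_nhds_unique (f := fun x => P.eval x) (l := 𝓝[≠] (0 : ℂ))
        (P.continuous.continuousAt.mono_left nhdsWithin_le_nhds) ?_
      have h1 : Tendsto (fun x : ℂ => x ^ (d + 1) * w x) (𝓝[≠] 0) (𝓝 0) := by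
        have : ContinuousAt (fun x : ℂ => x ^ (d + 1) * w x) 0 := by fun_prop
        simpa [ContinuousAt] using this.mono_left (nhdsWithin_le_nhds (s := {0}ᶜ))
      exact h1.congr' (h.mono fun x hx => hx.symm)
    obtain ⟨Q, rfl⟩ := Polynomial.X_dvd_iff.2 ((Polynomial.coeff_zero_eq_eval_zero P).trans h0)
    rw [pow_succ']
    refine mul_dvd_mul_left _ (ih hw ?_)
    filter_upwards [h, self_mem_nhdsWithin] with x hx hx0
    have hx0 : x ≠ 0 := hx0
    simp only [Polynomial.eval_mul, Polynomial.eval_X] at hx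
    refine mul_left_cancel₀ hx0 ?_
    rw [hx]; ring

theorem coeff_eq_zero_of_eventually {d : ℕ} {P : Polynomial ℂ} {w : ℂ → ℂ} (hw : ContinuousAt w 0)
    (h : ∀ᶠ x in 𝓝 (0 : ℂ), P.eval x = x ^ d * w x) {k : ℕ} (hk : k < d) : P.coeff k = 0 :=
  Polynomial.X_pow_dvd_iff.1
    (X_pow_dvd_of_eventually hw (h.filter_mono nhdsWithin_le_nhds)) k hk

/-- Every nonzero germ in `m` variables can be resolved. -/
def Resolvable (m : ℕ) : Prop :=
  ∀ h : (Fin m → ℂ) → ℂ, HolGerm h → ¬ h =ᶠ[𝓝 0] 0 → Res h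

/-- Every germ in `m + 1` variables of order at most `d` in the coordinate `0` can be resolved,
together with a given function of the base. -/
def ResolvableOrder (m d : ℕ) : Prop :=
  ∀ (a : (Fin m → ℂ) → ℂ) (F : (Fin (m + 1) → ℂ) → ℂ), HolGerm a → ¬ a =ᶠ[𝓝 0] 0 → HolGerm F →
    (∃ k ≤ d, (derivZero^[k] F) 0 ≠ 0) → Res fun z => a (base z) * F z

theorem ResolvableOrder.of_slice {d : ℕ} (H : ResolvableOrder m d) {a : (Fin m → ℂ) → ℂ}
    {F : (Fin (m + 1) → ℂ) → ℂ} (ha : HolGerm a) (ha0 : ¬ a =ᶠ[𝓝 0] 0) (hF : HolGerm F)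
    {P : Polynomial ℂ} {w : ℂ → ℂ} (hw : ContinuousAt w 0)
    (h : ∀ᶠ x in 𝓝 (0 : ℂ), F (Fin.cons x 0) = P.eval x + x ^ (d + 1) * w x) {k : ℕ} (hk : k ≤ d)
    (hP : P.coeff k ≠ 0) : Res fun z => a (base z) * F z := by
  refine H a F ha ha0 hF ?_
  by_contra! hc
  obtain ⟨w', hw', e⟩ := slice_eq_pow_mul (d := d + 1) hF fun k hk => hc k (by omega)
  refine hP (coeff_eq_zero_of_eventually (hw'.sub hw) (d := d + 1) ?_ (by omega))
  filter_upwards [h, e] with x h1 h2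
  rw [h2] at h1
  simp only [Pi.sub_apply]
  linear_combination -h1

theorem continuousAt_slice {u : (Fin (m + 1) → ℂ) → ℂ} (hu : HolGerm u) :
    ContinuousAt (fun x : ℂ => u (Fin.cons x 0)) 0 := by
  have := hu.continuousAt
  rw [← cons_zero_zero] at this
  refine ContinuousAt.comp this ?_
  simpa [ContinuousAt, cons_zero_zero] using tendsto_slice

theorem base_blowMap_some (j : Fin m) (c : ℂ) (z : Fin (m + 1) → ℂ) :
    base (blowMap 0 j.succ (some c) z) = base z := by
  ext k
  simp [blowMap]

theorem blowMap_some_apply_zero (j : Fin m) (c : ℂ) (z : Fin (m + 1) → ℂ) :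
    blowMap 0 j.succ (some c) z 0 = z j.succ * (z 0 + c) := by
  simp [blowMap]

theorem base_blowMap_none (j : Fin m) (z : Fin (m + 1) → ℂ) :
    base (blowMap 0 j.succ none z) = Function.update (base z) j (z j.succ * z 0) := by
  ext k
  by_cases h : k = j
  · subst h; simp [blowMap]
  · simp [blowMap, h]

theorem blowMap_none_apply_zero (j : Fin m) (z : Fin (m + 1) → ℂ) :
    blowMap 0 j.succ none z 0 = z 0 := by
  simp [blowMap, (Fin.succ_ne_zero j).symm]

theorem monomial_update_mul (A : Fin m → ℕ) (j : Fin m) (y : Fin m → ℂ) (x : ℂ) :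
    ∏ k, Function.update y j (y j * x) k ^ A k = x ^ A j * ∏ k, y k ^ A k := by
  rw [← Finset.mul_prod_erase _ _ (Finset.mem_univ j),
    ← Finset.mul_prod_erase _ (fun k => y k ^ A k) (Finset.mem_univ j), ← mul_assoc]
  congr 1
  · simp [mul_pow, mul_comm]
  · exact Finset.prod_congr rfl fun k hk => by
      rw [Function.update_of_ne (Finset.ne_of_mem_erase hk)]

theorem monomial_eq_coord_mul {A : Fin m → ℕ} {j : Fin m} (hj : A j ≠ 0) (y : Fin m → ℂ) :
    ∏ k, y k ^ A k = y j * ∏ k, y k ^ (Function.update A j (A j - 1)) k := by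
  rw [← Finset.mul_prod_erase _ _ (Finset.mem_univ j),
    ← Finset.mul_prod_erase _ (fun k => y k ^ (Function.update A j (A j - 1)) k)
      (Finset.mem_univ j), ← mul_assoc]
  congr 1
  · rw [Function.update_self, ← pow_succ', Nat.sub_add_cancel (Nat.one_le_iff_ne_zero.2 hj)]
  · exact Finset.prod_congr rfl fun k hk => by
      rw [Function.update_of_ne (Finset.ne_of_mem_erase hk)]

theorem sum_update_pred {A : Fin m → ℕ} {j : Fin m} (hj : A j ≠ 0) :
    ∑ k, Function.update A j (A j - 1) k + 1 = ∑ k, A k := by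
  rw [← Finset.add_sum_erase _ _ (Finset.mem_univ j),
    ← Finset.add_sum_erase _ A (Finset.mem_univ j), Function.update_self]
  have : ∑ k ∈ Finset.univ.erase j, Function.update A j (A j - 1) k =
      ∑ k ∈ Finset.univ.erase j, A k :=
    Finset.sum_congr rfl fun k hk => by rw [Function.update_of_ne (Finset.ne_of_mem_erase hk)]
  omega

/-- Polynomials `∑ cᵢ xⁱ + xᵉ⁺¹ u` whose coefficients are divisible by the right powers of a
monomial, one of them exactly. -/
theorem res_of_common_monomial {e : ℕ} (H : ResolvableOrder m e) :
    ∀ (s : ℕ) (γ : Fin m → ℕ), ∑ k, γ k = s →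
    ∀ (a : (Fin m → ℂ) → ℂ) (v : ℕ → (Fin m → ℂ) → ℂ) (u : (Fin (m + 1) → ℂ) → ℂ),
    Mono a → (∀ i, HolGerm (v i)) → HolGerm u → u 0 ≠ 0 → (∃ i < e, v i 0 ≠ 0) →
    Res fun z => a (base z) * (∑ i ∈ Finset.range e,
      (∏ k, base z k ^ γ k) ^ (e + 1 - i) * v i (base z) * z 0 ^ i + z 0 ^ (e + 1) * u z) := by
  intro s
  induction s with
  | zero =>
    intro γ hγ a v u ha hv hu hu0 ⟨i₀, hi₀, hvi⟩
    have hγ0 : ∀ k, γ k = 0 := fun k => (Finset.sum_eq_zero_iff.1 hγ) k (Finset.mem_univ k)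
    refine H.of_slice ha.holGerm ha.not_eventuallyEq_zero ?_
      (P := ∑ i ∈ Finset.range e, Polynomial.C (v i 0) * Polynomial.X ^ i)
      (continuousAt_slice hu) (Eventually.of_forall fun x => ?_) hi₀.le ?_
    · exact (HolGerm.sum _ fun i _ => (((holGerm_monomial γ).comp_base.pow _).mul
        (hv i).comp_base).mul ((holGerm_coord 0).pow i)).add (((holGerm_coord 0).pow _).mul hu)
    · simp [hγ0, Polynomial.eval_finsetSum]
    · simp [Polynomial.finsetSum_coeff, Polynomial.coeff_C_mul, Polynomial.coeff_X_pow, hi₀, hvi]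
  | succ s ih =>
    intro γ hγ a v u ha hv hu hu0 hex
    obtain ⟨j, hj⟩ : ∃ j, γ j ≠ 0 := by
      by_contra! hc
      simp [hc] at hγ
    have h0j : (0 : Fin (m + 1)) ≠ j.succ := (Fin.succ_ne_zero j).symm
    have hF : HolGerm fun z : Fin (m + 1) → ℂ => ∑ i ∈ Finset.range e,
        (∏ k, base z k ^ γ k) ^ (e + 1 - i) * v i (base z) * z 0 ^ i + z 0 ^ (e + 1) * u z :=
      (HolGerm.sum _ fun i _ => (((holGerm_monomial γ).comp_base.pow _).mul
        (hv i).comp_base).mul ((holGerm_coord 0).pow i)).add (((holGerm_coord 0).pow _).mul hu)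
    refine .step (ha.holGerm.comp_base.mul hF) _ (admissibleFamily_blowMap h0j) fun c => ?_
    set γ' : Fin m → ℕ := Function.update γ j (γ j - 1) with hγ'
    have hmon := fun y : Fin m → ℂ => monomial_eq_coord_mul hj y
    rcases c with _ | c
    · obtain ⟨A, w, hw, hw0, ea⟩ := ha
      set b := blowMap (0 : Fin (m + 1)) j.succ none with hb
      have hbH : HolGerm b := holGerm_blowMap _ _ _
      have hb0 : b 0 = 0 := blowMap_zero _ _ _
      have hbb : HolGerm fun z => base (b z) := holGerm_base.comp hbH hb0
      have hbb0 : base (b 0) = 0 := by rw [hb0]; rfl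
      set U : (Fin (m + 1) → ℂ) → ℂ := fun z => ∑ i ∈ Finset.range e,
        ((∏ k, base z k ^ γ k) * z 0 ^ (γ j - 1)) ^ (e + 1 - i) * v i (base (b z)) + u (b z)
        with hU
      have hUH : HolGerm U :=
        (HolGerm.sum _ fun i _ => (((holGerm_monomial γ).comp_base.mul
          ((holGerm_coord 0).pow _)).pow _).mul ((hv i).comp hbb hbb0)).add (hu.comp hbH hb0)
      have hU0 : U 0 ≠ 0 := by
        simp only [hU, hb0]
        rw [Finset.sum_eq_zero, zero_add]
        · exact hu0
        · intro i hi
          have hi := Finset.mem_range.1 hi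
          rw [hmon, base_zero, Pi.zero_apply, zero_mul, zero_mul, zero_pow (by omega), zero_mul]
      have hMa : Mono fun z => a (base (b z)) := by
        have : Mono fun z : Fin (m + 1) → ℂ =>
            w (base (b z)) * (z 0 ^ A j * ∏ k, base z k ^ A k) :=
          (Mono.of_unit (hw.comp hbb hbb0) (by rw [hbb0]; exact hw0)).mul
            (((Mono.coord 0).pow _).mul (Mono.comp_base (f := fun y => ∏ k, y k ^ A k)
              ⟨A, fun _ => 1, HolGerm.const _, one_ne_zero, by simp⟩))
        refine this.congr ?_
        filter_upwards [hbb.tendsto hbb0 ea] with z hz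
        simp only [Set.mem_preimage, Set.mem_ofPred_eq] at hz
        rw [hz, hb, base_blowMap_none, ← base_apply z j, monomial_update_mul]
      refine .mono (((Mono.coord 0).mul (hMa.mul
        (((Mono.coord 0).pow (e + 1)).mul (Mono.of_unit hUH hU0)))).congr
        (Eventually.of_forall fun z => ?_))
      have hJ : jac b z = z 0 := jac_blowMap_none h0j z
      beta_reduce
      rw [hJ]
      refine congrArg (z 0 * ·) (congrArg (a (base (b z)) * ·) ?_)
      simp only [hU, mul_add, Finset.mul_sum]
      congr 1
      · refine Finset.sum_congr rfl fun i hi => ?_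
        have hi := Finset.mem_range.1 hi
        rw [hb, blowMap_none_apply_zero, base_blowMap_none, ← base_apply z j, monomial_update_mul]
        obtain ⟨g, hg⟩ := Nat.exists_eq_succ_of_ne_zero hj
        obtain ⟨p, hp⟩ : ∃ p, e + 1 = p + i := ⟨e + 1 - i, by omega⟩
        rw [hg, hp, Nat.add_sub_cancel, Nat.succ_sub_one, Nat.succ_eq_add_one, pow_succ, pow_add]
        simp only [mul_pow]
        ring
    · set b := blowMap (0 : Fin (m + 1)) j.succ (some c) with hb
      have hbH : HolGerm b := holGerm_blowMap _ _ _
      have hb0 : b 0 = 0 := blowMap_zero _ _ _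
      have ha' : Mono fun y : Fin m → ℂ => a y * y j ^ (e + 2) := ha.mul ((Mono.coord j).pow _)
      have hcommon : ∀ z, jac b z * (a (base (b z)) * (∑ i ∈ Finset.range e,
          (∏ k, base (b z) k ^ γ k) ^ (e + 1 - i) * v i (base (b z)) * b z 0 ^ i
            + b z 0 ^ (e + 1) * u (b z))) =
          (a (base z) * base z j ^ (e + 2)) * (∑ i ∈ Finset.range e,
          (∏ k, base z k ^ γ' k) ^ (e + 1 - i) * v i (base z) * (z 0 + c) ^ i
            + (z 0 + c) ^ (e + 1) * u (b z)) := by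
        intro z
        rw [hb, jac_blowMap_some h0j, ← base_apply z j, base_blowMap_some]
        have hsum : ∑ i ∈ Finset.range e, (∏ k, base z k ^ γ k) ^ (e + 1 - i) * v i (base z) *
            (blowMap 0 j.succ (some c) z 0) ^ i = base z j ^ (e + 1) * ∑ i ∈ Finset.range e,
            (∏ k, base z k ^ γ' k) ^ (e + 1 - i) * v i (base z) * (z 0 + c) ^ i := by
          rw [Finset.mul_sum]
          refine Finset.sum_congr rfl fun i hi => ?_
          have hi := Finset.mem_range.1 hi
          obtain ⟨p, hp⟩ : ∃ p, e + 1 = p + i := ⟨e + 1 - i, by omega⟩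
          rw [blowMap_some_apply_zero, ← base_apply z j, hmon, hp, Nat.add_sub_cancel, pow_add,
            mul_pow, mul_pow]
          ring
        rw [hsum, blowMap_some_apply_zero, ← base_apply z j, mul_pow]
        ring
      simp only [hcommon]
      by_cases hc : c = 0
      · subst hc
        simp only [add_zero]
        exact ih γ' (by have := sum_update_pred hj; rw [← hγ'] at this; omega) _ v (fun z => u (b z)) ha' hv
          (hu.comp hbH hb0) (by rw [hb0]; exact hu0) hex
      · set α : ℕ → ℂ := fun i => (∏ k, (0 : Fin m → ℂ) k ^ γ' k) ^ (e + 1 - i) * v i 0 with hα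
        refine H.of_slice (k := e) ha'.holGerm ha'.not_eventuallyEq_zero ?_
          (P := ∑ i ∈ Finset.range e, Polynomial.C (α i) * (Polynomial.X + Polynomial.C c) ^ i +
            Polynomial.C (u 0) * (Polynomial.X + Polynomial.C c) ^ (e + 1))
          (w := fun _ => 0) continuousAt_const (Eventually.of_forall fun x => ?_) le_rfl ?_
        · exact (HolGerm.sum _ fun i _ => (((holGerm_monomial γ').comp_base.pow _).mul
            (hv i).comp_base).mul (((holGerm_coord 0).add (HolGerm.const c)).pow i)).add
            ((((holGerm_coord 0).add (HolGerm.const c)).pow _).mul (hu.comp hbH hb0))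
        · have hbx : b (Fin.cons x 0) = 0 := by
            rw [hb, ← cons_base (blowMap _ _ _ _), blowMap_some_apply_zero, base_blowMap_some]
            simp only [Fin.cons_succ, Pi.zero_apply, zero_mul, base_cons]
            exact cons_zero_zero
          simp only [hbx, base_cons, Fin.cons_zero, mul_zero, add_zero, Polynomial.eval_add,
            Polynomial.eval_finsetSum, Polynomial.eval_mul, Polynomial.eval_C, Polynomial.eval_pow,
            Polynomial.eval_X, hα]
          ring
        · rw [Polynomial.coeff_add, Polynomial.finsetSum_coeff, Finset.sum_eq_zero, zero_add,
            Polynomial.coeff_C_mul, Polynomial.coeff_X_add_C_pow]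
          · simp only [Nat.add_sub_cancel_left, pow_one, Nat.choose_succ_self_right]
            exact mul_ne_zero hu0 (mul_ne_zero hc (by exact_mod_cast Nat.succ_ne_zero e))
          · intro i hi
            have hi := Finset.mem_range.1 hi
            rw [Polynomial.coeff_C_mul, Polynomial.coeff_X_add_C_pow, Nat.choose_eq_zero_of_lt hi]
            simp

/-- The implicit function theorem for holomorphic germs. -/
theorem exists_implicit {G : (Fin (m + 1) → ℂ) → ℂ} (hG : HolGerm G) (hG0 : G 0 = 0)
    (hD : derivZero G 0 ≠ 0) :
    ∃ φ : (Fin m → ℂ) → ℂ, HolGerm φ ∧ φ 0 = 0 ∧ ∀ᶠ y in 𝓝 0, G (Fin.cons (φ y) y) = 0 := by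
  set Ψ : (Fin (m + 1) → ℂ) → (Fin (m + 1) → ℂ) := fun z => Fin.cons (G z) (base z) with hΨ
  have hΨH : HolGerm Ψ := holGerm_cons hG holGerm_base
  have hΨ0 : Ψ 0 = 0 := by simp only [hΨ, hG0, base_zero, cons_zero_zero]
  have hC : ContDiffAt ℂ 1 Ψ 0 :=
    contDiffAt_pi.2 fun i => HolGerm.contDiffAt (holGerm_pi.1 hΨH i)
  set L := fderiv ℂ Ψ 0 with hL
  have hLd : HasFDerivAt Ψ L 0 := hΨH.differentiableAt.hasFDerivAt
  have hL0 : ∀ v, L v 0 = fderiv ℂ G 0 v := fun v => by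
    have h1 := hasFDerivAt_pi'.1 hLd 0
    have h2 : HasFDerivAt (fun z => Ψ z 0) (fderiv ℂ G 0) 0 := hG.differentiableAt.hasFDerivAt
    exact congrArg (fun M => M v) (h1.unique h2)
  have hLs : ∀ v (i : Fin m), L v i.succ = v i.succ := fun v i => by
    have h1 := hasFDerivAt_pi'.1 hLd i.succ
    have h2 : HasFDerivAt (fun z => Ψ z i.succ) (ContinuousLinearMap.proj (R := ℂ)
      (φ := fun _ : Fin (m + 1) => ℂ) i.succ) 0 := hasFDerivAt_apply (𝕜 := ℂ) i.succ _
    exact congrArg (fun M => M v) (h1.unique h2)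
  have hinj : Function.Injective (L : (Fin (m + 1) → ℂ) →ₗ[ℂ] (Fin (m + 1) → ℂ)) := by
    refine (injective_iff_map_eq_zero _).2 fun v hv => ?_
    have hv' : L v = 0 := hv
    have hvs : ∀ i : Fin m, v i.succ = 0 := fun i =>
      (hLs v i).symm.trans (by rw [hv']; rfl)
    have hve : v = v 0 • Pi.single 0 1 := by
      ext i
      refine Fin.cases ?_ (fun i => ?_) i
      · simp
      · simp [hvs]
    have h0 := hL0 v
    rw [hv', hve, map_smul] at h0
    have : v 0 = 0 := by
      have h1 : v 0 * derivZero G 0 = 0 := by simpa [derivZero] using h0.symm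
      exact (mul_eq_zero.1 h1).resolve_right hD
    rw [hve, this, zero_smul]
  set L' : (Fin (m + 1) → ℂ) ≃L[ℂ] (Fin (m + 1) → ℂ) :=
    (LinearEquiv.ofInjectiveEndo _ hinj).toContinuousLinearEquiv with hL'
  have hLd' : HasFDerivAt Ψ (L' : (Fin (m + 1) → ℂ) →L[ℂ] (Fin (m + 1) → ℂ)) 0 := by
    convert! hLd
  set ψ := hC.localInverse hLd' one_ne_zero with hψ
  have hψC : ContDiffAt ℂ 1 ψ 0 := by
    have := hC.to_localInverse hLd' one_ne_zero
    rwa [hΨ0] at this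
  have hψ0 : ψ 0 = 0 := by
    have := hC.localInverse_apply_image hLd' one_ne_zero
    rwa [hΨ0] at this
  have hψH : HolGerm ψ := by
    filter_upwards [hψC.eventually (by simp)] with y hy using hy.differentiableAt one_ne_zero
  have hr : ∀ᶠ y in 𝓝 0, Ψ (ψ y) = y := by
    have := (hC.hasStrictFDerivAt' hLd' one_ne_zero).eventually_right_inverse
    rwa [hΨ0] at this
  have hψc : HolGerm fun y : Fin m → ℂ => ψ (Fin.cons 0 y) := hψH.comp holGerm_cons_zero cons_zero_zero
  refine ⟨fun y => ψ (Fin.cons 0 y) 0, holGerm_pi.1 hψc 0, ?_, ?_⟩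
  · beta_reduce
    rw [cons_zero_zero, hψ0]; rfl
  · filter_upwards [(holGerm_cons_zero (m := m)).tendsto cons_zero_zero hr] with y hy
    simp only [Set.mem_preimage, Set.mem_ofPred_eq] at hy
    have h1 : base (ψ (Fin.cons 0 y)) = y := congrArg base hy
    have h2 : G (ψ (Fin.cons 0 y)) = 0 := congrFun hy 0
    rw [← cons_base (ψ (Fin.cons 0 y)), h1] at h2
    exact h2

theorem comp_powMap_eventuallyEq {c : (Fin m → ℂ) → ℂ} {g : Fin m → ℕ}
    {w : (Fin m → ℂ) → ℂ} (e : c =ᶠ[𝓝 0] fun y => w y * ∏ k, y k ^ g k) {N : ℕ} (hN : N ≠ 0) :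
    (fun y => c (powMap (fun _ => N) y)) =ᶠ[𝓝 0]
      fun y => w (powMap (fun _ => N) y) * ∏ k, y k ^ (N * g k) := by
  have h0 : powMap (fun _ : Fin m => N) 0 = 0 := by ext i; simp [powMap, hN]
  filter_upwards [(holGerm_powMap (fun _ : Fin m => N)).tendsto h0 e] with y hy
  simp only [Set.mem_preimage, Set.mem_ofPred_eq] at hy
  rw [hy]
  simp only [powMap, ← pow_mul]

theorem res_of_monomial_coeffs {e : ℕ} (H : ResolvableOrder m e) {a : (Fin m → ℂ) → ℂ}
    {c : ℕ → (Fin m → ℂ) → ℂ} {u : (Fin (m + 1) → ℂ) → ℂ} (ha : Mono a)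
    (hc : ∀ i, HolGerm (c i)) (hu : HolGerm u) (hu0 : u 0 ≠ 0)
    (hcm : ∀ i < e, c i =ᶠ[𝓝 0] 0 ∨ Mono (c i)) (n : ℕ → ℕ) {N : ℕ} (hN : N ≠ 0)
    (hn : ∀ i < e, n i * (e + 1 - i) = N)
    (hcc : ∀ i < e, ∀ k < e, Mono (c i) → Mono (c k) →
      (fun y => c i y ^ n i - c k y ^ n k) =ᶠ[𝓝 0] 0 ∨
        Mono fun y => c i y ^ n i - c k y ^ n k) :
    Res fun z => a (base z) *
      (∑ i ∈ Finset.range e, c i (base z) * z 0 ^ i + z 0 ^ (e + 1) * u z) := by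
  classical
  have hF : HolGerm fun z : Fin (m + 1) → ℂ => a (base z) *
      (∑ i ∈ Finset.range e, c i (base z) * z 0 ^ i + z 0 ^ (e + 1) * u z) :=
    ha.holGerm.comp_base.mul ((HolGerm.sum _ fun i _ => (hc i).comp_base.mul
      ((holGerm_coord 0).pow i)).add (((holGerm_coord 0).pow _).mul hu))
  set I := (Finset.range e).filter fun i => Mono (c i) with hI
  have hIm : ∀ {i}, i ∈ I → i < e ∧ Mono (c i) := fun {i} hi => by simpa [hI] using hi
  have hnI : ∀ {i}, i < e → i ∉ I → c i =ᶠ[𝓝 0] 0 := fun {i} hi hiI =>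
    (hcm i hi).resolve_right fun h => hiI (by simp [hI, hi, h])
  rcases I.eq_empty_or_nonempty with hIe | hIn
  · refine .mono ((ha.comp_base.mul (((Mono.coord 0).pow (e + 1)).mul
      (Mono.of_unit hu hu0))).congr ?_)
    have : ∀ᶠ z in 𝓝 (0 : Fin (m + 1) → ℂ), ∀ i ∈ Finset.range e, c i (base z) = 0 := by
      refine (Filter.eventually_all_finset _).2 fun i hi => ?_
      exact tendsto_base (hnI (Finset.mem_range.1 hi) (by simp [hIe]))
    filter_upwards [this] with z hz
    rw [Finset.sum_eq_zero fun i hi => by rw [hz i hi, zero_mul], zero_add]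
  · have hex : ∀ i, ∃ g : Fin m → ℕ, ∃ w : (Fin m → ℂ) → ℂ, HolGerm w ∧
        (i ∈ I → w 0 ≠ 0 ∧ c i =ᶠ[𝓝 0] fun y => w y * ∏ k, y k ^ g k) := by
      intro i
      by_cases hi : i ∈ I
      · obtain ⟨g, w, h1, h2, h3⟩ := (hIm hi).2
        exact ⟨g, w, h1, fun _ => ⟨h2, h3⟩⟩
      · exact ⟨0, fun _ => 0, HolGerm.const 0, fun h => absurd h hi⟩
    choose g w hw hwI using hex
    set Γ : ℕ → Fin m → ℕ := fun i k => n i * g i k with hΓ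
    have hcomp : ∀ i ∈ I, ∀ k ∈ I, Γ i ≤ Γ k ∨ Γ k ≤ Γ i := by
      intro i hi k hk
      have e1 : (fun y => c i y ^ n i - c k y ^ n k) =ᶠ[𝓝 0]
          fun y => w i y ^ n i * ∏ l, y l ^ Γ i l - w k y ^ n k * ∏ l, y l ^ Γ k l := by
        filter_upwards [(hwI i hi).2, (hwI k hk).2] with y h1 h2
        rw [h1, h2]
        simp only [mul_pow, ← Finset.prod_pow, ← pow_mul, hΓ, mul_comm]
      refine comparable_of_sub ((hw i).pow (n i)) (pow_ne_zero _ (hwI i hi).1) ((hw k).pow (n k))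
        (pow_ne_zero _ (hwI k hk).1) ?_
      exact (hcc i (hIm hi).1 k (hIm hk).1 (hIm hi).2 (hIm hk).2).imp (fun h => e1.symm.trans h)
        fun h => h.congr e1
    obtain ⟨i₀, hi₀, hmin⟩ := Finset.exists_min_image I (fun i => ∑ k, Γ i k) hIn
    have hle : ∀ i ∈ I, Γ i₀ ≤ Γ i := by
      intro i hi
      rcases hcomp i₀ hi₀ i hi with h | h
      · exact h
      · have h1 : ∑ k, Γ i k = ∑ k, Γ i₀ k :=
          le_antisymm (Finset.sum_le_sum fun k _ => h k) (hmin i hi)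
        have h2 := (Finset.sum_eq_sum_iff_of_le fun k _ => h k).1 h1
        exact fun k => (h2 k (Finset.mem_univ k)).ge
    set p : (Fin m → ℂ) → (Fin m → ℂ) := powMap fun _ => N with hp
    have hpH : HolGerm p := holGerm_powMap _
    have hp0 : p 0 = 0 := by ext i; simp [hp, powMap, hN]
    refine .step hF _ (admissibleFamily_powMap (m := m) (N := fun _ => N) fun _ => hN).lift
      fun _ => ?_
    set v : ℕ → (Fin m → ℂ) → ℂ := fun i y => if i ∈ I then
      w i (p y) * (∏ k, y k ^ (Γ i k - Γ i₀ k)) ^ (e + 1 - i) else 0 with hv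
    have hvH : ∀ i, HolGerm (v i) := by
      intro i
      by_cases hi : i ∈ I
      · simp only [hv, hi, if_true]
        exact ((hw i).comp hpH hp0).mul ((holGerm_monomial _).pow _)
      · simp only [hv, hi, if_false]
        exact HolGerm.const 0
    have hap : Mono fun y => a (p y) := by
      obtain ⟨A, b, hb, hb0, eb⟩ := ha
      exact ⟨fun k => N * A k, fun y => b (p y), hb.comp hpH hp0, by beta_reduce; rwa [hp0],
        comp_powMap_eventuallyEq eb hN⟩
    have hl0 : liftMap p 0 = 0 := liftMap_zero hp0
    have hJM : Mono fun y => jac p y * a (p y) := (mono_jac_powMap fun _ => hN).mul hap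
    refine (res_of_common_monomial H _ (Γ i₀) rfl (fun y => jac p y * a (p y)) v
      (fun z => u (liftMap p z)) hJM hvH
      (hu.comp hpH.liftMap hl0) (by rwa [hl0]) ⟨i₀, (hIm hi₀).1, ?_⟩).congr ?_
    · simp only [hv, hi₀, if_true, Nat.sub_self, pow_zero, Finset.prod_const_one, one_pow, mul_one,
        hp0]
      exact (hwI i₀ hi₀).1
    · have hcp : ∀ᶠ z in 𝓝 (0 : Fin (m + 1) → ℂ), ∀ i ∈ Finset.range e,
          c i (p (base z)) = (∏ k, base z k ^ Γ i₀ k) ^ (e + 1 - i) * v i (base z) := by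
        refine (Filter.eventually_all_finset _).2 fun i hi => ?_
        have hie := Finset.mem_range.1 hi
        by_cases hiI : i ∈ I
        · filter_upwards [tendsto_base (comp_powMap_eventuallyEq (hwI i hiI).2 hN)] with z hz
          simp only [Set.mem_preimage, Set.mem_ofPred_eq] at hz
          simp only [hp, hv, hiI, if_true]
          rw [hz, mul_left_comm, ← mul_pow, ← Finset.prod_mul_distrib, ← Finset.prod_pow]
          congr 1
          refine Finset.prod_congr rfl fun k _ => ?_
          rw [← pow_add, Nat.add_sub_cancel' (hle i hiI k), ← pow_mul, ← hn i hie]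
          congr 1
          simp only [hΓ]
          ring
        · filter_upwards [tendsto_base ((hpH.tendsto hp0) (hnI hie hiI))] with z hz
          simp only [hv, hiI, if_false, mul_zero]
          exact hz
      filter_upwards [hcp, tendsto_base hpH] with z hz hz'
      rw [jac_liftMap hz']
      simp only [base_liftMap, liftMap_apply_zero, ← mul_assoc]
      congr 2
      refine Finset.sum_congr rfl fun i hi => ?_
      rw [hz i hi]

theorem mono_of_prod {ι : Type*} (s : Finset ι) {f : ι → (Fin m → ℂ) → ℂ}
    (hf : ∀ i ∈ s, HolGerm (f i)) (h : Mono fun y => ∏ i ∈ s, f i y) : ∀ i ∈ s, Mono (f i) := by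
  classical
  intro i hi
  have hrest : HolGerm fun y => ∏ k ∈ s.erase i, f k y :=
    HolGerm.prod _ fun k hk => hf k (Finset.mem_of_mem_erase hk)
  refine (mono_of_mul (hf i hi) hrest (h.congr (Eventually.of_forall fun y => ?_))).1
  exact (Finset.mul_prod_erase s (fun i => f i y) hi).symm

theorem Resolvable.res_mul (M : Resolvable m) {e : ℕ} (H : ResolvableOrder m e)
    {a : (Fin m → ℂ) → ℂ} {c : ℕ → (Fin m → ℂ) → ℂ} {u : (Fin (m + 1) → ℂ) → ℂ} (ha : HolGerm a)
    (ha0 : ¬ a =ᶠ[𝓝 0] 0) (hc : ∀ i, HolGerm (c i)) (hu : HolGerm u) (hu0 : u 0 ≠ 0) :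
    Res fun z => a (base z) *
      (∑ i ∈ Finset.range e, c i (base z) * z 0 ^ i + z 0 ^ (e + 1) * u z) := by
  classical
  set n : ℕ → ℕ := fun i => (e + 1).factorial / (e + 1 - i) with hn
  have hnN : ∀ i < e, n i * (e + 1 - i) = (e + 1).factorial := fun i hi =>
    Nat.div_mul_cancel (Nat.dvd_factorial (by omega) (by omega))
  set I := (Finset.range e).filter fun i => ¬ c i =ᶠ[𝓝 0] 0 with hI
  set dif : ℕ × ℕ → (Fin m → ℂ) → ℂ := fun p y => c p.1 y ^ n p.1 - c p.2 y ^ n p.2 with hdif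
  have hdifH : ∀ p, HolGerm (dif p) := fun p => ((hc _).pow _).sub ((hc _).pow _)
  set S := (I ×ˢ I).filter fun p => ¬ dif p =ᶠ[𝓝 0] 0 with hS
  have hP1 : HolGerm fun y => ∏ i ∈ I, c i y := HolGerm.prod _ fun i _ => hc i
  have hP2 : HolGerm fun y => ∏ p ∈ S, dif p y := HolGerm.prod _ fun p _ => hdifH p
  set δ : (Fin m → ℂ) → ℂ := fun y => a y * ((∏ i ∈ I, c i y) * ∏ p ∈ S, dif p y) with hδ
  have hδ0 : ¬ δ =ᶠ[𝓝 0] 0 := by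
    intro h
    rcases ha.eventuallyEq_zero_or (hP1.mul hP2) h with h | h
    · exact ha0 h
    · rcases hP1.eventuallyEq_zero_or hP2 h with h | h
      · obtain ⟨i, hi, h⟩ := HolGerm.prod_eventuallyEq_zero _ (fun i _ => hc i) h
        exact (Finset.mem_filter.1 hi).2 h
      · obtain ⟨p, hp, h⟩ := HolGerm.prod_eventuallyEq_zero _ (fun p _ => hdifH p) h
        exact (Finset.mem_filter.1 hp).2 h
  have hF : HolGerm fun z : Fin (m + 1) → ℂ => a (base z) *
      (∑ i ∈ Finset.range e, c i (base z) * z 0 ^ i + z 0 ^ (e + 1) * u z) :=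
    ha.comp_base.mul ((HolGerm.sum _ fun i _ => (hc i).comp_base.mul
      ((holGerm_coord 0).pow i)).add (((holGerm_coord 0).pow _).mul hu))
  refine Res.lift (M δ (ha.mul (hP1.mul hP2)) hδ0) hF fun ρ b hρ hρ0 hMδ hb => ?_
  obtain ⟨hMa, hMr⟩ := mono_of_mul (ha.comp hρ hρ0) ((hP1.mul hP2).comp hρ hρ0) hMδ
  obtain ⟨hM1, hM2⟩ := mono_of_mul (hP1.comp hρ hρ0) (hP2.comp hρ hρ0) hMr
  have hM1 := mono_of_prod I (fun i _ => (hc i).comp hρ hρ0) hM1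
  have hM2 := mono_of_prod S (fun p _ => (hdifH p).comp hρ hρ0) hM2
  have hl0 : liftMap ρ 0 = 0 := liftMap_zero hρ0
  have hcI : ∀ i < e, i ∉ I → (fun y => c i (ρ y)) =ᶠ[𝓝 0] 0 := by
    intro i hi hiI
    have : c i =ᶠ[𝓝 0] 0 := by
      by_contra h
      exact hiI (by simp [hI, hi, h])
    exact hρ.tendsto hρ0 this
  refine (res_of_monomial_coeffs H (a := fun y => b y * a (ρ y)) (c := fun i y => c i (ρ y))
    (u := fun z => u (liftMap ρ z)) (hb.mul hMa) (fun i => (hc i).comp hρ hρ0)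
    (hu.comp hρ.liftMap hl0) (by rwa [hl0]) ?_ n (Nat.factorial_ne_zero (e + 1)) hnN ?_).congr
    (Eventually.of_forall fun z => ?_)
  · intro i hi
    by_cases hiI : i ∈ I
    · exact Or.inr (hM1 i hiI)
    · exact Or.inl (hcI i hi hiI)
  · intro i hi k hk hMi hMk
    have hiI : i ∈ I := by
      by_contra h
      exact hMi.not_eventuallyEq_zero (hcI i hi h)
    have hkI : k ∈ I := by
      by_contra h
      exact hMk.not_eventuallyEq_zero (hcI k hk h)
    by_cases h : dif (i, k) =ᶠ[𝓝 0] 0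
    · exact Or.inl (hρ.tendsto hρ0 h)
    · exact Or.inr (hM2 (i, k) (by simp [hS, hiI, hkI, h]))
  · simp only [base_liftMap, liftMap_apply_zero, mul_assoc]

/-- The shear translating the coordinate `0` by a function of the other coordinates. -/
def shear (φ : (Fin m → ℂ) → ℂ) (z : Fin (m + 1) → ℂ) : Fin (m + 1) → ℂ :=
  Fin.cons (z 0 + φ (base z)) (base z)

section shear
variable {φ : (Fin m → ℂ) → ℂ}

@[simp] theorem base_shear (z : Fin (m + 1) → ℂ) : base (shear φ z) = base z := rfl

theorem HolGerm.shear (hφ : HolGerm φ) : HolGerm (shear φ) :=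
  holGerm_cons ((holGerm_coord 0).add hφ.comp_base) holGerm_base

theorem shear_zero (h0 : φ 0 = 0) : shear φ 0 = 0 := by
  simp only [shear, base_zero, h0, Pi.zero_apply, add_zero, cons_zero_zero]

theorem shear_neg_shear (z : Fin (m + 1) → ℂ) : shear (fun y => -φ y) (shear φ z) = z := by
  conv_rhs => rw [← cons_base z]
  simp [shear]

theorem shear_shear_neg (z : Fin (m + 1) → ℂ) : shear φ (shear (fun y => -φ y) z) = z := by
  simpa using shear_neg_shear (φ := fun y => -φ y) z

theorem shear_add_smul (z : Fin (m + 1) → ℂ) (t : ℂ) :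
    shear φ (z + t • Pi.single 0 1) = shear φ z + t • Pi.single 0 1 := by
  have hb : base (z + t • Pi.single 0 1) = base z := by ext i; simp
  ext i
  refine Fin.cases ?_ (fun i => ?_) i
  · simp [shear, hb]; ring
  · simp [shear]

theorem derivZero_shear {f : (Fin (m + 1) → ℂ) → ℂ} (hf : HolGerm f) (hφ : HolGerm φ)
    (h0 : φ 0 = 0) :
    derivZero (fun z => f (shear φ z)) =ᶠ[𝓝 0] fun z => derivZero f (shear φ z) := by
  filter_upwards [hf.comp hφ.shear (shear_zero h0), hφ.shear.tendsto (shear_zero h0) hf]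
    with z h1 h2
  simp only [derivZero]
  rw [← h1.lineDeriv_eq_fderiv, ← DifferentiableAt.lineDeriv_eq_fderiv h2]
  simp only [lineDeriv, shear_add_smul]

theorem iterate_derivZero_shear {f : (Fin (m + 1) → ℂ) → ℂ} (hf : HolGerm f) (hφ : HolGerm φ)
    (h0 : φ 0 = 0) (k : ℕ) :
    derivZero^[k] (fun z => f (shear φ z)) =ᶠ[𝓝 0] fun z => (derivZero^[k] f) (shear φ z) := by
  induction k with
  | zero => rfl
  | succ k ih =>
    simp only [Function.iterate_succ_apply']
    exact (derivZero_congr ih).trans (derivZero_shear (hf.iterate_derivZero k) hφ h0)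

end shear

theorem Resolvable.resolvableOrder (M : Resolvable m) : ∀ d, ResolvableOrder m d := by
  intro d
  induction d with
  | zero =>
    intro a F ha ha0 hF hk
    obtain ⟨k, hk, hFk⟩ := hk
    obtain rfl : k = 0 := by omega
    refine Res.lift (M a ha ha0) (ha.comp_base.mul hF) fun ρ b hρ hρ0 hMa hb => .mono ?_
    refine hb.comp_base.mul (hMa.comp_base.mul (Mono.of_unit
      (hF.comp hρ.liftMap (liftMap_zero hρ0)) ?_))
    rwa [liftMap_zero hρ0]
  | succ e ih =>
    intro a F ha ha0 hF hk
    by_cases hk' : ∃ k ≤ e, (derivZero^[k] F) 0 ≠ 0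
    · exact ih a F ha ha0 hF hk'
    push Not at hk'
    have hG0 : (derivZero^[e] F) 0 = 0 := hk' e le_rfl
    have hD : (derivZero^[e + 1] F) 0 ≠ 0 := by
      obtain ⟨k, hk, hFk⟩ := hk
      rcases Nat.le_succ_iff.1 hk with h | h
      · exact absurd (hk' k h) hFk
      · rwa [h] at hFk
    obtain ⟨φ, hφ, hφ0, hGφ⟩ := exists_implicit (hF.iterate_derivZero e) hG0
      (by rwa [Function.iterate_succ_apply'] at hD)
    have hnφ : HolGerm fun y => -φ y := by
      filter_upwards [hφ] with y hy using hy.neg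
    have hF' : HolGerm fun z => F (shear φ z) := hF.comp hφ.shear (shear_zero hφ0)
    refine Res.of_inverse hφ.shear hnφ.shear (shear_zero hφ0) (shear_zero (by simp [hφ0]))
      (Eventually.of_forall shear_neg_shear) (Eventually.of_forall shear_shear_neg)
      (ha.comp_base.mul hF) ?_
    obtain ⟨c, u, hc, hu, hT, hck, hu0⟩ := exists_taylor (e + 1) hF'
    have hue : u 0 ≠ 0 := by
      intro h
      rw [h, mul_zero, (iterate_derivZero_shear hF hφ hφ0 (e + 1)).self_of_nhds] at hu0
      beta_reduce at hu0
      rw [shear_zero hφ0] at hu0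
      exact hD hu0
    have hce : c e =ᶠ[𝓝 0] 0 := by
      filter_upwards [hck e (by omega), hGφ, (holGerm_cons_zero (m := m)).tendsto cons_zero_zero
        (iterate_derivZero_shear hF hφ hφ0 e)] with y h1 h2 h3
      have h3 : (derivZero^[e] fun z => F (shear φ z)) (Fin.cons 0 y) =
        (derivZero^[e] F) (shear φ (Fin.cons 0 y)) := h3
      have h4 : shear φ (Fin.cons 0 y) = Fin.cons (φ y) y := by
        have hb : base (Fin.cons 0 y : Fin (m + 1) → ℂ) = y := rfl
        simp [shear, hb]
      rw [h3, h4, h2] at h1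
      exact (mul_eq_zero.1 h1.symm).resolve_left (by exact_mod_cast e.factorial_ne_zero)
    refine (M.res_mul ih ha ha0 hc hu hue).congr ?_
    filter_upwards [hT, tendsto_base hce] with z h1 h2
    have h2 : c e (base z) = 0 := h2
    rw [base_shear, h1, Finset.sum_range_succ, h2, zero_mul, add_zero]

theorem resolvable_zero : Resolvable 0 := by
  intro h hh h0
  refine .mono (Mono.of_unit hh fun h1 => h0 ?_)
  exact Eventually.of_forall fun y => by rw [Subsingleton.elim y 0, h1]; rfl

/-- If all the iterated derivatives of `f` in the coordinate `0` vanish at the origin then `f`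
vanishes on the coordinate axis. -/
theorem eventually_axis_eq_zero {f : (Fin (m + 1) → ℂ) → ℂ} (hf : HolGerm f)
    (h : ∀ k, (derivZero^[k] f) 0 = 0) : ∀ᶠ x : ℂ in 𝓝 0, f (Fin.cons x 0) = 0 := by
  have hs : HolGerm fun x : ℂ => f (Fin.cons x 0) :=
    hf.comp (holGerm_cons differentiable_id.holGerm (HolGerm.const 0)) cons_zero_zero
  have ha : AnalyticAt ℂ (fun x : ℂ => f (Fin.cons x 0)) 0 := by
    obtain ⟨s, hs1, hs2⟩ := (eventually_iff_exists_mem.1 hs)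
    exact (DifferentiableOn.analyticAt (fun x hx => (hs2 x hx).differentiableWithinAt) hs1)
  by_contra hne
  obtain ⟨n, g, hg, hg0, e⟩ := ha.exists_eventuallyEq_pow_smul_nonzero_iff.2 hne
  obtain ⟨w, hw, e'⟩ := slice_eq_pow_mul hf (d := n + 1) fun k _ => h k
  have h1 : Tendsto g (𝓝[≠] 0) (𝓝 (g 0)) := hg.continuousAt.tendsto.mono_left nhdsWithin_le_nhds
  have h2 : Tendsto (fun x => x * w x) (𝓝[≠] 0) (𝓝 0) := by
    have : Tendsto (fun x => x * w x) (𝓝 0) (𝓝 (0 * w 0)) := tendsto_id.mul hw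
    rw [zero_mul] at this
    exact this.mono_left nhdsWithin_le_nhds
  refine hg0 (tendsto_nhds_unique (h1.congr' ?_) h2)
  filter_upwards [e.filter_mono nhdsWithin_le_nhds, e'.filter_mono nhdsWithin_le_nhds,
    self_mem_nhdsWithin] with x h1 h2 hx
  have hx : x ≠ 0 := hx
  rw [h2, sub_zero, smul_eq_mul, pow_succ, mul_assoc] at h1
  exact (mul_left_cancel₀ (pow_ne_zero n hx) h1).symm

theorem Resolvable.succ (M : Resolvable m) : Resolvable (m + 1) := by
  intro h hh hne
  by_cases h0 : h 0 = 0
  swap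
  · exact .mono (Mono.of_unit hh h0)
  obtain ⟨r, hr, hb⟩ := Metric.eventually_nhds_iff_ball.1 hh
  obtain ⟨q, hq, hhq⟩ : ∃ q ∈ Metric.ball (0 : Fin (m + 1) → ℂ) r, h q ≠ 0 := by
    by_contra! hc
    exact hne (by filter_upwards [Metric.ball_mem_nhds _ hr] using hc)
  have hq0 : q ≠ 0 := fun hq0 => hhq (by rw [hq0, h0])
  have he0 : (Pi.single 0 1 : Fin (m + 1) → ℂ) ≠ 0 := by simp
  obtain ⟨A, hA⟩ := SeparatingDual.exists_continuousLinearEquiv_apply_eq (R := ℂ) he0 hq0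
  have hAH : HolGerm A := A.differentiable.holGerm
  have hA' : HolGerm fun y => h (A y) := hh.comp hAH (map_zero A)
  refine Res.of_inverse (π := A) (ψ := A.symm) hAH A.symm.differentiable.holGerm
    (map_zero A) (map_zero A.symm)
    (Eventually.of_forall A.symm_apply_apply) (Eventually.of_forall A.apply_symm_apply) hh ?_
  obtain ⟨k, hk⟩ : ∃ k, (derivZero^[k] fun y => h (A y)) 0 ≠ 0 := by
    by_contra! hc
    have hz := eventually_axis_eq_zero hA' hc
    have hx : ∀ x : ℂ, A (Fin.cons x 0) = x • q := fun x => by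
      rw [← hA, ← map_smul]
      congr 1
      ext i
      refine Fin.cases ?_ (fun i => ?_) i <;> simp
    simp only [hx] at hz
    have hqn : ‖q‖ < r := by simpa using hq
    have hqp : 0 < ‖q‖ := norm_pos_iff.2 hq0
    have := eqOn_zero_ball_of_eventuallyEq (f := fun x : ℂ => h (x • q)) (p := 0) (r := r / ‖q‖)
      (fun y hy => ?_) (Metric.mem_ball_self (by positivity)) hz 1 (by
        simpa [lt_div_iff₀ hqp] using hqn)
    · exact hhq (by simpa using this)
    · have hyb : y • q ∈ Metric.ball (0 : Fin (m + 1) → ℂ) r := by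
        rw [mem_ball_zero_iff, norm_smul]
        rw [mem_ball_zero_iff, lt_div_iff₀ hqp] at hy
        exact hy
      exact DifferentiableAt.comp y (hb _ hyb) (by fun_prop)
  refine (M.resolvableOrder k (fun _ => 1) _ (HolGerm.const 1)
    (fun h1 => one_ne_zero h1.self_of_nhds) hA' ⟨k, le_rfl, hk⟩).congr ?_
  exact Eventually.of_forall fun z => one_mul _

theorem resolvable : ∀ m, Resolvable m
  | 0 => resolvable_zero
  | m + 1 => (resolvable m).succ

theorem integrableOn_norm_rpow_iff {s r : ℝ} (hr : 0 < r) :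
    IntegrableOn (fun z : ℂ => ‖z‖ ^ s) (Metric.ball 0 r) ↔ -2 < s := by
  rw [integrableOn_fun_norm_addHaar volume (f := fun x : ℝ => x ^ s), Complex.finrank_real_complex]
  have : Set.EqOn (fun y : ℝ => y ^ (2 - 1) • y ^ s) (fun y => y ^ (s + 1)) (Set.Ioo 0 r) := by
    intro y hy
    simp only [smul_eq_mul, Nat.add_one_sub_one, pow_one]
    rw [Real.rpow_add_one hy.1.ne', mul_comm]
  rw [integrableOn_congr_fun this measurableSet_Ioo, intervalIntegral.integrableOn_Ioo_rpow_iff hr]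
  constructor <;> intro h <;> linarith

theorem restrict_ball_pi {r : ℝ} (hr : 0 < r) :
    (volume : Measure (Fin m → ℂ)).restrict (Metric.ball 0 r) =
      Measure.pi fun _ => (volume : Measure ℂ).restrict (Metric.ball 0 r) := by
  rw [ball_pi _ hr]
  exact Measure.restrict_pi_pi (fun _ => (volume : Measure ℂ)) _

theorem ae_forall_ne_zero {μ : Fin m → Measure ℂ} [∀ i, SigmaFinite (μ i)] [∀ i, NullSingletonClass (μ i)] :
    ∀ᵐ y ∂(Measure.pi μ), ∀ i, y i ≠ 0 :=
  eventually_all.2 fun i =>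
    (Measure.tendsto_eval_ae_ae (μ := μ) (i := i)) (compl_mem_ae_iff.2 (measure_singleton _))

theorem integrableOn_prod_norm_rpow_iff {s : Fin m → ℝ} {r : ℝ} (hr : 0 < r) :
    IntegrableOn (fun y : Fin m → ℂ => ∏ i, ‖y i‖ ^ s i) (Metric.ball 0 r) ↔ ∀ i, -2 < s i := by
  refine ⟨fun h i => ?_, fun h => ?_⟩
  · obtain ⟨k, rfl⟩ : ∃ k, m = k + 1 := ⟨m - 1, by have := i.2; omega⟩
    rw [IntegrableOn, restrict_ball_pi hr] at h
    have hmp := measurePreserving_piFinSuccAbove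
      (fun _ : Fin (k + 1) => (volume : Measure ℂ).restrict (Metric.ball 0 r)) i
    rw [← hmp.symm.integrable_comp_emb (MeasurableEquiv.measurableEmbedding _)] at h
    have hae := h.prod_left_ae
    have hne : (ae (Measure.pi fun _ : Fin k =>
        (volume : Measure ℂ).restrict (Metric.ball 0 r))).NeBot := by
      rw [← restrict_ball_pi hr, ae_neBot, Ne, Measure.restrict_eq_zero]
      exact (Metric.measure_ball_pos volume _ hr).ne'
    obtain ⟨y, hy, hy0⟩ := (hae.and ae_forall_ne_zero).exists
    rw [← integrableOn_norm_rpow_iff hr]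
    have hP : (∏ j : Fin k, ‖y j‖ ^ s (i.succAbove j)) ≠ 0 :=
      Finset.prod_ne_zero_iff.2 fun j _ =>
        (Real.rpow_pos_of_pos (norm_pos_iff.2 (hy0 j)) _).ne'
    refine (hy.mul_const (∏ j : Fin k, ‖y j‖ ^ s (i.succAbove j))⁻¹).congr
      (Eventually.of_forall fun x => ?_)
    simp only [Function.comp_apply, MeasurableEquiv.piFinSuccAbove_symm_apply,
      Fin.insertNthEquiv, Equiv.coe_fn_mk]
    rw [Fin.prod_univ_succAbove _ i]
    simp only [Fin.insertNth_apply_same, Fin.insertNth_apply_succAbove]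
    rw [mul_assoc, mul_inv_cancel₀ hP, mul_one]
  · rw [IntegrableOn, restrict_ball_pi hr]
    exact Integrable.fintype_prod (f := fun i (z : ℂ) => ‖z‖ ^ s i)
      fun i => (integrableOn_norm_rpow_iff hr).2 (h i)

/-- The density whose local integrability defines multiplier ideals. -/
def density (f g : (Fin m → ℂ) → ℂ) (α : ℝ) (y : Fin m → ℂ) : ℝ := ‖g y‖ ^ 2 / ‖f y‖ ^ (2 * α)

/-- Local integrability of `density f g α` at the origin holds exactly for the `α` below finitely
many positive rational numbers. -/
def HasThresholds (f g : (Fin m → ℂ) → ℂ) : Prop :=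
  ∃ B : Finset ℚ, (∀ b ∈ B, 0 < b) ∧ (f 0 = 0 → B.Nonempty) ∧
    (∃ W ∈ 𝓝 (0 : Fin m → ℂ), ∀ α : ℝ, (∀ b ∈ B, α < b) → IntegrableOn (density f g α) W) ∧
    ∀ α : ℝ, (∃ V ∈ 𝓝 (0 : Fin m → ℂ), IntegrableOn (density f g α) V) → ∀ b ∈ B, α < b

theorem hasThresholds_of_mono {f g : (Fin m → ℂ) → ℂ} (hf : Mono f) (hg : Mono g) :
    HasThresholds f g := by
  classical
  obtain ⟨a, u, hu, hu0, ef⟩ := hf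
  obtain ⟨b, v, hv, hv0, eg⟩ := hg
  have hev : ∀ᶠ y in 𝓝 (0 : Fin m → ℂ), (DifferentiableAt ℂ u y ∧ DifferentiableAt ℂ v y) ∧
      (u y ≠ 0 ∧ v y ≠ 0) ∧ f y = u y * ∏ i, y i ^ a i ∧ g y = v y * ∏ i, y i ^ b i :=
    (hu.and hv).and (((hu.continuousAt.eventually_ne hu0).and
      (hv.continuousAt.eventually_ne hv0)).and (ef.and eg))
  obtain ⟨R, hR, hball⟩ := Metric.nhds_basis_closedBall.mem_iff.1 hev
  set q : ℝ → (Fin m → ℂ) → ℝ := fun α y => ‖v y‖ ^ 2 / ‖u y‖ ^ (2 * α) with hq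
  have hqc : ∀ α, ContinuousOn (q α) (Metric.closedBall 0 R) := fun α y hy =>
    ((((hball hy).1.2.continuousAt.norm.pow 2).div
      ((hball hy).1.1.continuousAt.norm.rpow_const (Or.inl (norm_ne_zero_iff.2 (hball hy).2.1.1)))
      (Real.rpow_pos_of_pos (norm_pos_iff.2 (hball hy).2.1.1) _).ne')).continuousWithinAt
  have hq0 : ∀ α, ∀ y ∈ Metric.closedBall (0 : Fin m → ℂ) R, q α y ≠ 0 := fun α y hy =>
    div_ne_zero (pow_ne_zero _ (norm_ne_zero_iff.2 (hball hy).2.1.2))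
      (Real.rpow_pos_of_pos (norm_pos_iff.2 (hball hy).2.1.1) _).ne'
  set s : ℝ → Fin m → ℝ := fun α i => 2 * b i - 2 * α * a i with hs
  have hae : ∀ᵐ y : Fin m → ℂ, ∀ i, y i ≠ 0 :=
    ae_forall_ne_zero (μ := fun _ => (volume : Measure ℂ))
  have hfac : ∀ α, ∀ y ∈ Metric.closedBall (0 : Fin m → ℂ) R, (∀ i, y i ≠ 0) →
      density f g α y = q α y * ∏ i, ‖y i‖ ^ s α i := by
    intro α y hy hy0
    have hpos : ∀ i, 0 < ‖y i‖ := fun i => norm_pos_iff.2 (hy0 i)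
    simp only [density, (hball hy).2.2.1, (hball hy).2.2.2, norm_mul, norm_prod, norm_pow, hq, hs]
    rw [Real.mul_rpow (norm_nonneg _) (Finset.prod_nonneg fun i _ => by positivity), mul_pow,
      mul_div_mul_comm, ← Real.finsetProd_rpow _ _ (fun i _ => by positivity), ← Finset.prod_pow,
      ← Finset.prod_div_distrib]
    congr 1
    refine Finset.prod_congr rfl fun i _ => ?_
    rw [Real.rpow_sub (hpos i), ← Real.rpow_natCast, ← Real.rpow_natCast, ← Real.rpow_natCast,
      ← Real.rpow_mul (hpos i).le, ← Real.rpow_mul (hpos i).le]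
    push_cast
    congr 2 <;> ring
  have hiff : ∀ α r, 0 < r → r ≤ R →
      (IntegrableOn (density f g α) (Metric.ball 0 r) ↔ ∀ i, -2 < s α i) := by
    intro α r hr hrR
    have hsub : Metric.ball (0 : Fin m → ℂ) r ⊆ Metric.closedBall 0 R :=
      (Metric.ball_subset_ball hrR).trans Metric.ball_subset_closedBall
    have hK := isCompact_closedBall (0 : Fin m → ℂ) R
    have hres : ∀ᵐ y ∂(volume.restrict (Metric.ball (0 : Fin m → ℂ) r)),
        y ∈ Metric.ball (0 : Fin m → ℂ) r ∧ ∀ i, y i ≠ 0 :=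
      (ae_restrict_mem Metric.isOpen_ball.measurableSet).and (ae_restrict_of_ae hae)
    rw [← integrableOn_prod_norm_rpow_iff hr]
    constructor
    · intro h
      refine (h.continuousOn_mul_of_subset ((hqc α).inv₀ (hq0 α))
        hK Metric.isOpen_ball.measurableSet hsub).congr ?_
      filter_upwards [hres] with y hy
      rw [hfac α y (hsub hy.1) hy.2, Pi.inv_apply, inv_mul_cancel_left₀ (hq0 α y (hsub hy.1))]
    · intro h
      refine (h.continuousOn_mul_of_subset (hqc α)
        hK Metric.isOpen_ball.measurableSet hsub).congr ?_
      filter_upwards [hres] with y hy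
      rw [hfac α y (hsub hy.1) hy.2]
  set B : Finset ℚ := (Finset.univ.filter fun i => a i ≠ 0).image fun i => ((b i : ℚ) + 1) / a i
    with hB
  have hBs : ∀ α : ℝ, (∀ c ∈ B, α < c) ↔ ∀ i, -2 < s α i := by
    intro α
    simp only [hB, Finset.mem_image, Finset.mem_filter, Finset.mem_univ, true_and,
      forall_exists_index, and_imp, forall_apply_eq_imp_iff₂]
    refine forall_congr' fun i => ?_
    by_cases hi : a i = 0
    · simp only [hi, ne_eq, not_true, false_imp_iff, true_iff, hs, Nat.cast_zero, mul_zero, sub_zero]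
      have : (0 : ℝ) ≤ b i := Nat.cast_nonneg _
      linarith
    · have hp : (0 : ℝ) < a i := by exact_mod_cast Nat.pos_of_ne_zero hi
      simp only [hi, ne_eq, not_false_iff, true_imp_iff, hs]
      push_cast
      rw [lt_div_iff₀ hp]
      constructor <;> intro h <;> linarith
  refine ⟨B, ?_, ?_, ⟨Metric.ball 0 R, Metric.ball_mem_nhds _ hR, fun α h =>
    (hiff α R hR le_rfl).2 ((hBs α).1 h)⟩, ?_⟩
  · intro c hc
    obtain ⟨i, hi, rfl⟩ := Finset.mem_image.1 hc
    have : 0 < a i := Nat.pos_of_ne_zero (Finset.mem_filter.1 hi).2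
    positivity
  · intro h0
    rw [ef.self_of_nhds] at h0
    obtain ⟨i, -, hi⟩ := Finset.prod_eq_zero_iff.1 ((mul_eq_zero.1 h0).resolve_left hu0)
    refine ⟨_, Finset.mem_image_of_mem _ (Finset.mem_filter.2 ⟨Finset.mem_univ i, fun h => ?_⟩)⟩
    simp [h] at hi
  · rintro α ⟨V, hV, hInt⟩
    obtain ⟨r, hr, hrV⟩ := Metric.mem_nhds_iff.1 hV
    refine (hBs α).2 ((hiff α (min r R) (lt_min hr hR) (min_le_right _ _)).1 (hInt.mono_set ?_))
    exact (Metric.ball_subset_ball (min_le_left _ _)).trans hrV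

theorem abs_det_restrictScalars (L : (Fin m → ℂ) →L[ℂ] (Fin m → ℂ)) :
    |(L.restrictScalars ℝ).det| = ‖L.det‖ ^ 2 := by
  have h : (L.restrictScalars ℝ).det = Algebra.norm ℝ L.det :=
    LinearMap.det_restrictScalars (R := ℝ) (f := (L : (Fin m → ℂ) →ₗ[ℂ] (Fin m → ℂ)))
  rw [h, Algebra.norm_complex_apply, Complex.normSq_eq_norm_sq, abs_of_nonneg (by positivity)]

theorem density_pullback (f g : (Fin m → ℂ) → ℂ) (π : (Fin m → ℂ) → (Fin m → ℂ)) (α : ℝ)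
    (y : Fin m → ℂ) :
    density (fun y => f (π y)) (fun y => jac π y * g (π y)) α y =
      |((fderiv ℂ π y).restrictScalars ℝ).det| • density f g α (π y) := by
  rw [abs_det_restrictScalars, smul_eq_mul]
  simp only [density, jac, norm_mul, mul_pow, mul_div_assoc]

theorem measurableSet_jac_ne_zero (π : (Fin m → ℂ) → (Fin m → ℂ)) :
    MeasurableSet {y | jac π y ≠ 0} :=
  (ContinuousLinearMap.continuous_det.measurable.comp (measurable_fderiv ℂ π))
    (measurableSet_singleton (0 : ℂ)).compl

theorem Admissible.integrableOn_image_iff {π : (Fin m → ℂ) → (Fin m → ℂ)} (hπ : Admissible π) :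
    ∃ U ∈ 𝓝 (0 : Fin m → ℂ), ∀ W ⊆ U, MeasurableSet W → ∀ (f g : (Fin m → ℂ) → ℂ) (α : ℝ),
      IntegrableOn (density f g α) (π '' W) ↔
        IntegrableOn (density (fun y => f (π y)) (fun y => jac π y * g (π y)) α) W := by
  obtain ⟨𝒜, hfin, hA, P, hP, hcov⟩ := hπ.pieces
  refine ⟨_, inter_mem hP hπ.hol, fun W hWU hW f g α => ?_⟩
  set N := {y | jac π y ≠ 0} with hN
  have hNm : MeasurableSet N := measurableSet_jac_ne_zero π
  have hd : ∀ y ∈ W, HasFDerivAt π ((fderiv ℂ π y).restrictScalars ℝ) y := fun y hy =>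
    (hWU hy).2.hasFDerivAt.restrictScalars ℝ
  have hWN : W = (W \ N) ∪ ⋃ A ∈ 𝒜, (A ∩ N) ∩ W := by
    ext y
    simp only [Set.mem_union, Set.mem_sdiff, Set.mem_iUnion, Set.mem_inter_iff, exists_prop]
    constructor
    · intro hy
      by_cases hyN : y ∈ N
      · obtain ⟨A, hA, hyA⟩ := hcov ⟨(hWU hy).1, hyN⟩
        exact Or.inr ⟨A, hA, ⟨hyA, hyN⟩, hy⟩
      · exact Or.inl ⟨hy, hyN⟩
    · rintro (h | ⟨A, -, -, h⟩)
      exacts [h.1, h]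
  have hnull : volume (π '' (W \ N)) = 0 := by
    refine addHaar_image_eq_zero_of_det_fderivWithin_eq_zero volume
      (fun y hy => (hd y hy.1).hasFDerivWithinAt) fun y hy => ?_
    have h0 : (fderiv ℂ π y).det = 0 := not_not.1 hy.2
    rw [← abs_eq_zero, abs_det_restrictScalars, h0, norm_zero, zero_pow two_ne_zero]
  have hpiece : ∀ A ∈ 𝒜, (IntegrableOn (density f g α) (π '' ((A ∩ N) ∩ W)) ↔
      IntegrableOn (density (fun y => f (π y)) (fun y => jac π y * g (π y)) α) ((A ∩ N) ∩ W)) := by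
    intro A hA'
    rw [integrableOn_image_iff_integrableOn_abs_det_fderiv_smul volume
      (((hA A hA').1.inter hNm).inter hW) (fun y hy => (hd y hy.2).hasFDerivWithinAt)
      ((hA A hA').2.mono Set.inter_subset_left)]
    exact integrableOn_congr_fun (fun y _ => (density_pullback f g π α y).symm)
      (((hA A hA').1.inter hNm).inter hW)
  have hzero : IntegrableOn (density (fun y => f (π y)) (fun y => jac π y * g (π y)) α) (W \ N) := by
    refine (integrableOn_zero (ε' := ℝ)).congr_fun (fun y hy => ?_) (hW.diff hNm)
    have h0 : jac π y = 0 := not_not.1 hy.2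
    simp [density, h0]
  have hunion : IntegrableOn (density f g α) (π '' W) ↔
      ∀ A ∈ 𝒜, IntegrableOn (density f g α) (π '' ((A ∩ N) ∩ W)) := by
    conv_lhs => rw [hWN]
    rw [Set.image_union, Set.image_iUnion₂, integrableOn_union, integrableOn_finite_biUnion hfin]
    refine and_iff_right ?_
    rw [IntegrableOn, Measure.restrict_eq_zero.2 hnull]
    exact integrable_zero_measure
  rw [hunion, forall₂_congr hpiece]
  conv_rhs => rw [hWN]
  rw [integrableOn_union, integrableOn_finite_biUnion hfin]
  exact (and_iff_right hzero).symm

theorem Res.hasThresholds {h : (Fin m → ℂ) → ℂ} (hh : Res h) :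
    ∀ {f g : (Fin m → ℂ) → ℂ}, HolGerm f → HolGerm g → (fun y => f y * g y) =ᶠ[𝓝 0] h →
      HasThresholds f g := by
  classical
  induction hh with
  | mono hh =>
    intro f g hf hg e
    obtain ⟨h1, h2⟩ := mono_of_mul hf hg (hh.congr e.symm)
    exact hasThresholds_of_mono h1 h2
  | step hh π hπ hc ih =>
    intro f g hf hg e
    have hA := hπ.admissible
    have key : ∀ c, HasThresholds (fun y => f (π c y)) (fun y => jac (π c) y * g (π c y)) := by
      intro c
      refine ih c (hf.comp (hA c).hol (hA c).zero)
        ((hA c).hol.jac.mul (hg.comp (hA c).hol (hA c).zero)) ?_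
      filter_upwards [(hA c).hol.tendsto (hA c).zero e] with y hy
      have hy : f (π c y) * g (π c y) = _ := hy
      rw [← hy]
      ring
    choose B hB0 hBne hBW hBV using key
    choose W hW hInt using hBW
    choose U hU hiff using fun c => (hA c).integrableOn_image_iff
    have hI : ∀ c, interior (W c ∩ U c) ∈ 𝓝 (0 : Fin m → ℂ) := fun c =>
      interior_mem_nhds.2 (inter_mem (hW c) (hU c))
    obtain ⟨S, hS⟩ := hπ.cover _ hI
    refine ⟨S.biUnion B, ?_, ?_, ⟨_, hS, fun α hα => ?_⟩, ?_⟩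
    · intro b hb
      obtain ⟨c, -, hc⟩ := Finset.mem_biUnion.1 hb
      exact hB0 c b hc
    · intro h0
      have := mem_of_mem_nhds hS
      simp only [Set.mem_iUnion, exists_prop] at this
      obtain ⟨c, hcS, -⟩ := this
      obtain ⟨b, hb⟩ := hBne c (by beta_reduce; rw [(hA c).zero, h0])
      exact ⟨b, Finset.mem_biUnion.2 ⟨c, hcS, hb⟩⟩
    · refine (integrableOn_finset_iUnion).2 fun c hcS => ?_
      refine (hiff c _ (interior_subset.trans Set.inter_subset_right)
        isOpen_interior.measurableSet f g α).2 ?_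
      exact (hInt c α fun b hb => hα b (Finset.mem_biUnion.2 ⟨c, hcS, hb⟩)).mono_set
        (interior_subset.trans Set.inter_subset_left)
    · rintro α ⟨V, hV, hVint⟩ b hb
      obtain ⟨c, hcS, hbc⟩ := Finset.mem_biUnion.1 hb
      have hpre : interior (π c ⁻¹' V ∩ U c) ∈ 𝓝 (0 : Fin m → ℂ) :=
        interior_mem_nhds.2 (inter_mem ((hA c).hol.tendsto (hA c).zero hV) (hU c))
      refine hBV c α ⟨_, hpre, ?_⟩ b hbc
      refine (hiff c _ (interior_subset.trans Set.inter_subset_right)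
        isOpen_interior.measurableSet f g α).1 (hVint.mono_set ?_)
      rintro _ ⟨y, hy, rfl⟩
      exact (interior_subset hy).1

theorem hasThresholds {f g : (Fin m → ℂ) → ℂ} (hf : HolGerm f) (hg : HolGerm g)
    (hf0 : ¬ f =ᶠ[𝓝 0] 0) (hg0 : ¬ g =ᶠ[𝓝 0] 0) : HasThresholds f g :=
  (resolvable m _ (hf.mul hg) fun h =>
    (hf.eventuallyEq_zero_or hg h).elim hf0 hg0).hasThresholds hf hg EventuallyEq.rfl

end resolution

/-- Germ-level version of (2.1.3) together with rationality and discreteness of jumping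
coefficients: for a holomorphic germ `g ≠ 0` at `x`, the set of `α` for which `g` satisfies
the multiplier condition for `(f, α)` at `x` is an open ray `(-∞, β)` with `β` a positive
rational number. -/
theorem multCond_set_is_ray
    {n : ℕ} (hn : 1 ≤ n)
    (U : Set (Fin n → ℂ)) (hU : IsOpen U)
    (f : (Fin n → ℂ) → ℂ) (hf : DifferentiableOn ℂ f U)
    (x : Fin n → ℂ) (hx : x ∈ U) (hf0 : f x = 0) (hne : ¬ (f =ᶠ[𝓝 x] 0))
    (g : (Fin n → ℂ) → ℂ) (hg : HolNear g x) (hgne : ¬ (g =ᶠ[𝓝 x] 0)) :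
    ∃ β : ℚ, 0 < β ∧ ∀ α : ℝ, MultCond f U g x α ↔ α < (β : ℝ) := by
  obtain ⟨D, hD, hxD, hgD⟩ := hg
  have hmap : map (x + ·) (𝓝 (0 : Fin n → ℂ)) = 𝓝 x := by rw [map_add_left_nhds, add_zero]
  have htend : Tendsto (x + ·) (𝓝 (0 : Fin n → ℂ)) (𝓝 x) := hmap.le
  have hgerm : ∀ (h : (Fin n → ℂ) → ℂ) (s : Set (Fin n → ℂ)), IsOpen s → x ∈ s →
      DifferentiableOn ℂ h s → HolGerm fun y => h (x + y) := by
    intro h s hs hxs hd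
    filter_upwards [htend (hs.mem_nhds hxs)] with y hy
    exact DifferentiableAt.comp y (hd.differentiableAt (hs.mem_nhds hy)) (by fun_prop)
  have hzero : ∀ h : (Fin n → ℂ) → ℂ, ¬ (h =ᶠ[𝓝 x] 0) → ¬ (fun y => h (x + y)) =ᶠ[𝓝 0] 0 := by
    intro h hh h0
    refine hh ?_
    rw [← hmap]
    exact h0
  have hInt : ∀ α (s : Set (Fin n → ℂ)),
      IntegrableOn (density (fun y => f (x + y)) (fun y => g (x + y)) α) ((x + ·) ⁻¹' s) ↔
        IntegrableOn (fun y => ‖g y‖ ^ 2 / ‖f y‖ ^ (2 * α)) s := fun α s =>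
    (measurePreserving_add_left volume x).integrableOn_comp_preimage
      (f := fun y => ‖g y‖ ^ 2 / ‖f y‖ ^ (2 * α)) (measurableEmbedding_addLeft x)
  obtain ⟨B, hB0, hBne, ⟨W, hW, hWint⟩, hBV⟩ := hasThresholds (hgerm f U hU hx hf)
    (hgerm g D hD hxD hgD) (hzero f hne) (hzero g hgne)
  have hBne : B.Nonempty := hBne (by simpa using hf0)
  refine ⟨B.min' hBne, hB0 _ (B.min'_mem hBne), fun α => ⟨?_, fun hα => ?_⟩⟩
  · rintro ⟨V, hV, hxV, -, -, hVint⟩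
    exact hBV α ⟨_, htend (hV.mem_nhds hxV), (hInt α V).2 hVint⟩ _ (B.min'_mem hBne)
  · have h1 := hWint α fun b hb => hα.trans_le (by exact_mod_cast B.min'_le b hb)
    obtain ⟨V, hVW, hV, hxV⟩ : ∃ V ⊆ (-x + ·) ⁻¹' W, IsOpen V ∧ x ∈ V := by
      refine mem_nhds_iff.1 ?_
      have : Tendsto (-x + ·) (𝓝 x) (𝓝 (-x + x)) := (continuous_const_add (-x)).tendsto x
      rw [neg_add_cancel] at this
      exact this hW
    refine ⟨V ∩ (U ∩ D), hV.inter (hU.inter hD), ⟨hxV, hx, hxD⟩, fun y hy => hy.2.1,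
      hgD.mono fun y hy => hy.2.2, (hInt α _).1 (h1.mono_set fun y hy => ?_)⟩
    simpa using hVW hy.1
end
end
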